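/- Let π/2 < w < π, let K ⊂ S² be a convex body of width w with area(K) ≤ area(U°_{π−w}) + ε for some ε > 0, and let L be a reduction of K. Then δ(K,L) ≤ c_w·√ε for some constant c_w > 0 depending only on w. -/

import Mathlib

open scoped RealInnerProductSpace
open Real MeasureTheory

noncomputable section

namespace SphericalPal

/-- Ambient Euclidean space of the sphere `Sⁿ`. -/
abbrev E (n : ℕ) := EuclideanSpace ℝ (Fin (n + 1))

/-- The unit sphere `Sⁿ ⊂ ℝⁿ⁺¹`. -/
def unitSphere (n : ℕ) : Set (E n) := Metric.sphere 0 1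

variable {n : ℕ}

/-- Geodesic (angular) distance on the unit sphere. -/
def gdist (x y : E n) : ℝ := Real.arccos ⟪x, y⟫

/-- The geodesic segment joining `x` and `y` on the sphere. -/
def seg (x y : E n) : Set (E n) :=
  {z ∈ unitSphere n | gdist x z + gdist z y = gdist x y}

/-- A subset of the sphere is spherically convex if it lies on the sphere, is contained
in an open hemisphere and contains the geodesic segment joining any two of its points. -/
def SConvex (X : Set (E n)) : Prop :=
  X ⊆ unitSphere n ∧
  (∃ u ∈ unitSphere n, ∀ x ∈ X, 0 < ⟪u, x⟫) ∧
  ∀ x ∈ X, ∀ y ∈ X, seg x y ⊆ X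

/-- Spherical convex hull. -/
def sconv (X : Set (E n)) : Set (E n) := ⋂₀ {C | SConvex C ∧ X ⊆ C}

/-- Relative (spherical) interior of a subset of the sphere. -/
def sInterior (X : Set (E n)) : Set (E n) :=
  {x ∈ X | ∃ ε > 0, ∀ y ∈ unitSphere n, gdist x y < ε → y ∈ X}

/-- A spherical convex body: compact, spherically convex, with nonempty relative interior. -/
def IsConvexBody (K : Set (E n)) : Prop :=
  SConvex K ∧ IsCompact K ∧ (sInterior K).Nonempty

/-- The lune determined by `u` and `v` (intersection of the closed hemispheres
opposite to `u` and to `v`). -/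
def lune (u v : E n) : Set (E n) := {x ∈ unitSphere n | ⟪x, u⟫ ≤ 0 ∧ ⟪x, v⟫ ≤ 0}

/-- The bounding hemisphere of `lune u v` contained in the great sphere orthogonal to `u`. -/
def luneFace (u v : E n) : Set (E n) := {x ∈ unitSphere n | ⟪x, u⟫ = 0 ∧ ⟪x, v⟫ ≤ 0}

/-- The center (midpoint) of the bounding hemisphere `luneFace u v`. -/
def luneFaceCenter (u v : E n) : E n :=
  ‖(⟪u, v⟫ • u - v : E n)‖⁻¹ • (⟪u, v⟫ • u - v)

/-- The breadth of the lune `lune u v`: the geodesic distance of the centers of the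
two bounding hemispheres. -/
def breadth (u v : E n) : ℝ := gdist (luneFaceCenter u v) (luneFaceCenter v u)

/-- `lune u v` is a supporting lune of `K`. -/
def IsSupportingLune (K : Set (E n)) (u v : E n) : Prop :=
  u ∈ unitSphere n ∧ v ∈ unitSphere n ∧ u ≠ v ∧ u ≠ -v ∧
  K ⊆ lune u v ∧ (K ∩ luneFace u v).Nonempty ∧ (K ∩ luneFace v u).Nonempty

/-- The (minimal) width of a spherical convex body. -/
def width (K : Set (E n)) : ℝ :=
  sInf {b | ∃ u v : E n, IsSupportingLune K u v ∧ b = breadth u v}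

/-- The width of `K` with respect to the supporting great hypersphere orthogonal to `u`:
the minimal breadth among supporting lunes of `K` having one bounding hemisphere
contained in that great hypersphere. -/
def widthAt (K : Set (E n)) (u : E n) : ℝ :=
  sInf {b | ∃ v : E n, IsSupportingLune K u v ∧ b = breadth u v}

/-- The great hypersphere orthogonal to `u` supports `K`. -/
def IsSupportingSphere (K : Set (E n)) (u : E n) : Prop :=
  u ∈ unitSphere n ∧ (∀ x ∈ K, ⟪x, u⟫ ≤ 0) ∧ ∃ x ∈ K, ⟪x, u⟫ = 0

/-- `K` is of constant width `w`. -/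
def HasConstantWidth (K : Set (E n)) (w : ℝ) : Prop :=
  ∀ u : E n, IsSupportingSphere K u → widthAt K u = w

/-- `K` is a reduced convex body. -/
def IsReduced (K : Set (E n)) : Prop :=
  IsConvexBody K ∧ ∀ L : Set (E n), IsConvexBody L → L ⊆ K → L ≠ K → width L < width K

/-- The spherical polar set. -/
def polar (A : Set (E n)) : Set (E n) := {u ∈ unitSphere n | ∀ a ∈ A, ⟪a, u⟫ ≤ 0}

/-- Closed geodesic ball on the sphere. -/
def gball (p : E n) (r : ℝ) : Set (E n) := {x ∈ unitSphere n | gdist p x ≤ r}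

/-- The inradius of `K`: the largest `r` such that some geodesic ball of radius `r`
is contained in `K`. -/
def inradius (K : Set (E n)) : ℝ :=
  sSup {r | 0 ≤ r ∧ ∃ p ∈ unitSphere n, gball p r ⊆ K}

/-- Geodesic distance from a point to a set. -/
def sdist (x : E n) (A : Set (E n)) : ℝ := sInf (gdist x '' A)

/-- Hausdorff distance with respect to the geodesic metric. -/
def hausdorffG (A B : Set (E n)) : ℝ :=
  max (sSup ((fun x => sdist x B) '' A)) (sSup ((fun y => sdist y A) '' B))

/-- Two subsets of the sphere are congruent, i.e., isometric by an orthogonal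
transformation of the ambient Euclidean space. -/
def Congruent (A B : Set (E n)) : Prop :=
  ∃ f : E n ≃ₗᵢ[ℝ] E n, f '' A = B

/-- Spherical surface measure on `S²` (2-dimensional Hausdorff measure). -/
def area (X : Set (E 2)) : ℝ := (μH[2] X).toReal

/-- The spherical angle `∠(x, p, y)` at `p` between the geodesic segments `[p,x]`, `[p,y]`. -/
def sangle (x p y : E 2) : ℝ :=
  InnerProductGeometry.angle (x - ⟪p, x⟫ • p) (y - ⟪p, y⟫ • p)

/-- `T` is a regular spherical triangle: the spherical convex hull of three points
with equal pairwise geodesic distances, not lying on a common great circle. -/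
def IsRegularTriangle (T : Set (E 2)) : Prop :=
  ∃ v₁ v₂ v₃ : E 2, v₁ ∈ unitSphere 2 ∧ v₂ ∈ unitSphere 2 ∧ v₃ ∈ unitSphere 2 ∧
    LinearIndependent ℝ ![v₁, v₂, v₃] ∧
    gdist v₁ v₂ = gdist v₂ v₃ ∧ gdist v₂ v₃ = gdist v₁ v₃ ∧
    T = sconv {v₁, v₂, v₃}

/-- Three points on the sphere with equal pairwise geodesic distance `a`
(the vertices of a regular spherical triangle of side length `a`). -/
def IsRegularCenters (x₁ x₂ x₃ : E 2) (a : ℝ) : Prop :=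
  x₁ ∈ unitSphere 2 ∧ x₂ ∈ unitSphere 2 ∧ x₃ ∈ unitSphere 2 ∧
  gdist x₁ x₂ = a ∧ gdist x₂ x₃ = a ∧ gdist x₁ x₃ = a

/-- `U` is a spherical Reuleaux triangle: intersection of three geodesic balls of radius `r`
whose centers have pairwise geodesic distance `r`. -/
def IsReuleaux (U : Set (E 2)) (r : ℝ) : Prop :=
  ∃ x₁ x₂ x₃ : E 2, IsRegularCenters x₁ x₂ x₃ r ∧
    U = gball x₁ r ∩ gball x₂ r ∩ gball x₃ r

/-- The body `U°_{π-w}` for `w > π/2`: the spherical convex hull of three geodesic balls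
of radius `w - π/2` (whose centers are meant to form a regular triangle of side `π - w`). -/
def polarReuleaux (x₁ x₂ x₃ : E 2) (w : ℝ) : Set (E 2) :=
  sconv (gball x₁ (w - π / 2) ∪ gball x₂ (w - π / 2) ∪ gball x₃ (w - π / 2))

end SphericalPal

open SphericalPal

set_option linter.all false

namespace SphericalPal

open Set

/-- cylindrical parametrisation of the sphere in coordinates, scaled by `p 0` -/
def cylG (p : Fin 3 → ℝ) : Fin 3 → ℝ :=
  ![p 0 * (√(1 - p 2 ^ 2) * Real.cos (p 1)), p 0 * (√(1 - p 2 ^ 2) * Real.sin (p 1)), p 0 * p 2]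

def cylM (p : Fin 3 → ℝ) : Matrix (Fin 3) (Fin 3) ℝ :=
  !![√(1 - p 2 ^ 2) * Real.cos (p 1), -(p 0 * (√(1 - p 2 ^ 2) * Real.sin (p 1))),
      -(p 0 * (p 2 / √(1 - p 2 ^ 2) * Real.cos (p 1)));
    √(1 - p 2 ^ 2) * Real.sin (p 1), (p 0 * (√(1 - p 2 ^ 2) * Real.cos (p 1))),
      -(p 0 * (p 2 / √(1 - p 2 ^ 2) * Real.sin (p 1)));
    p 2, 0, p 0]

def cylS : Set (Fin 3 → ℝ) :=
  {p | p 0 ∈ Ioo (0:ℝ) 1 ∧ p 1 ∈ Ioo (0:ℝ) (2 * π) ∧ p 2 ∈ Ioo (-1:ℝ) 1}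

lemma one_sub_sq_pos {h : ℝ} (hh : h ∈ Ioo (-1:ℝ) 1) : 0 < 1 - h ^ 2 := by
  obtain ⟨h1, h2⟩ := hh
  nlinarith

lemma measurableSet_cylS : MeasurableSet cylS := by
  refine MeasurableSet.inter ?_ (MeasurableSet.inter ?_ ?_)
  · exact measurableSet_Ioo.preimage (measurable_pi_apply 0)
  · exact measurableSet_Ioo.preimage (measurable_pi_apply 1)
  · exact measurableSet_Ioo.preimage (measurable_pi_apply 2)

lemma cylG_hasFDerivAt (p : Fin 3 → ℝ) (hp : p 2 ∈ Ioo (-1:ℝ) 1) :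
    HasFDerivAt cylG (Matrix.toLin' (cylM p)).toContinuousLinearMap p := by
  have h0 : HasFDerivAt (fun p : Fin 3 → ℝ => p 0) (ContinuousLinearMap.proj 0 : (Fin 3 → ℝ) →L[ℝ] ℝ) p :=
    hasFDerivAt_apply 0 p
  have h1 : HasFDerivAt (fun p : Fin 3 → ℝ => p 1) (ContinuousLinearMap.proj 1 : (Fin 3 → ℝ) →L[ℝ] ℝ) p :=
    hasFDerivAt_apply 1 p
  have h2 : HasFDerivAt (fun p : Fin 3 → ℝ => p 2) (ContinuousLinearMap.proj 2 : (Fin 3 → ℝ) →L[ℝ] ℝ) p :=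
    hasFDerivAt_apply 2 p
  have hpos := one_sub_sq_pos hp
  have hq := ((h2.pow 2).const_sub 1).sqrt hpos.ne'
  have hs : (0:ℝ) < √(1 - p 2 ^ 2) := Real.sqrt_pos.2 hpos
  rw [hasFDerivAt_pi']
  intro i
  fin_cases i
  · refine (h0.mul (hq.mul h1.cos)).congr_fderiv ?_
    ext v
    simp [cylM, Matrix.toLin'_apply, Matrix.mulVec, dotProduct, Fin.sum_univ_three]
    field_simp
    ring
  · refine (h0.mul (hq.mul h1.sin)).congr_fderiv ?_
    ext v
    simp [cylM, Matrix.toLin'_apply, Matrix.mulVec, dotProduct, Fin.sum_univ_three]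
    field_simp
    ring
  · refine (h0.mul h2).congr_fderiv ?_
    ext v
    simp [cylM, Matrix.toLin'_apply, Matrix.mulVec, dotProduct, Fin.sum_univ_three]
    ring

lemma cylM_det (p : Fin 3 → ℝ) (hp : p 2 ∈ Ioo (-1:ℝ) 1) : (cylM p).det = p 0 ^ 2 := by
  have hpos := one_sub_sq_pos hp
  have hs : (0:ℝ) < √(1 - p 2 ^ 2) := Real.sqrt_pos.2 hpos
  have hsq : √(1 - p 2 ^ 2) ^ 2 = 1 - p 2 ^ 2 := Real.sq_sqrt hpos.le
  have h := Real.sin_sq_add_cos_sq (p 1)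
  rw [Matrix.det_fin_three]
  simp [cylM]
  field_simp
  generalize √(1 - p 2 ^ 2) = q at *
  generalize Real.sin (p 1) = s at *
  generalize Real.cos (p 1) = c at *
  linear_combination (p 0^2 * q^2 + p 0^2 * p 2^2) * h + p 0^2 * hsq

lemma cos_sin_inj {a b l : ℝ} (ha : a ∈ Ioo l (l + 2 * π)) (hb : b ∈ Ioo l (l + 2 * π))
    (hc : Real.cos a = Real.cos b) (hs : Real.sin a = Real.sin b) : a = b := by
  have h := Real.Angle.cos_sin_inj hc hs
  rw [Real.Angle.angle_eq_iff_two_pi_dvd_sub] at h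
  obtain ⟨k, hk⟩ := h
  have hpi := Real.pi_pos
  obtain ⟨h1, h2⟩ := ha
  obtain ⟨h3, h4⟩ := hb
  have k1 : (k:ℝ) < 1 := by nlinarith
  have k2 : (-1:ℝ) < k := by nlinarith
  have k1' : k < 1 := by exact_mod_cast k1
  have k2' : -1 < k := by exact_mod_cast k2
  have : k = 0 := by omega
  subst this
  simp at hk
  linarith

lemma cylG_norm (p : Fin 3 → ℝ) (hp : p 2 ∈ Ioo (-1:ℝ) 1) :
    cylG p 0 ^ 2 + cylG p 1 ^ 2 + cylG p 2 ^ 2 = p 0 ^ 2 := by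
  have hpos := one_sub_sq_pos hp
  have hsq : √(1 - p 2 ^ 2) ^ 2 = 1 - p 2 ^ 2 := Real.sq_sqrt hpos.le
  have h := Real.sin_sq_add_cos_sq (p 1)
  simp [cylG]
  generalize √(1 - p 2 ^ 2) = q at *
  linear_combination (p 0^2 * q^2) * h + p 0^2 * hsq

lemma cylG_injOn : InjOn cylG cylS := by
  rintro p ⟨⟨hp0, hp0'⟩, hp1, hp2⟩ q ⟨⟨hq0, hq0'⟩, hq1, hq2⟩ h
  have e1 := cylG_norm p hp2
  have e2 := cylG_norm q hq2
  rw [h, e2] at e1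
  have e0 : p 0 = q 0 := by nlinarith
  have c2 : cylG p 2 = cylG q 2 := by rw [h]
  have c0 : cylG p 0 = cylG q 0 := by rw [h]
  have c1 : cylG p 1 = cylG q 1 := by rw [h]
  simp only [cylG, Matrix.cons_val] at c0 c1 c2
  rw [e0] at c0 c1 c2
  have f2 : p 2 = q 2 := mul_left_cancel₀ hq0.ne' c2
  rw [f2] at c0 c1
  have hs : (0:ℝ) < √(1 - q 2 ^ 2) := Real.sqrt_pos.2 (one_sub_sq_pos hq2)
  have d0 : Real.cos (p 1) = Real.cos (q 1) :=
    mul_left_cancel₀ hs.ne' (mul_left_cancel₀ hq0.ne' c0)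
  have d1 : Real.sin (p 1) = Real.sin (q 1) :=
    mul_left_cancel₀ hs.ne' (mul_left_cancel₀ hq0.ne' c1)
  have f1 := cos_sin_inj (l := 0) (by simpa using hp1) (by simpa using hq1) d0 d1
  ext i
  fin_cases i
  · exact e0
  · exact f1
  · exact f2

/-- an angle in `(0,2π)` for a non-real unit vector of the plane -/
lemma exists_angle {x y : ℝ} (h : x ^ 2 + y ^ 2 = 1) (hy : y ≠ 0) :
    ∃ a ∈ Ioo (0:ℝ) (2 * π), Real.cos a = x ∧ Real.sin a = y := by
  have hx1 : -1 ≤ x := by nlinarith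
  have hx2 : x ≤ 1 := by nlinarith
  have hx1' : -1 < x := by
    rcases hx1.lt_or_eq with h' | h'
    · exact h'
    · exfalso; apply hy; subst h'; nlinarith
  have hx2' : x < 1 := by
    rcases hx2.lt_or_eq with h' | h'
    · exact h'
    · exfalso; apply hy; subst h'; nlinarith
  have hs : √(1 - x ^ 2) = |y| := by
    rw [← Real.sqrt_sq_eq_abs]; congr 1; linarith
  have ha := Real.arccos_pos.2 hx2'
  have hb := Real.arccos_le_pi x
  have hpi := Real.pi_pos
  rcases lt_or_gt_of_ne hy with h' | h'
  · refine ⟨2 * π - Real.arccos x, ⟨by linarith, by linarith⟩, ?_, ?_⟩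
    · rw [Real.cos_two_pi_sub, Real.cos_arccos hx1 hx2]
    · rw [Real.sin_two_pi_sub, Real.sin_arccos, hs, abs_of_neg h', neg_neg]
  · refine ⟨Real.arccos x, ⟨by linarith, by linarith⟩, Real.cos_arccos hx1 hx2, ?_⟩
    rw [Real.sin_arccos, hs, abs_of_pos h']

lemma cylG_surj (x : Fin 3 → ℝ) (hx : x 0 ^ 2 + x 1 ^ 2 + x 2 ^ 2 < 1) (h1 : x 1 ≠ 0) :
    ∃ p ∈ cylS, cylG p = x := by
  have hy : 0 < x 1 ^ 2 := by positivity
  have hq0 : 0 < x 0 ^ 2 + x 1 ^ 2 := by positivity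
  have hr0 : 0 < x 0 ^ 2 + x 1 ^ 2 + x 2 ^ 2 := by positivity
  set q := √(x 0 ^ 2 + x 1 ^ 2) with hq
  set r := √(x 0 ^ 2 + x 1 ^ 2 + x 2 ^ 2) with hr
  have hqp : 0 < q := Real.sqrt_pos.2 hq0
  have hrp : 0 < r := Real.sqrt_pos.2 hr0
  have hq2 : q ^ 2 = x 0 ^ 2 + x 1 ^ 2 := Real.sq_sqrt hq0.le
  have hr2 : r ^ 2 = x 0 ^ 2 + x 1 ^ 2 + x 2 ^ 2 := Real.sq_sqrt hr0.le
  have hr1 : r < 1 := by nlinarith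
  obtain ⟨a, ha, hc, hs⟩ := exists_angle (x := x 0 / q) (y := x 1 / q)
    (by field_simp; linarith) (by positivity)
  have hq' : √(1 - (x 2 / r) ^ 2) = q / r := by
    rw [show 1 - (x 2 / r) ^ 2 = (q / r) ^ 2 by field_simp; linarith]
    exact Real.sqrt_sq (by positivity)
  refine ⟨![r, a, x 2 / r], ⟨⟨?_, ?_⟩, ?_, ?_, ?_⟩, ?_⟩
  · simpa using hrp
  · simpa using hr1
  · simpa using ha
  · simp only [Matrix.cons_val]
    rw [lt_div_iff₀ hrp]
    nlinarith
  · simp only [Matrix.cons_val]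
    rw [div_lt_iff₀ hrp]
    nlinarith
  · ext i
    fin_cases i
    · simp [cylG, hq', hc]; field_simp
    · simp [cylG, hq', hs]; field_simp
    · simp [cylG]; field_simp



/-- radial projection -/
def nrm (x : E 2) : E 2 := ‖x‖⁻¹ • x

/-- normalised spherical measure (total mass `4π`), via cone volumes -/
def sig : Measure (E 2) := (3 : ENNReal) • (volume.restrict (Metric.ball (0 : E 2) 1)).map nrm

/-- cylindrical parametrisation of the unit sphere for the frame `e, f, c` -/
def Psi (e f c : E 2) (p : ℝ × ℝ) : E 2 :=
  √(1 - p.2 ^ 2) • (Real.cos p.1 • e + Real.sin p.1 • f) + p.2 • c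

/-- parameter rectangle -/
def rect : Set (ℝ × ℝ) := Ioo (0:ℝ) (2 * π) ×ˢ Ioo (-1:ℝ) 1

lemma measurable_nrm : Measurable nrm := by
  unfold nrm
  exact (measurable_norm.inv).smul measurable_id

lemma continuous_Psi (e f c : E 2) : Continuous (Psi e f c) := by
  unfold Psi
  fun_prop

lemma sig_apply {X : Set (E 2)} (hX : MeasurableSet X) :
    sig X = 3 * volume (nrm ⁻¹' X ∩ Metric.ball 0 1) := by
  simp only [sig, Measure.smul_apply, smul_eq_mul]
  rw [Measure.map_apply measurable_nrm hX, Measure.restrict_apply (measurable_nrm hX)]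

def bb (i : Fin 3) : E 2 := EuclideanSpace.single i (1:ℝ)

lemma toLp_cylG (p : Fin 3 → ℝ) :
    (WithLp.toLp 2 (cylG p) : E 2) = p 0 • Psi (bb 0) (bb 1) (bb 2) (p 1, p 2) := by
  ext i
  fin_cases i <;> simp [cylG, Psi, bb]

lemma Psi_std_norm (p : ℝ × ℝ) (hp : p.2 ∈ Ioo (-1:ℝ) 1) : ‖Psi (bb 0) (bb 1) (bb 2) p‖ = 1 := by
  have h := cylG_norm ![1, p.1, p.2] (by simpa using hp)
  have h2 := toLp_cylG ![1, p.1, p.2]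
  simp only [Matrix.cons_val, one_smul] at h2
  rw [← h2, EuclideanSpace.norm_eq]
  rw [Fin.sum_univ_three]
  simp only [Real.norm_eq_abs, sq_abs]
  rw [h]; simp

lemma nrm_pos_smul {a : ℝ} (ha : 0 < a) (x : E 2) : nrm (a • x) = nrm x := by
  unfold nrm
  rw [norm_smul, Real.norm_eq_abs, abs_of_pos ha, smul_smul]
  congr 1
  field_simp

lemma nrm_of_unit {x : E 2} (hx : ‖x‖ = 1) : nrm x = x := by simp [nrm, hx]

lemma lintegral_fin_three (F : ℝ → ENNReal) (H : ℝ × ℝ → ENNReal) (hF : Measurable F) (hH : Measurable H) :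
    ∫⁻ p : Fin 3 → ℝ, F (p 0) * H (p 1, p 2) = (∫⁻ r, F r) * ∫⁻ q, H q := by
  have h1 := (volume_preserving_piFinSuccAbove (fun _ : Fin 3 => ℝ) 0)
  have h2 := (volume_preserving_finTwoArrow ℝ)
  have h3 : MeasurePreserving (fun p : Fin 3 → ℝ => (p 0, (p 1, p 2))) volume volume := by
    have := ((MeasurePreserving.id (volume : Measure ℝ)).prod h2).comp h1
    exact this
  have := h3.lintegral_comp (f := fun x : ℝ × (ℝ × ℝ) => F x.1 * H x.2) (by fun_prop)
  rw [this]
  exact lintegral_prod_mul hF.aemeasurable hH.aemeasurable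

lemma lint_sq : ∫⁻ r : ℝ, (Ioo (0:ℝ) 1).indicator (fun r => ENNReal.ofReal (r ^ 2)) r = ENNReal.ofReal (1/3) := by
  rw [lintegral_indicator measurableSet_Ioo, ← ofReal_integral_eq_lintegral_ofReal]
  · rw [← integral_Ioc_eq_integral_Ioo, ← intervalIntegral.integral_of_le zero_le_one, integral_pow]
    norm_num
  · exact (continuousOn_id.pow 2).integrableOn_Icc.mono_set Ioo_subset_Icc_self
  · filter_upwards with x using sq_nonneg x

lemma arch_std {X : Set (E 2)} (hX : MeasurableSet X) :
    sig X = volume (Psi (bb 0) (bb 1) (bb 2) ⁻¹' X ∩ rect) := by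
  classical
  rw [sig_apply hX]
  set A : Set (E 2) := nrm ⁻¹' X ∩ Metric.ball 0 1 with hA
  have mA : MeasurableSet A := (measurable_nrm hX).inter measurableSet_ball
  have hvol : volume A = volume ((WithLp.toLp 2 : (Fin 3 → ℝ) → E 2) ⁻¹' A) :=
    ((PiLp.volume_preserving_toLp (Fin 3)).measure_preimage mA.nullMeasurableSet).symm
  set B := (WithLp.toLp 2 : (Fin 3 → ℝ) → E 2) ⁻¹' A with hB
  have mB : MeasurableSet B := (PiLp.volume_preserving_toLp (Fin 3)).measurable mA
  have hder : ∀ x ∈ cylS, HasFDerivWithinAt cylG (Matrix.toLin' (cylM x)).toContinuousLinearMap cylS x :=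
    fun x hx => (cylG_hasFDerivAt x hx.2.2).hasFDerivWithinAt
  have hnull : volume {x : Fin 3 → ℝ | x 1 = 0} = 0 := by
    have := Measure.addHaar_submodule (volume : Measure (Fin 3 → ℝ))
      (LinearMap.ker (LinearMap.proj 1 : (Fin 3 → ℝ) →ₗ[ℝ] ℝ)) (by
        intro h
        have h2 : (fun _ => 1 : Fin 3 → ℝ) ∈ LinearMap.ker (LinearMap.proj 1 : (Fin 3 → ℝ) →ₗ[ℝ] ℝ) := by
          rw [h]; trivial
        simp at h2)
    exact this
  have mG : MeasurableSet (cylG '' cylS) :=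
    measurable_image_of_fderivWithin measurableSet_cylS hder cylG_injOn
  have hBG : volume B = volume (B ∩ cylG '' cylS) := by
    apply le_antisymm _ (measure_mono inter_subset_left)
    calc volume B ≤ volume ((B ∩ cylG '' cylS) ∪ {x : Fin 3 → ℝ | x 1 = 0}) := by
          apply measure_mono
          intro x hx
          by_cases h1 : x 1 = 0
          · right; exact h1
          · left
            refine ⟨hx, ?_⟩
            have := hx.2
            simp only [Metric.mem_ball, dist_zero_right] at this
            rw [EuclideanSpace.norm_eq, Fin.sum_univ_three] at this
            simp only [Real.norm_eq_abs, sq_abs] at this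
            rw [Real.sqrt_lt' one_pos] at this
            obtain ⟨p, hp, hpx⟩ := cylG_surj x (by simpa using this) h1
            exact ⟨p, hp, hpx⟩
      _ ≤ _ := by
          refine (measure_union_le _ _).trans ?_
          rw [hnull, add_zero]
  have key := lintegral_image_eq_lintegral_abs_det_fderiv_mul (volume : Measure (Fin 3 → ℝ))
    measurableSet_cylS hder cylG_injOn (B.indicator 1)
  rw [lintegral_indicator_one mB, Measure.restrict_apply mB] at key
  have mPsi := (continuous_Psi (bb 0) (bb 1) (bb 2)).measurable
  have mR : MeasurableSet rect := measurableSet_Ioo.prod measurableSet_Ioo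
  set Y := Psi (bb 0) (bb 1) (bb 2) ⁻¹' X ∩ rect with hY
  have mY : MeasurableSet Y := (mPsi hX).inter mR
  have key2 : ∫⁻ x in cylS, ENNReal.ofReal |((Matrix.toLin' (cylM x)).toContinuousLinearMap).det| * B.indicator 1 (cylG x)
      = ∫⁻ p : Fin 3 → ℝ, (Ioo (0:ℝ) 1).indicator (fun r => ENNReal.ofReal (r ^ 2)) (p 0) * Y.indicator 1 (p 1, p 2) := by
    rw [← lintegral_indicator measurableSet_cylS]
    congr 1
    ext p
    by_cases hp : p ∈ cylS
    · rw [indicator_of_mem hp, indicator_of_mem hp.1]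
      have hd : ((Matrix.toLin' (cylM p)).toContinuousLinearMap).det = p 0 ^ 2 := by
        rw [LinearMap.det_toContinuousLinearMap, LinearMap.det_toLin', cylM_det p hp.2.2]
      rw [hd, abs_of_nonneg (sq_nonneg _)]
      congr 1
      have hn : ‖Psi (bb 0) (bb 1) (bb 2) (p 1, p 2)‖ = 1 := Psi_std_norm (p 1, p 2) hp.2.2
      have hiff : cylG p ∈ B ↔ (p 1, p 2) ∈ Y := by
        simp only [hB, hA, hY, mem_preimage, mem_inter_iff, toLp_cylG]
        rw [nrm_pos_smul hp.1.1, nrm_of_unit hn]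
        apply and_congr Iff.rfl
        constructor
        · intro _; exact ⟨hp.2.1, hp.2.2⟩
        · intro _
          rw [mem_ball_zero_iff, norm_smul, hn, Real.norm_eq_abs, abs_of_pos hp.1.1, mul_one]
          exact hp.1.2
      by_cases h : cylG p ∈ B
      · rw [indicator_of_mem h, indicator_of_mem (hiff.1 h)]; rfl
      · rw [indicator_of_notMem h, indicator_of_notMem (fun h' => h (hiff.2 h'))]
    · rw [indicator_of_notMem hp]
      symm
      by_cases h0 : p 0 ∈ Ioo (0:ℝ) 1
      · have : (p 1, p 2) ∉ Y := fun h => hp ⟨h0, h.2.1, h.2.2⟩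
        rw [indicator_of_notMem this, mul_zero]
      · rw [indicator_of_notMem h0, zero_mul]
  rw [key2, lintegral_fin_three _ _ (Measurable.indicator (by fun_prop) measurableSet_Ioo)
    (measurable_one.indicator mY), lint_sq, lintegral_indicator_one mY] at key
  rw [hvol, hBG, key, ← mul_assoc]
  have : (3 : ENNReal) * ENNReal.ofReal (1/3) = 1 := by
    rw [show (3:ENNReal) = ENNReal.ofReal 3 by simp, ← ENNReal.ofReal_mul (by norm_num)]
    norm_num
  rw [this, one_mul]

lemma sig_map_isometry (f : E 2 ≃ₗᵢ[ℝ] E 2) {X : Set (E 2)} (hX : MeasurableSet X) :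
    sig (f ⁻¹' X) = sig X := by
  rw [sig_apply hX, sig_apply (f.continuous.measurable hX)]
  congr 1
  rw [← f.measurePreserving.measure_preimage ((measurable_nrm hX).inter measurableSet_ball).nullMeasurableSet]
  congr 1
  ext x
  simp [nrm]

/-- orthonormal frame -/
structure Frame (e f c : E 2) : Prop where
  ee : ⟪e, e⟫ = 1
  ff : ⟪f, f⟫ = 1
  cc : ⟪c, c⟫ = 1
  ef : ⟪e, f⟫ = 0
  ec : ⟪e, c⟫ = 0
  fc : ⟪f, c⟫ = 0

lemma Frame.orthonormal {e f c : E 2} (h : Frame e f c) : Orthonormal ℝ ![e, f, c] := by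
  rw [orthonormal_iff_ite]
  intro i j
  have h1 := h.ef; have h2 := h.ec; have h3 := h.fc
  fin_cases i <;> fin_cases j <;> simp [h.ee, h.ff, h.cc, h1, h2, h3, real_inner_comm, -inner_self_eq_norm_sq_to_K, -real_inner_self_eq_norm_sq] <;>
    first | (rw [real_inner_comm]; assumption) | exact_mod_cast (by simpa [real_inner_self_eq_norm_sq] using h.ee) | skip




/-- orthonormal basis from a frame -/
def Frame.basis {e f c : E 2} (h : Frame e f c) : OrthonormalBasis (Fin 3) ℝ (E 2) :=
  OrthonormalBasis.mk h.orthonormal (by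
    have := (basisOfOrthonormalOfCardEqFinrank h.orthonormal (by simp)).span_eq
    rw [coe_basisOfOrthonormalOfCardEqFinrank] at this
    exact this.ge)

lemma Frame.basis_coe {e f c : E 2} (h : Frame e f c) : ⇑h.basis = ![e, f, c] := by
  simp [Frame.basis]

lemma Frame.decomp {e f c : E 2} (h : Frame e f c) (z : E 2) :
    z = ⟪z, e⟫ • e + ⟪z, f⟫ • f + ⟪z, c⟫ • c := by
  have := h.basis.sum_repr' z
  rw [Fin.sum_univ_three, h.basis_coe] at this
  simp only [Matrix.cons_val] at this
  rw [real_inner_comm e z, real_inner_comm f z, real_inner_comm c z, this]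

lemma Frame.inner_eq {e f c : E 2} (h : Frame e f c) (z z' : E 2) :
    ⟪z, z'⟫ = ⟪z, e⟫ * ⟪z', e⟫ + ⟪z, f⟫ * ⟪z', f⟫ + ⟪z, c⟫ * ⟪z', c⟫ := by
  conv_lhs => rw [h.decomp z']
  simp only [inner_add_right, inner_smul_right]
  ring

lemma arch {e f c : E 2} (h : Frame e f c) {X : Set (E 2)} (hX : MeasurableSet X) :
    sig X = volume (Psi e f c ⁻¹' X ∩ rect) := by
  have h1 := sig_map_isometry (h.basis.repr.symm) hX
  rw [← h1, arch_std (h.basis.repr.symm.continuous.measurable hX)]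
  congr 2
  ext p
  simp only [mem_preimage]
  have hb : ∀ i, h.basis.repr.symm (bb i) = h.basis i := by
    intro i; unfold bb; exact h.basis.repr_symm_single i
  have : h.basis.repr.symm (Psi (bb 0) (bb 1) (bb 2) p) = Psi e f c p := by
    unfold Psi
    simp only [map_add, map_smul, hb, h.basis_coe, Matrix.cons_val]
  rw [this]

lemma Psi_inner_e {e f c : E 2} (h : Frame e f c) (p : ℝ × ℝ) :
    ⟪Psi e f c p, e⟫ = √(1 - p.2 ^ 2) * Real.cos p.1 := by
  unfold Psi
  simp only [inner_add_left, inner_smul_left, h.ee, real_inner_comm e f, real_inner_comm e c, h.ef, h.ec]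
  simp

lemma Psi_inner_f {e f c : E 2} (h : Frame e f c) (p : ℝ × ℝ) :
    ⟪Psi e f c p, f⟫ = √(1 - p.2 ^ 2) * Real.sin p.1 := by
  unfold Psi
  simp only [inner_add_left, inner_smul_left, h.ff, real_inner_comm f c, h.ef, h.fc]
  simp

lemma Psi_inner_c {e f c : E 2} (h : Frame e f c) (p : ℝ × ℝ) :
    ⟪Psi e f c p, c⟫ = p.2 := by
  unfold Psi
  simp only [inner_add_left, inner_smul_left, h.cc, h.ec, h.fc]
  simp

lemma rect_sqrt_pos {p : ℝ × ℝ} (hp : p ∈ rect) : 0 < √(1 - p.2 ^ 2) := by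
  apply Real.sqrt_pos.2
  have := hp.2
  simp only [mem_Ioo] at this
  nlinarith

lemma Psi_norm {e f c : E 2} (h : Frame e f c) {p : ℝ × ℝ} (hp : p ∈ rect) : ‖Psi e f c p‖ = 1 := by
  have h1 : ⟪Psi e f c p, Psi e f c p⟫ = 1 := by
    rw [h.inner_eq, Psi_inner_e h, Psi_inner_f h, Psi_inner_c h]
    have h2 : √(1 - p.2 ^ 2) * √(1 - p.2 ^ 2) = 1 - p.2 ^ 2 :=
      Real.mul_self_sqrt (Real.sqrt_pos.1 (rect_sqrt_pos hp)).le
    have := Real.sin_sq_add_cos_sq p.1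
    linear_combination (Real.cos p.1 ^2 + Real.sin p.1 ^ 2) * h2 + (1 - p.2^2) * this
  rw [real_inner_self_eq_norm_sq] at h1
  nlinarith [norm_nonneg (Psi e f c p)]

lemma frame_std : Frame (bb 0) (bb 1) (bb 2) := by
  constructor <;> simp [bb, EuclideanSpace.inner_single_left]

lemma sig_univ : sig univ = ENNReal.ofReal (4 * π) := by
  rw [arch frame_std MeasurableSet.univ]
  simp only [preimage_univ, univ_inter, rect]
  rw [Measure.volume_eq_prod, Measure.prod_prod]
  simp only [Real.volume_Ioo]
  rw [← ENNReal.ofReal_mul (by linarith [Real.pi_pos])]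
  congr 1; ring

instance : IsFiniteMeasure sig := ⟨by rw [sig_univ]; exact ENNReal.ofReal_lt_top⟩

lemma sig_sphere_compl : sig (unitSphere 2)ᶜ = 0 := by
  have hm : MeasurableSet (unitSphere 2) := Metric.isClosed_sphere.measurableSet
  rw [arch frame_std hm.compl]
  have : Psi (bb 0) (bb 1) (bb 2) ⁻¹' (unitSphere 2)ᶜ ∩ rect = ∅ := by
    ext p
    simp only [mem_inter_iff, mem_preimage, mem_compl_iff, mem_empty_iff_false, iff_false, not_and]
    intro h hp
    apply h
    simp [unitSphere, Psi_norm frame_std hp]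
  rw [this]; simp

/-- azimuth set of a planar cone -/
def azi (e f : E 2) (Θ : Set (E 2)) : Set ℝ :=
  {t | t ∈ Ioo 0 (2 * π) ∧ Real.cos t • e + Real.sin t • f ∈ Θ}

lemma measurable_azi (e f : E 2) {Θ : Set (E 2)} (hΘ : MeasurableSet Θ) : MeasurableSet (azi e f Θ) := by
  apply measurableSet_Ioo.inter
  have : Continuous (fun t : ℝ => Real.cos t • e + Real.sin t • f) := by fun_prop
  exact this.measurable hΘ

/-- Key product formula. -/
lemma sig_prod {e f c : E 2} (h : Frame e f c) {Θ : Set (E 2)} (hΘ : MeasurableSet Θ)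
    (hcone : ∀ a : ℝ, 0 < a → ∀ z, a • z ∈ Θ ↔ z ∈ Θ) {I : Set ℝ} (hI : MeasurableSet I) :
    sig {z | z - ⟪z, c⟫ • c ∈ Θ ∧ ⟪z, c⟫ ∈ I} = volume (azi e f Θ) * volume (I ∩ Ioo (-1) 1) := by
  have hm : MeasurableSet {z : E 2 | z - ⟪z, c⟫ • c ∈ Θ ∧ ⟪z, c⟫ ∈ I} := by
    have h1 : Measurable (fun z : E 2 => z - ⟪z, c⟫ • c) := by fun_prop
    have h2 : Measurable (fun z : E 2 => ⟪z, c⟫) := by fun_prop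
    exact (h1 hΘ).inter (h2 hI)
  rw [arch h hm]
  have : Psi e f c ⁻¹' {z | z - ⟪z, c⟫ • c ∈ Θ ∧ ⟪z, c⟫ ∈ I} ∩ rect = azi e f Θ ×ˢ (I ∩ Ioo (-1) 1) := by
    ext p
    simp only [mem_inter_iff, mem_preimage, mem_setOf_eq, mem_prod, rect, azi, Psi_inner_c h]
    have key : p ∈ rect → (Psi e f c p - p.2 • c ∈ Θ ↔ Real.cos p.1 • e + Real.sin p.1 • f ∈ Θ) := by
      intro hp
      rw [← hcone _ (rect_sqrt_pos hp) (Real.cos p.1 • e + Real.sin p.1 • f)]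
      simp [Psi]
    constructor
    · rintro ⟨⟨h1, h2⟩, h3, h4⟩
      exact ⟨⟨h3, (key ⟨h3, h4⟩).1 h1⟩, h2, h4⟩
    · rintro ⟨⟨h3, h1⟩, h2, h4⟩
      exact ⟨⟨(key ⟨h3, h4⟩).2 h1, h2⟩, h3, h4⟩
  rw [this, Measure.volume_eq_prod, Measure.prod_prod]

/-- upper bound by a sector -/
lemma sig_le_sector {e f c : E 2} (h : Frame e f c) {X : Set (E 2)} (hX : MeasurableSet X)
    {a b i j : ℝ} (hab : a ≤ b) (hij : i ≤ j)
    (H : ∀ p ∈ rect, Psi e f c p ∈ X → p.1 ∈ Icc a b ∧ p.2 ∈ Icc i j) :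
    sig.real X ≤ (b - a) * (j - i) := by
  rw [Measure.real, arch h hX]
  apply ENNReal.toReal_le_of_le_ofReal (by nlinarith)
  calc volume (Psi e f c ⁻¹' X ∩ rect) ≤ volume (Icc a b ×ˢ Icc i j) := by
        apply measure_mono
        rintro p ⟨h1, h2⟩
        exact H p h2 h1
    _ = ENNReal.ofReal ((b - a) * (j - i)) := by
        rw [Measure.volume_eq_prod, Measure.prod_prod, Real.volume_Icc, Real.volume_Icc,
          ENNReal.ofReal_mul (by linarith)]

/-- lower bound by a sector -/
lemma sig_ge_sector {e f c : E 2} (h : Frame e f c) {X : Set (E 2)} (hX : MeasurableSet X)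
    {a b i j : ℝ} (hab : a ≤ b) (hij : i ≤ j) (ha : 0 ≤ a) (hb : b ≤ 2 * π) (hi : -1 ≤ i) (hj : j ≤ 1)
    (H : ∀ p ∈ rect, p.1 ∈ Ioo a b → p.2 ∈ Ioo i j → Psi e f c p ∈ X) :
    (b - a) * (j - i) ≤ sig.real X := by
  rw [Measure.real, arch h hX]
  have hfin : volume (Psi e f c ⁻¹' X ∩ rect) ≠ ⊤ := by
    rw [← arch h hX]; exact measure_ne_top _ _
  rw [← ENNReal.ofReal_le_iff_le_toReal hfin]
  calc ENNReal.ofReal ((b - a) * (j - i)) = volume (Ioo a b ×ˢ Ioo i j) := by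
        rw [Measure.volume_eq_prod, Measure.prod_prod, Real.volume_Ioo, Real.volume_Ioo,
          ENNReal.ofReal_mul (by linarith)]
    _ ≤ _ := by
        apply measure_mono
        rintro p ⟨h1, h2⟩
        have : p ∈ rect := ⟨⟨by linarith [h1.1], by linarith [h1.2]⟩, ⟨by linarith [h2.1], by linarith [h2.2]⟩⟩
        exact ⟨H p this h1 h2, this⟩

/-- every unit vector can be completed to a frame -/
lemma exists_frame {c : E 2} (hc : ‖c‖ = 1) : ∃ e f, Frame e f c := by
  have hcc : Orthonormal ℝ (fun _ : Fin 1 => c) := by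
    rw [orthonormal_iff_ite]; intro i j
    simp [Subsingleton.elim i j, real_inner_self_eq_norm_sq, hc]
  obtain ⟨B, hB⟩ := Orthonormal.exists_orthonormalBasis_extension_of_card_eq
    (𝕜 := ℝ) (E := E 2) (ι := Fin 3) (by simp) (v := ![0, 0, c]) (s := {2}) (by
      rw [orthonormal_iff_ite]; rintro ⟨i, hi⟩ ⟨j, hj⟩
      simp only [mem_singleton_iff] at hi hj
      subst hi; subst hj
      simp [real_inner_self_eq_norm_sq, hc])
  have h2 : B 2 = c := by simpa using hB 2 rfl
  have := fun i j => B.inner_eq_ite i j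
  refine ⟨B 0, B 1, ?_⟩
  rw [← h2]
  constructor <;> rw [this] <;> simp

/-- a frame with prescribed `c` and prescribed direction `e` -/
lemma exists_frame' {c e : E 2} (hc : ‖c‖ = 1) (he : ‖e‖ = 1) (hec : ⟪e, c⟫ = 0) : ∃ f, Frame e f c := by
  obtain ⟨B, hB⟩ := Orthonormal.exists_orthonormalBasis_extension_of_card_eq
    (𝕜 := ℝ) (E := E 2) (ι := Fin 3) (by simp) (v := ![e, 0, c]) (s := {0, 2}) (by
      have hec' : ⟪c, e⟫ = 0 := by rw [real_inner_comm]; exact hec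
      rw [orthonormal_iff_ite]; rintro ⟨i, hi⟩ ⟨j, hj⟩
      simp only [mem_insert_iff, mem_singleton_iff] at hi hj
      rcases hi with rfl | rfl <;> rcases hj with rfl | rfl <;> 
      simp [real_inner_self_eq_norm_sq, hc, he, hec, hec'])
  have h2 : B 2 = c := by simpa using hB 2 (by simp)
  have h0 : B 0 = e := by simpa using hB 0 (by simp)
  have := fun i j => B.inner_eq_ite i j
  refine ⟨B 1, ?_⟩
  rw [← h2, ← h0]
  constructor <;> rw [this] <;> simp


lemma mem_us {z : E 2} : z ∈ unitSphere 2 ↔ ‖z‖ = 1 := by simp [unitSphere]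

lemma measurable_us : MeasurableSet (unitSphere 2) := Metric.isClosed_sphere.measurableSet

lemma exists_isom {x y : E 2} (hx : x ∈ unitSphere 2) (hy : y ∈ unitSphere 2) :
    ∃ g : E 2 ≃ₗᵢ[ℝ] E 2, g x = y := by
  obtain ⟨e, f, h⟩ := exists_frame (mem_us.1 hx)
  obtain ⟨e', f', h'⟩ := exists_frame (mem_us.1 hy)
  refine ⟨h.basis.repr.trans h'.basis.repr.symm, ?_⟩
  have h2 : h.basis 2 = x := by rw [h.basis_coe]; rfl
  have h2' : h'.basis 2 = y := by rw [h'.basis_coe]; rfl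
  calc (h.basis.repr.trans h'.basis.repr.symm) x
      = (h.basis.repr.trans h'.basis.repr.symm) (h.basis 2) := by rw [h2]
    _ = h'.basis 2 := by simp
    _ = y := h2'

lemma hausdorff_sphere_lt_top : (μH[2] : Measure (E 2)) (unitSphere 2) < ⊤ := by
  let G : ℝ × ℝ → E 2 := fun p => Real.sin p.1 • (Real.cos p.2 • bb 0 + Real.sin p.2 • bb 1) + Real.cos p.1 • bb 2
  have hG : ContDiff ℝ 1 G := by
    have h1 : ContDiff ℝ 1 (fun p : ℝ × ℝ => Real.sin p.1) := Real.contDiff_sin.comp contDiff_fst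
    have h2 : ContDiff ℝ 1 (fun p : ℝ × ℝ => Real.cos p.1) := Real.contDiff_cos.comp contDiff_fst
    have h3 : ContDiff ℝ 1 (fun p : ℝ × ℝ => Real.sin p.2) := Real.contDiff_sin.comp contDiff_snd
    have h4 : ContDiff ℝ 1 (fun p : ℝ × ℝ => Real.cos p.2) := Real.contDiff_cos.comp contDiff_snd
    exact (h1.smul ((h4.smul contDiff_const).add (h3.smul contDiff_const))).add (h2.smul contDiff_const)
  have hL := hG.locallyLipschitz
  set K : Set (ℝ × ℝ) := Icc 0 π ×ˢ Icc (-π) π with hK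
  have hKc : IsCompact K := isCompact_Icc.prod isCompact_Icc
  have hfin : (μH[2] : Measure (E 2)) (G '' K) < ⊤ := by
    refine hKc.induction_on (p := fun s => (μH[2] : Measure (E 2)) (G '' s) < ⊤) ?_ ?_ ?_ ?_
    · simp
    · intro s t hst ht
      exact (measure_mono (image_mono hst)).trans_lt ht
    · intro s t hs ht
      rw [image_union]
      exact (measure_union_le _ _).trans_lt (ENNReal.add_lt_top.2 ⟨hs, ht⟩)
    · intro x hx
      obtain ⟨C, t, ht, hC⟩ := hL x
      refine ⟨t ∩ Metric.ball x 1, mem_nhdsWithin_of_mem_nhds (Filter.inter_mem ht (Metric.ball_mem_nhds x one_pos)), ?_⟩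
      have := (hC.mono (inter_subset_left (t := Metric.ball x 1))).hausdorffMeasure_image_le (d := 2) (by norm_num)
      refine this.trans_lt ?_
      apply ENNReal.mul_lt_top
      · simp [ENNReal.coe_lt_top]
      · rw [hausdorffMeasure_prod_real]
        exact (measure_mono inter_subset_right).trans_lt Metric.isBounded_ball.measure_lt_top
  refine (measure_mono ?_).trans_lt hfin
  intro z hz
  have hz1 : z 0 ^ 2 + z 1 ^ 2 + z 2 ^ 2 = 1 := by
    have := mem_us.1 hz
    rw [EuclideanSpace.norm_eq, Fin.sum_univ_three] at this
    have h2 := Real.sqrt_eq_one.1 this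
    simpa [sq_abs] using h2
  set cz : ℂ := ⟨z 0, z 1⟩ with hcz
  have hn : ‖cz‖ = √(1 - z 2 ^ 2) := by
    rw [Complex.norm_def, Complex.normSq_apply]
    congr 1
    simp [hcz]; nlinarith
  refine ⟨(Real.arccos (z 2), Complex.arg cz), ⟨⟨Real.arccos_nonneg _, Real.arccos_le_pi _⟩, ⟨(Complex.neg_pi_lt_arg _).le, Complex.arg_le_pi _⟩⟩, ?_⟩
  have h0 : ‖cz‖ * Real.cos cz.arg = z 0 := by rw [Complex.norm_mul_cos_arg]
  have h1 : ‖cz‖ * Real.sin cz.arg = z 1 := by rw [Complex.norm_mul_sin_arg]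
  have h2 : Real.cos (Real.arccos (z 2)) = z 2 := Real.cos_arccos (by nlinarith) (by nlinarith)
  have h3 : Real.sin (Real.arccos (z 2)) = ‖cz‖ := by rw [Real.sin_arccos, hn]
  simp only [G, h2, h3]
  ext i
  fin_cases i <;> simp [bb] <;> rfl

lemma hausdorff_sphere_pos : 0 < (μH[2] : Measure (E 2)) (unitSphere 2) := by
  let p : E 2 → ℝ × ℝ := fun z => (z 0, z 1)
  have hp : LipschitzWith 1 p := by
    apply LipschitzWith.of_dist_le_mul
    intro x y
    simp only [NNReal.coe_one, one_mul, p, Prod.dist_eq]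
    rw [EuclideanSpace.dist_eq]
    apply max_le <;> apply Real.le_sqrt_of_sq_le <;> rw [Fin.sum_univ_three] <;> nlinarith [sq_nonneg (dist (x 0) (y 0)), sq_nonneg (dist (x 1) (y 1)), sq_nonneg (dist (x 2) (y 2))]
  have h1 := hp.hausdorffMeasure_image_le (d := 2) (by norm_num) (unitSphere 2)
  rw [hausdorffMeasure_prod_real] at h1
  simp only [ENNReal.coe_one, ENNReal.one_rpow, one_mul] at h1
  refine lt_of_lt_of_le ?_ h1
  have h2 : (Ioo (0:ℝ) (1/2)) ×ˢ (Ioo (0:ℝ) (1/2)) ⊆ p '' unitSphere 2 := by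
    rintro ⟨a, b⟩ ⟨ha, hb⟩
    simp only [mem_Ioo] at ha hb
    refine ⟨!₂[a, b, √(1 - a^2 - b^2)], ?_, ?_⟩
    · rw [mem_us, EuclideanSpace.norm_eq, Fin.sum_univ_three]
      rw [Real.sqrt_eq_one]
      have : √(1 - a^2 - b^2) ^ 2 = 1 - a^2 - b^2 := Real.sq_sqrt (by nlinarith)
      simp [this]
    · simp [p]
  refine lt_of_lt_of_le ?_ (measure_mono h2)
  rw [Measure.volume_eq_prod, Measure.prod_prod, Real.volume_Ioo]
  norm_num

lemma Besic_aux (μ ν : Measure (E 2)) [IsFiniteMeasure μ] [IsFiniteMeasure ν]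
    (hμ : μ (unitSphere 2)ᶜ = 0) (hν : ν (unitSphere 2)ᶜ = 0) 
    (hμi : ∀ x ∈ unitSphere 2, ∀ y ∈ unitSphere 2, ∀ r, μ (Metric.closedBall x r) = μ (Metric.closedBall y r))
    (hνi : ∀ x ∈ unitSphere 2, ∀ y ∈ unitSphere 2, ∀ r, ν (Metric.closedBall x r) = ν (Metric.closedBall y r)) :
    ∃ a : ENNReal, μ = a • (μ + ν) := by
  obtain ⟨τ, hτ⟩ : ∃ τ, τ = μ + ν := ⟨_, rfl⟩
  rw [← hτ]
  haveI : IsFiniteMeasure τ := by rw [hτ]; infer_instance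
  have hac : μ ≪ τ := Measure.absolutelyContinuous_of_le (by rw [hτ]; exact Measure.le_add_right le_rfl)
  have h1 := Besicovitch.ae_tendsto_rnDeriv μ τ
  have h2 : ∀ᵐ x ∂τ, x ∈ unitSphere 2 := by
    rw [ae_iff]
    change τ (unitSphere 2)ᶜ = 0
    simp [hτ, hμ, hν]
  have h3 := h1.and h2
  by_cases hz : τ = 0
  · refine ⟨0, ?_⟩
    have : μ = 0 := by
      have := hac
      rw [hz] at this
      exact Measure.absolutelyContinuous_zero_iff.1 this
    rw [this, hz]; simp
  have : (ae τ).NeBot := ae_neBot.2 hz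
  obtain ⟨x0, hx0, hx0s⟩ := h3.exists
  refine ⟨μ.rnDeriv τ x0, ?_⟩
  have h4 : μ.rnDeriv τ =ᵐ[τ] fun _ => μ.rnDeriv τ x0 := by
    filter_upwards [h3] with x hx
    refine tendsto_nhds_unique hx.1 ?_
    refine hx0.congr ?_
    intro r
    rw [hτ, Measure.add_apply, Measure.add_apply, hμi x hx.2 x0 hx0s, hνi x hx.2 x0 hx0s]
  haveI : μ.HaveLebesgueDecomposition τ := Measure.haveLebesgueDecomposition_of_sigmaFinite μ τ
  conv_lhs => rw [← Measure.withDensity_rnDeriv_eq μ τ hac, withDensity_congr_ae h4, withDensity_const]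

lemma sig_closedBall_inv : ∀ x ∈ unitSphere 2, ∀ y ∈ unitSphere 2, ∀ r,
    sig (Metric.closedBall x r) = sig (Metric.closedBall y r) := by
  intro x hx y hy r
  obtain ⟨g, hg⟩ := exists_isom hx hy
  rw [← sig_map_isometry g ((Metric.isClosed_closedBall (x := y) (ε := r)).measurableSet), ← hg]
  congr 1
  ext z; simp

lemma haus_closedBall_inv : ∀ x ∈ unitSphere 2, ∀ y ∈ unitSphere 2, ∀ r,
    ((μH[2] : Measure (E 2)).restrict (unitSphere 2)) (Metric.closedBall x r) = ((μH[2] : Measure (E 2)).restrict (unitSphere 2)) (Metric.closedBall y r) := by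
  intro x hx y hy r
  obtain ⟨g, hg⟩ := exists_isom hx hy
  rw [Measure.restrict_apply Metric.isClosed_closedBall.measurableSet, Measure.restrict_apply Metric.isClosed_closedBall.measurableSet,
    ← IsometryEquiv.hausdorffMeasure_preimage g.toIsometryEquiv 2 (Metric.closedBall y r ∩ _), ← hg]
  congr 1
  ext z; simp [unitSphere]

/-- surface measure is a constant multiple of `sig` -/
lemma exists_kappa : ∃ κ : ℝ, 0 < κ ∧ ∀ X : Set (E 2), MeasurableSet X → X ⊆ unitSphere 2 →
    area X = κ * sig.real X := by
  set μ := (μH[2] : Measure (E 2)).restrict (unitSphere 2) with hμ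
  haveI : IsFiniteMeasure μ := ⟨by rw [hμ, Measure.restrict_apply_univ]; exact hausdorff_sphere_lt_top⟩
  obtain ⟨a, ha⟩ := Besic_aux μ sig (by rw [hμ, Measure.restrict_apply measurable_us.compl]; simp) sig_sphere_compl
    haus_closedBall_inv sig_closedBall_inv
  have hr : ∀ X : Set (E 2), μ.real X = a.toReal * (μ.real X + sig.real X) := by
    intro X
    have : μ X = a * (μ X + sig X) := by
      conv_lhs => rw [ha]
      simp [mul_add]
    have h2 := congrArg ENNReal.toReal this
    rwa [ENNReal.toReal_mul, ENNReal.toReal_add (measure_ne_top _ _) (measure_ne_top _ _)] at h2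
  have hs : sig.real univ = 4 * π := by
    rw [Measure.real, sig_univ, ENNReal.toReal_ofReal (by positivity)]
  have hm : 0 < μ.real univ := by
    rw [Measure.real, hμ, Measure.restrict_apply_univ]
    exact ENNReal.toReal_pos hausdorff_sphere_pos.ne' hausdorff_sphere_lt_top.ne
  refine ⟨μ.real univ / (4 * π), by positivity, ?_⟩
  intro X hX hXs
  have hA : area X = μ.real X := by
    rw [area, Measure.real, hμ, Measure.restrict_apply hX, inter_eq_left.2 hXs]
  rw [hA]
  have h1 := hr X
  have h2 := hr univ
  rw [hs] at h2
  have hpi := Real.pi_pos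
  rw [div_mul_eq_mul_div, eq_div_iff (by positivity)]
  have h3 : μ.real univ + 4 * π ≠ 0 := by positivity
  have : a.toReal = μ.real univ / (μ.real univ + 4 * π) := by
    rw [eq_div_iff h3]; linarith
  rw [this] at h1
  field_simp at h1
  linarith

lemma area_mono {X Y : Set (E 2)} (h : X ⊆ Y) (hY : Y ⊆ unitSphere 2) : area X ≤ area Y := by
  unfold area
  apply ENNReal.toReal_mono
  · exact ((measure_mono hY).trans_lt hausdorff_sphere_lt_top).ne
  · exact measure_mono h

lemma sig_real_univ : sig.real univ = 4 * π := by
  rw [Measure.real, sig_univ, ENNReal.toReal_ofReal (by positivity)]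

/-- area of a zone -/
lemma sig_zone {c : E 2} (hc : ‖c‖ = 1) {i j : ℝ} (hij : i ≤ j) (hi : -1 ≤ i) (hj : j ≤ 1) :
    sig.real {z | ⟪z, c⟫ ∈ Icc i j} = 2 * π * (j - i) := by
  obtain ⟨e, f, h⟩ := exists_frame hc
  have hm : MeasurableSet {z : E 2 | ⟪z, c⟫ ∈ Icc i j} := by
    have h2 : Measurable (fun z : E 2 => ⟪z, c⟫) := by fun_prop
    exact h2 measurableSet_Icc
  have hpi := Real.pi_pos
  apply le_antisymm
  · have := sig_le_sector h hm (a := 0) (b := 2 * π) (i := i) (j := j) (by positivity) hij (by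
      intro p hp hpX
      simp only [mem_setOf_eq, Psi_inner_c h] at hpX
      exact ⟨⟨hp.1.1.le, hp.1.2.le⟩, hpX⟩)
    linarith
  · have := sig_ge_sector h hm (a := 0) (b := 2 * π) (i := i) (j := j) (by positivity) hij le_rfl le_rfl hi hj (by
      intro p hp h1 h2
      simp only [mem_setOf_eq, Psi_inner_c h]
      exact ⟨h2.1.le, h2.2.le⟩)
    linarith

lemma inner_le_one' {a b : E 2} (ha : ‖a‖ = 1) (hb : ‖b‖ = 1) : ⟪a, b⟫ ≤ 1 := by
  have := real_inner_le_norm a b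
  rwa [ha, hb, mul_one] at this

lemma neg_one_le_inner' {a b : E 2} (ha : ‖a‖ = 1) (hb : ‖b‖ = 1) : -1 ≤ ⟪a, b⟫ := by
  have := neg_le_of_abs_le (abs_real_inner_le_norm a b)
  rwa [ha, hb, mul_one] at this

lemma gdist_le_iff {a b : E 2} (ha : ‖a‖ = 1) (hb : ‖b‖ = 1) {t : ℝ} (ht0 : 0 ≤ t) (ht : t ≤ π) :
    gdist a b ≤ t ↔ Real.cos t ≤ ⟪a, b⟫ := by
  unfold gdist
  constructor
  · intro h
    have h1 : Real.cos t ≤ Real.cos (Real.arccos ⟪a, b⟫) :=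
      Real.cos_le_cos_of_nonneg_of_le_pi (Real.arccos_nonneg _) ht h
    rwa [Real.cos_arccos (neg_one_le_inner' ha hb) (inner_le_one' ha hb)] at h1
  · intro h
    rw [← Real.arccos_cos ht0 ht]
    exact Real.arccos_le_arccos h

lemma gball_eq {c : E 2} (hc : ‖c‖ = 1) {t : ℝ} (ht0 : 0 ≤ t) (ht : t ≤ π) :
    gball c t = {z ∈ unitSphere 2 | Real.cos t ≤ ⟪c, z⟫} := by
  ext z
  simp only [gball, mem_setOf_eq, and_congr_right_iff]
  intro hz
  exact gdist_le_iff hc (mem_us.1 hz) ht0 ht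

lemma isClosed_gball (c : E 2) (t : ℝ) : IsClosed (gball c t) := by
  apply Metric.isClosed_sphere.inter
  have : Continuous (fun z : E 2 => gdist c z) := by
    unfold gdist; exact Real.continuous_arccos.comp (by fun_prop)
  exact isClosed_le this continuous_const

lemma sig_inter_us (X : Set (E 2)) : sig.real (X ∩ unitSphere 2) = sig.real X := by
  simp only [Measure.real]
  congr 1
  exact measure_inter_conull sig_sphere_compl

lemma sig_gball {c : E 2} (hc : ‖c‖ = 1) {t : ℝ} (ht0 : 0 ≤ t) (ht : t ≤ π) :
    sig.real (gball c t) = 2 * π * (1 - Real.cos t) := by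
  rw [← sig_zone hc (Real.cos_le_one t) (Real.neg_one_le_cos t) le_rfl, ← sig_inter_us {z | _}, gball_eq hc ht0 ht]
  congr 1
  ext z
  simp only [mem_setOf_eq, mem_inter_iff, mem_Icc]
  rw [real_inner_comm c z]
  constructor
  · rintro ⟨h1, h2⟩; exact ⟨⟨h2, inner_le_one' hc (mem_us.1 h1)⟩, h1⟩
  · rintro ⟨h1, h2⟩; exact ⟨h2, h1.1⟩


lemma gdist_eq_angle {x y : E 2} (hx : ‖x‖ = 1) (hy : ‖y‖ = 1) :
    gdist x y = InnerProductGeometry.angle x y := by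
  simp [gdist, InnerProductGeometry.angle, hx, hy]

lemma norm_nrm {x : E 2} (hx : x ≠ 0) : ‖nrm x‖ = 1 := by
  unfold nrm
  rw [norm_smul, norm_inv, norm_norm, inv_mul_cancel₀ (norm_ne_zero_iff.2 hx)]

lemma norm_smul_nrm (x : E 2) : ‖x‖ • nrm x = x := by
  unfold nrm
  by_cases h : x = 0
  · simp [h]
  · rw [smul_smul, mul_inv_cancel₀ (norm_ne_zero_iff.2 h), one_smul]

lemma us_ne_zero {x : E 2} (hx : ‖x‖ = 1) : x ≠ 0 := by
  rintro rfl; simp at hx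

lemma inner_self_us {x : E 2} (hx : ‖x‖ = 1) : ⟪x, x⟫ = 1 := by
  rw [real_inner_self_eq_norm_sq, hx]; norm_num

lemma seg_sub_cone {x y z : E 2} (hx : ‖x‖ = 1) (hy : ‖y‖ = 1) (hxy : x ≠ -y) (hz : z ∈ seg x y) :
    ∃ a b : ℝ, 0 ≤ a ∧ 0 ≤ b ∧ z = a • x + b • y := by
  obtain ⟨hz1, hz2⟩ := hz
  have hzn := mem_us.1 hz1
  rw [gdist_eq_angle hx hzn, gdist_eq_angle hzn hy, gdist_eq_angle hx hy] at hz2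
  have := (InnerProductGeometry.angle_eq_angle_add_angle_iff (us_ne_zero hzn)).1 hz2.symm
  rcases this with h | h
  · exfalso
    apply hxy
    have h1 : ⟪x, y⟫ = -1 := by
      have := (InnerProductGeometry.inner_eq_neg_mul_norm_iff_angle_eq_pi (us_ne_zero hx) (us_ne_zero hy)).2 h
      rw [this, hx, hy]; norm_num
    have h2 : ‖x + y‖ ^ 2 = 0 := by
      rw [norm_add_sq_real, hx, hy, h1]; norm_num
    have h3 : x + y = 0 := by simpa using h2
    exact eq_neg_of_add_eq_zero_left h3
  · rw [Submodule.mem_span_pair] at h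
    obtain ⟨a, b, h⟩ := h
    exact ⟨a, b, a.2, b.2, h.symm⟩

lemma cone_sub_seg {x y : E 2} (hx : ‖x‖ = 1) (hy : ‖y‖ = 1) {a b : ℝ} (ha : 0 ≤ a) (hb : 0 ≤ b)
    (h : a • x + b • y ≠ 0) : nrm (a • x + b • y) ∈ seg x y := by
  have hn := norm_nrm h
  refine ⟨mem_us.2 hn, ?_⟩
  rw [gdist_eq_angle hx hn, gdist_eq_angle hn hy, gdist_eq_angle hx hy]
  symm
  apply InnerProductGeometry.angle_eq_angle_add_add_angle_add_of_mem_span (us_ne_zero hn)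
  rw [Submodule.mem_span_pair]
  have hi : 0 ≤ ‖a • x + b • y‖⁻¹ := by positivity
  refine ⟨⟨_, mul_nonneg hi ha⟩, ⟨_, mul_nonneg hi hb⟩, ?_⟩
  unfold nrm
  rw [smul_add, smul_smul, smul_smul]
  rfl

/-- closed convex cone -/
structure CCone (C : Set (E 2)) : Prop where
  closed : IsClosed C
  zero : (0 : E 2) ∈ C
  add : ∀ x ∈ C, ∀ y ∈ C, x + y ∈ C
  smul : ∀ a : ℝ, 0 ≤ a → ∀ x ∈ C, a • x ∈ C

lemma CCone.convex {C : Set (E 2)} (h : CCone C) : Convex ℝ C := by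
  intro x hx y hy a b ha hb _
  exact h.add _ (h.smul a ha x hx) _ (h.smul b hb y hy)

lemma CCone.moreau {C : Set (E 2)} (h : CCone C) (z : E 2) :
    ∃ f ∈ C, ∃ n, z = f + n ∧ ⟪f, n⟫ = 0 ∧ ∀ y ∈ C, ⟪y, n⟫ ≤ 0 := by
  obtain ⟨f, hf, hmin⟩ := exists_norm_eq_iInf_of_complete_convex ⟨0, h.zero⟩ h.closed.isComplete h.convex z
  rw [norm_eq_iInf_iff_real_inner_le_zero h.convex hf] at hmin
  have h1 := hmin 0 h.zero
  have h2 := hmin ((2:ℝ) • f) (h.smul 2 (by norm_num) f hf)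
  have h3 : ⟪z - f, f⟫ = 0 := by
    rw [zero_sub, inner_neg_right] at h1
    rw [two_smul, add_sub_cancel_right] at h2
    linarith
  refine ⟨f, hf, z - f, by abel, by rw [real_inner_comm]; exact h3, ?_⟩
  intro y hy
  have := hmin y hy
  rw [inner_sub_right, h3] at this
  rw [real_inner_comm]; linarith

/-- cone over a set -/
def coneOver (K : Set (E 2)) : Set (E 2) := {z | ∃ a : ℝ, 0 ≤ a ∧ ∃ x ∈ K, z = a • x}

lemma coneOver_ccone {K : Set (E 2)} (hK : SConvex K) (hc : IsCompact K) (hne : K.Nonempty) : CCone (coneOver K) := by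
  obtain ⟨hKs, ⟨u, hu, hu2⟩, hseg⟩ := hK
  obtain ⟨x0, hx0⟩ := hne
  refine ⟨?_, ⟨0, le_rfl, x0, hx0, by simp⟩, ?_, ?_⟩
  · apply IsSeqClosed.isClosed
    intro s z hs hsz
    choose a ha x hx hsx using hs
    have hxn : ∀ n, ‖s n‖ = a n := by
      intro n; rw [hsx n, norm_smul, mem_us.1 (hKs (hx n)), mul_one, Real.norm_of_nonneg (ha n)]
    obtain ⟨y, hy, φ, hφ, hlim⟩ := hc.tendsto_subseq hx
    refine ⟨‖z‖, norm_nonneg _, y, hy, ?_⟩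
    have h1 : Filter.Tendsto (fun n => ‖s (φ n)‖ • x (φ n)) Filter.atTop (nhds (‖z‖ • y)) :=
      ((hsz.comp hφ.tendsto_atTop).norm).smul hlim
    have h2 : Filter.Tendsto (fun n => ‖s (φ n)‖ • x (φ n)) Filter.atTop (nhds z) := by
      refine (hsz.comp hφ.tendsto_atTop).congr ?_
      intro n
      simp only [Function.comp]
      rw [hxn, ← hsx]
    exact tendsto_nhds_unique h2 h1
  · rintro _ ⟨a, ha, x, hx, rfl⟩ _ ⟨b, hb, y, hy, rfl⟩
    by_cases h0 : a • x + b • y = 0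
    · rw [h0]; exact ⟨0, le_rfl, x0, hx0, by simp⟩
    · refine ⟨‖a • x + b • y‖, norm_nonneg _, nrm (a • x + b • y), ?_, (norm_smul_nrm _).symm⟩
      exact hseg x hx y hy (cone_sub_seg (mem_us.1 (hKs hx)) (mem_us.1 (hKs hy)) ha hb h0)
  · rintro c hc _ ⟨a, ha, x, hx, rfl⟩
    exact ⟨c * a, mul_nonneg hc ha, x, hx, by rw [smul_smul]⟩

lemma coneOver_inter {K : Set (E 2)} (hK : K ⊆ unitSphere 2) {z : E 2} (hz : ‖z‖ = 1) (h : z ∈ coneOver K) : z ∈ K := by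
  obtain ⟨a, ha, x, hx, rfl⟩ := h
  rw [norm_smul, mem_us.1 (hK hx), mul_one, Real.norm_of_nonneg ha] at hz
  rw [hz, one_smul]; exact hx

lemma IsConvexBody.nonempty {K : Set (E 2)} (hK : IsConvexBody K) : K.Nonempty :=
  hK.2.2.imp fun _ h => h.1

lemma bipolar {K : Set (E 2)} (hK : IsConvexBody K) {z : E 2} (hz : ‖z‖ = 1)
    (h : ∀ u ∈ polar K, ⟪u, z⟫ ≤ 0) : z ∈ K := by
  have hC := coneOver_ccone hK.1 hK.2.1 hK.nonempty
  obtain ⟨f, hf, n, hfn, hort, hn⟩ := hC.moreau z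
  by_cases h0 : n = 0
  · rw [h0, add_zero] at hfn
    rw [← hfn] at hf
    exact coneOver_inter hK.1.1 hz hf
  · exfalso
    have h1 : nrm n ∈ polar K := by
      refine ⟨mem_us.2 (norm_nrm h0), ?_⟩
      intro a ha
      have := hn a ⟨1, zero_le_one, a, ha, by simp⟩
      unfold nrm
      rw [inner_smul_right]
      exact mul_nonpos_of_nonneg_of_nonpos (by positivity) this
    have h2 := h _ h1
    unfold nrm at h2
    rw [inner_smul_left, hfn, inner_add_right, real_inner_comm f n, hort, zero_add, real_inner_self_eq_norm_sq] at h2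
    have h3 : 0 < ‖n‖ := norm_pos_iff.2 h0
    simp only [conj_trivial] at h2
    have : 0 < ‖n‖⁻¹ * ‖n‖ ^ 2 := by positivity
    linarith

lemma polar_polar {K : Set (E 2)} (hK : IsConvexBody K) : polar (polar K) = K := by
  ext z
  constructor
  · rintro ⟨hz, h⟩
    exact bipolar hK (mem_us.1 hz) h
  · intro hz
    refine ⟨hK.1.1 hz, ?_⟩
    intro u hu
    rw [real_inner_comm]; exact hu.2 z hz

lemma isClosed_polar (A : Set (E 2)) : IsClosed (polar A) := by
  have : polar A = unitSphere 2 ∩ ⋂ a ∈ A, {u | ⟪a, u⟫ ≤ 0} := by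
    ext u; simp [polar]
  rw [this]
  apply Metric.isClosed_sphere.inter
  exact isClosed_biInter fun a _ => isClosed_le (by fun_prop) continuous_const

lemma isCompact_polar (A : Set (E 2)) : IsCompact (polar A) :=
  (isCompact_sphere (0 : E 2) 1).of_isClosed_subset (isClosed_polar A) (fun _ h => h.1)

lemma polar_nonempty {K : Set (E 2)} (hK : IsConvexBody K) : (polar K).Nonempty := by
  obtain ⟨u, hu, hu2⟩ := hK.1.2.1
  refine ⟨-u, mem_us.2 (by rw [norm_neg]; exact mem_us.1 hu), ?_⟩
  intro a ha
  rw [inner_neg_right, real_inner_comm]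
  linarith [hu2 a ha]

/-- strict negativity at interior points -/
lemma interior_neg {K : Set (E 2)} {x : E 2} (hx : x ∈ sInterior K) (hxs : ‖x‖ = 1) {u : E 2} (hu : u ∈ polar K) :
    ⟪x, u⟫ < 0 := by
  obtain ⟨hxK, ε, hε, hball⟩ := hx
  have hun := mem_us.1 hu.1
  rcases lt_or_eq_of_le (hu.2 x hxK) with h | h
  · exact h
  exfalso
  set t := min (ε / 2) 1 with ht
  have ht0 : 0 < t := by positivity
  have ht1 : t ≤ 1 := min_le_right _ _
  have htε : t < ε := by have := min_le_left (ε/2) 1; linarith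
  have htpi : t < π := by linarith [Real.pi_gt_three]
  set y := Real.cos t • x + Real.sin t • u with hy
  have hyn : ‖y‖ = 1 := by
    have : ‖y‖ ^ 2 = 1 := by
      rw [hy, norm_add_sq_real, norm_smul, norm_smul, hxs, hun, inner_smul_left, inner_smul_right, h]
      simp [Real.cos_sq_add_sin_sq]
    nlinarith [norm_nonneg y]
  have hxy : ⟪x, y⟫ = Real.cos t := by
    rw [hy, inner_add_right, inner_smul_right, inner_smul_right, h, inner_self_us hxs]; ring
  have hg : gdist x y < ε := by
    unfold gdist
    rw [hxy, Real.arccos_cos ht0.le htpi.le]; exact htε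
  have := hu.2 y (hball y (mem_us.2 hyn) hg)
  rw [hy, inner_add_left, inner_smul_left, inner_smul_left, h, inner_self_us hun] at this
  simp only [conj_trivial, mul_zero, zero_add, mul_one] at this
  linarith [Real.sin_pos_of_pos_of_lt_pi ht0 htpi]

lemma breadth_eq {u v : E 2} (hu : ‖u‖ = 1) (hv : ‖v‖ = 1) (h1 : u ≠ v) (h2 : u ≠ -v) :
    breadth u v = π - Real.arccos ⟪u, v⟫ := by
  set c := ⟪u, v⟫ with hc
  have hlt : c < 1 := lt_of_le_of_ne (inner_le_one' hu hv) (fun h => h1 ((inner_eq_one_iff_of_norm_eq_one hu hv).1 h))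
  have hgt : -1 < c := by
    apply lt_of_le_of_ne (neg_one_le_inner' hu hv)
    intro h
    apply h2
    have h2 : ‖u + v‖ ^ 2 = 0 := by
      rw [norm_add_sq_real, hu, hv]
      have h5 : -1 = c := h
      change (1:ℝ) ^ 2 + 2 * c + 1 ^ 2 = 0
      rw [← h5]; norm_num
    have h3 : u + v = 0 := by simpa using h2
    exact eq_neg_of_add_eq_zero_left h3
  have hn1 : ‖c • u - v‖ ^ 2 = 1 - c ^ 2 := by
    rw [norm_sub_sq_real, norm_smul, hu, hv, inner_smul_left, ← hc]
    simp; ring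
  have hn2 : ‖c • v - u‖ ^ 2 = 1 - c ^ 2 := by
    rw [norm_sub_sq_real, norm_smul, hu, hv, inner_smul_left, real_inner_comm, ← hc]
    simp; ring
  have hn : ‖c • u - v‖ = ‖c • v - u‖ := by
    have := hn1.trans hn2.symm
    nlinarith [norm_nonneg (c • u - v), norm_nonneg (c • v - u)]
  have hpos : 0 < 1 - c ^ 2 := by nlinarith
  have hnp : ‖c • u - v‖ ≠ 0 := by
    intro h; rw [h] at hn1; norm_num at hn1; linarith
  unfold breadth gdist luneFaceCenter
  rw [real_inner_comm u v, ← hc, ← Real.arccos_neg]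
  congr 1
  rw [inner_smul_left, inner_smul_right, ← hn]
  have : ⟪c • u - v, c • v - u⟫ = -c * (1 - c ^ 2) := by
    simp only [inner_sub_left, inner_sub_right, inner_smul_left, inner_smul_right, conj_trivial]
    rw [inner_self_us hu, inner_self_us hv, real_inner_comm u v, ← hc]; ring
  rw [this, ← hn1]
  simp only [conj_trivial]
  field_simp

lemma exists_extremal_lune {K : Set (E 2)} (hK : IsConvexBody K) :
    ∃ u v, IsSupportingLune K u v ∧ u ∈ polar K ∧ v ∈ polar K ∧
      ∀ u' ∈ polar K, ∀ v' ∈ polar K, ⟪u, v⟫ ≤ ⟪u', v'⟫ := by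
  have hcomp := (isCompact_polar K).prod (isCompact_polar K)
  obtain ⟨p, hp⟩ := polar_nonempty hK
  obtain ⟨⟨u, v⟩, ⟨hu, hv⟩, hmin⟩ := hcomp.exists_isMinOn ⟨(p, p), hp, hp⟩
    (f := fun q : E 2 × E 2 => ⟪q.1, q.2⟫) (by fun_prop)
  simp only at hu hv
  have hmin' : ∀ u' ∈ polar K, ∀ v' ∈ polar K, ⟪u, v⟫ ≤ ⟪u', v'⟫ := by
    intro u' hu' v' hv'
    exact hmin (show (u', v') ∈ polar K ×ˢ polar K from ⟨hu', hv'⟩)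
  have hun := mem_us.1 hu.1
  have hvn := mem_us.1 hv.1
  obtain ⟨x0, hx0⟩ := hK.2.2
  have hx0n := mem_us.1 (hK.1.1 hx0.1)
  have hneg : u ≠ -v := by
    intro h
    have h1 := interior_neg hx0 hx0n hu
    have h2 := interior_neg hx0 hx0n hv
    rw [h, inner_neg_right] at h1
    linarith
  have hne : u ≠ v := by
    intro h
    -- polar is a singleton
    have hs : ∀ u' ∈ polar K, u' = u := by
      intro u' hu'
      have h1 := hmin' u' hu' u hu
      rw [← h, inner_self_us hun] at h1
      exact (inner_eq_one_iff_of_norm_eq_one (mem_us.1 hu'.1) hun).1 (le_antisymm (inner_le_one' (mem_us.1 hu'.1) hun) h1)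
    obtain ⟨e, f, hF⟩ := exists_frame hun
    have hen : ‖e‖ = 1 := by
      have := hF.ee; rw [real_inner_self_eq_norm_sq] at this; nlinarith [norm_nonneg e]
    have he1 : e ∈ K := bipolar hK hen (by
      intro u' hu'; rw [hs u' hu', real_inner_comm, hF.ec])
    have he2 : -e ∈ K := bipolar hK (by rw [norm_neg]; exact hen) (by
      intro u' hu'; rw [hs u' hu', real_inner_comm, inner_neg_left, hF.ec, neg_zero])
    obtain ⟨q, _, hq⟩ := hK.1.2.1
    have h1 := hq _ he1
    have h2 := hq _ he2
    rw [inner_neg_right] at h2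
    linarith
  have hlt : ⟪u, v⟫ < 1 := lt_of_le_of_ne (inner_le_one' hun hvn) (fun h => hne ((inner_eq_one_iff_of_norm_eq_one hun hvn).1 h))
  have hgt : -1 < ⟪u, v⟫ := by
    apply lt_of_le_of_ne (neg_one_le_inner' hun hvn)
    intro h
    apply hneg
    have h2 : ‖u + v‖ ^ 2 = 0 := by
      rw [norm_add_sq_real, hun, hvn, ← h]; norm_num
    have h3 : u + v = 0 := by simpa using h2
    exact eq_neg_of_add_eq_zero_left h3
  have key : ∀ u v : E 2, u ∈ polar K → v ∈ polar K → ⟪u, v⟫ < 1 → -1 < ⟪u, v⟫ →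
      (∀ u' ∈ polar K, ∀ v' ∈ polar K, ⟪u, v⟫ ≤ ⟪u', v'⟫) → ∃ x ∈ K, ⟪x, u⟫ = 0 := by
    intro u v hu hv hlt hgt hmin'
    have hun := mem_us.1 hu.1
    have hvn := mem_us.1 hv.1
    obtain ⟨x, hx, hxmax⟩ := hK.2.1.exists_isMaxOn hK.nonempty (f := fun x => ⟪x, u⟫) (by fun_prop)
    by_contra hcon
    push Not at hcon
    have hxneg : ⟪x, u⟫ < 0 := lt_of_le_of_ne (hu.2 x hx) (hcon x hx)
    set t := -⟪x, u⟫ with ht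
    have ht0 : 0 < t := by linarith
    set c := ⟪u, v⟫ with hc
    have hns : ‖u - t • v‖ ^ 2 = 1 - 2 * t * c + t ^ 2 := by
      rw [norm_sub_sq_real, norm_smul, hun, hvn, inner_smul_right, ← hc]
      simp; ring
    have hnpos : 0 < 1 - 2 * t * c + t ^ 2 := by nlinarith [sq_nonneg (t - c)]
    have hN : 0 < ‖u - t • v‖ := by
      rcases (norm_nonneg (u - t • v)).lt_or_eq with h | h
      · exact h
      · rw [← h] at hns; norm_num at hns; linarith
    have hmem : nrm (u - t • v) ∈ polar K := by
      refine ⟨mem_us.2 (norm_nrm (norm_pos_iff.1 hN)), ?_⟩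
      intro y hy
      unfold nrm
      rw [inner_smul_right]
      apply mul_nonpos_of_nonneg_of_nonpos (by positivity)
      rw [inner_sub_right, inner_smul_right]
      have h1 : ⟪y, u⟫ ≤ ⟪x, u⟫ := hxmax hy
      have h2 := neg_one_le_inner' (mem_us.1 (hK.1.1 hy)) hvn
      nlinarith
    have h1 := hmin' _ hmem v hv
    unfold nrm at h1
    rw [inner_smul_left, inner_sub_left, inner_smul_left, inner_self_us hvn, ← hc] at h1
    simp only [conj_trivial, mul_one] at h1
    set N := ‖u - t • v‖ with hNdef
    have h2 : c * N ≤ c - t := by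
      have := mul_le_mul_of_nonneg_right h1 hN.le
      rw [mul_right_comm, inv_mul_cancel₀ hN.ne', one_mul] at this
      exact this
    have hcc : 0 < 1 - c ^ 2 := by nlinarith
    by_cases hc0 : 0 ≤ c
    · have h3 : 0 ≤ c * N := by positivity
      have h4 : (c * N) ^ 2 ≤ (c - t) ^ 2 := by nlinarith
      have h5 : c ^ 2 * (1 - 2 * t * c + t ^ 2) ≤ (c - t) ^ 2 := by rw [← hns]; nlinarith
      have h6 : 0 ≤ t * (1 - c ^ 2) * (t - 2 * c) := by nlinarith
      have h7 : 0 < t * (1 - c ^ 2) := by positivity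
      have h8 : 0 ≤ t - 2 * c := nonneg_of_mul_nonneg_right h6 h7
      have h9 : c = 0 := by linarith
      rw [h9] at h2; linarith
    · push Not at hc0
      have h3 : 0 ≤ -(c * N) := by nlinarith
      have h4 : (t - c) ^ 2 ≤ (c * N) ^ 2 := by nlinarith
      have h5 : (c - t) ^ 2 ≤ c ^ 2 * (1 - 2 * t * c + t ^ 2) := by rw [← hns]; nlinarith
      have h6 : t * (1 - c ^ 2) * (t - 2 * c) ≤ 0 := by nlinarith
      have h7 : 0 < t * (1 - c ^ 2) := by positivity
      have h8 : 0 < t - 2 * c := by linarith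
      nlinarith [mul_pos h7 h8]
  refine ⟨u, v, ⟨hu.1, hv.1, hne, hneg, ?_, ?_, ?_⟩, hu, hv, hmin'⟩
  · intro x hx
    exact ⟨hK.1.1 hx, hu.2 x hx, hv.2 x hx⟩
  · obtain ⟨x, hx, hx0⟩ := key u v hu hv hlt hgt hmin'
    exact ⟨x, hx, hK.1.1 hx, hx0, hv.2 x hx⟩
  · obtain ⟨x, hx, hx0⟩ := key v u hv hu (by rwa [real_inner_comm]) (by rwa [real_inner_comm]) (by
      intro u' hu' v' hv'; rw [real_inner_comm]; exact hmin' u' hu' v' hv')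
    exact ⟨x, hx, hK.1.1 hx, hx0, hu.2 x hx⟩

lemma polar_diam {K : Set (E 2)} (hK : IsConvexBody K) {w : ℝ} (hw : width K = w) (hw1 : π / 2 < w) (hw2 : w < π) :
    ∀ u ∈ polar K, ∀ v ∈ polar K, Real.cos (π - w) ≤ ⟪u, v⟫ := by
  obtain ⟨u, v, hl, hu, hv, hmin⟩ := exists_extremal_lune hK
  have h1 : width K ≤ breadth u v := by
    apply csInf_le
    · refine ⟨0, ?_⟩
      rintro b ⟨u, v, _, rfl⟩
      exact Real.arccos_nonneg _
    · exact ⟨u, v, hl, rfl⟩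
  have hun := mem_us.1 hu.1
  have hvn := mem_us.1 hv.1
  rw [breadth_eq hun hvn hl.2.2.1 hl.2.2.2.1, hw] at h1
  have h2 : Real.cos (π - w) ≤ ⟪u, v⟫ := by
    rw [← gdist_le_iff hun hvn (by linarith) (by linarith [Real.pi_pos])]
    unfold gdist; linarith
  intro u' hu' v' hv'
  exact h2.trans (hmin u' hu' v' hv')

lemma le_width {K : Set (E 2)} (hK : IsConvexBody K) {w : ℝ} (hw1 : π / 2 < w) (hw2 : w < π)
    (h : ∀ u ∈ polar K, ∀ v ∈ polar K, Real.cos (π - w) ≤ ⟪u, v⟫) : w ≤ width K := by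
  obtain ⟨u, v, hl, _⟩ := exists_extremal_lune hK
  unfold width
  refine le_csInf ⟨breadth u v, u, v, hl, rfl⟩ ?_
  rintro b ⟨u, v, hl, rfl⟩
  have hun := mem_us.1 hl.1
  have hvn := mem_us.1 hl.2.1
  rw [breadth_eq hun hvn hl.2.2.1 hl.2.2.2.1]
  have hu : u ∈ polar K := ⟨hl.1, fun a ha => (hl.2.2.2.2.1 ha).2.1⟩
  have hv : v ∈ polar K := ⟨hl.2.1, fun a ha => (hl.2.2.2.2.1 ha).2.2⟩
  have := (gdist_le_iff hun hvn (by linarith) (by linarith [Real.pi_pos])).2 (h u hu v hv)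
  unfold gdist at this; linarith


/-- unit decomposition: `z = a s + b e` -/
lemma exists_dir {s z : E 2} (hs : ‖s‖ = 1) (hz : ‖z‖ = 1) :
    ∃ e, ‖e‖ = 1 ∧ ⟪s, e⟫ = 0 ∧ ∃ b : ℝ, 0 ≤ b ∧ z = ⟪z, s⟫ • s + b • e ∧ ⟪z, s⟫ ^ 2 + b ^ 2 = 1 := by
  set y := z - ⟪z, s⟫ • s with hy
  have hsy : ⟪s, y⟫ = 0 := by
    rw [hy, inner_sub_right, inner_smul_right, inner_self_us hs, real_inner_comm]; ring
  have hny : ‖y‖ ^ 2 = 1 - ⟪z, s⟫ ^ 2 := by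
    rw [hy, norm_sub_sq_real, norm_smul, hz, hs, inner_smul_right]
    simp; ring
  by_cases h0 : y = 0
  · obtain ⟨e, f, hF⟩ := exists_frame hs
    have hen : ‖e‖ = 1 := by
      have := hF.ee; rw [real_inner_self_eq_norm_sq] at this; nlinarith [norm_nonneg e]
    refine ⟨e, hen, by rw [real_inner_comm]; exact hF.ec, 0, le_rfl, ?_, ?_⟩
    · rw [zero_smul, add_zero]; exact sub_eq_zero.1 h0
    · rw [h0, norm_zero] at hny; linarith
  · refine ⟨nrm y, norm_nrm h0, ?_, ‖y‖, norm_nonneg _, ?_, by linarith⟩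
    · unfold nrm; rw [inner_smul_right, hsy, mul_zero]
    · rw [norm_smul_nrm, hy]; abel

lemma inner_sq_le {s e x : E 2} (hs : ‖s‖ = 1) (he : ‖e‖ = 1) (hse : ⟪s, e⟫ = 0) (hx : ‖x‖ = 1) :
    ⟪x, s⟫ ^ 2 + ⟪x, e⟫ ^ 2 ≤ 1 := by
  have h : 0 ≤ ‖x - ⟪x, s⟫ • s - ⟪x, e⟫ • e‖ ^ 2 := by positivity
  rw [← real_inner_self_eq_norm_sq] at h
  simp only [inner_sub_left, inner_sub_right, inner_smul_left, inner_smul_right, conj_trivial] at h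
  rw [inner_self_us hs, inner_self_us he, inner_self_us hx, hse, real_inner_comm s e, hse, real_inner_comm x s, real_inner_comm x e] at h
  nlinarith

lemma double_polar_aux {D : ℝ} (hD0 : 0 < D) (hD : D < π / 2) {S : Set (E 2)} (hS : S ⊆ unitSphere 2) {s : E 2} (hs : ‖s‖ = 1)
    (h : ∀ s' ∈ S, Real.cos D ≤ ⟪s', s⟫) {z : E 2} (hz : z ∈ polar (polar S)) : Real.cos D ≤ ⟪z, s⟫ := by
  by_contra hcon
  push Not at hcon
  have hzn := mem_us.1 hz.1
  obtain ⟨e, he, hse, b, hb, hzd, hab⟩ := exists_dir hs hzn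
  have hc : 0 < Real.cos D := Real.cos_pos_of_mem_Ioo ⟨by linarith, hD⟩
  have hsn : 0 < Real.sin D := Real.sin_pos_of_pos_of_lt_pi hD0 (by linarith)
  have hcs := Real.sin_sq_add_cos_sq D
  set n := -Real.sin D • s + Real.cos D • e with hn
  have hnn : ‖n‖ = 1 := by
    have : ‖n‖ ^ 2 = 1 := by
      rw [hn, norm_add_sq_real, norm_smul, norm_smul, hs, he, inner_smul_left, inner_smul_right, hse]
      simp [Real.sin_sq_add_cos_sq]
    nlinarith [norm_nonneg n]
  have hnS : n ∈ polar S := by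
    refine ⟨mem_us.2 hnn, ?_⟩
    intro s' hs'
    have h1 := h s' hs'
    have h2 := inner_sq_le hs he hse (mem_us.1 (hS hs'))
    rw [hn, inner_add_right, inner_smul_right, inner_smul_right]
    have h3 : ⟪s', e⟫ ≤ Real.sin D := by
      apply le_of_sq_le_sq _ hsn.le
      nlinarith
    nlinarith
  have h1 := hz.2 n hnS
  have hze : ⟪z, e⟫ = b := by
    conv_lhs => rw [hzd]
    rw [inner_add_left, inner_smul_left, inner_smul_left, hse, inner_self_us he]; simp
  rw [hn, inner_add_left, inner_smul_left, inner_smul_left, real_inner_comm, real_inner_comm z e, hze] at h1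
  simp only [conj_trivial] at h1
  set a := ⟪z, s⟫ with ha
  by_cases ha0 : a ≤ 0
  · have : 0 ≤ Real.sin D * (-a) := mul_nonneg hsn.le (by linarith)
    have h3 : 0 ≤ Real.cos D * b := mul_nonneg hc.le hb
    have h4 : Real.cos D * b = 0 := by linarith
    have h5 : Real.sin D * (-a) = 0 := by linarith
    have h6 : b = 0 := by rcases mul_eq_zero.1 h4 with h | h; linarith; exact h
    have h7 : -a = 0 := by rcases mul_eq_zero.1 h5 with h | h; linarith; exact h
    nlinarith
  · push Not at ha0
    have h2 : Real.sin D < b := by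
      apply lt_of_pow_lt_pow_left₀ 2 hb
      nlinarith
    nlinarith

lemma double_polar {D : ℝ} (hD0 : 0 < D) (hD : D < π / 2) {S : Set (E 2)} (hS : S ⊆ unitSphere 2)
    (h : ∀ s ∈ S, ∀ s' ∈ S, Real.cos D ≤ ⟪s, s'⟫) :
    ∀ z ∈ polar (polar S), ∀ z' ∈ polar (polar S), Real.cos D ≤ ⟪z, z'⟫ := by
  intro z hz z' hz'
  apply double_polar_aux hD0 hD hS (mem_us.1 hz'.1) _ hz
  intro s hs
  rw [real_inner_comm]
  exact double_polar_aux hD0 hD hS (mem_us.1 (hS hs)) (fun s' hs' => h s' hs' s hs) hz'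

lemma ball_sub_polar {D : ℝ} (hD0 : 0 < D) (hD : D < π / 2) {p m z : E 2} (hp : ‖p‖ = 1) (hm : ‖m‖ = 1) (hz : ‖z‖ = 1)
    (hpm : Real.cos D ≤ ⟪p, m⟫) (hzp : Real.sin D ≤ -⟪z, p⟫) : ⟪m, z⟫ ≤ 0 := by
  have hc : 0 < Real.cos D := Real.cos_pos_of_mem_Ioo ⟨by linarith, hD⟩
  have hsn : 0 < Real.sin D := Real.sin_pos_of_pos_of_lt_pi hD0 (by linarith)
  have hcs := Real.sin_sq_add_cos_sq D
  obtain ⟨e, he, hse, b, hb, hzd, hab⟩ := exists_dir hp hm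
  rw [hzd, inner_add_left, inner_smul_left, inner_smul_left]
  simp only [conj_trivial]
  have h2 := inner_sq_le hp he hse hz
  rw [real_inner_comm p z, real_inner_comm e z] at h2
  rw [real_inner_comm] at hpm hzp
  rw [real_inner_comm] at hzp
  rw [real_inner_comm p z] at hzp
  have h3 : ⟪e, z⟫ ≤ Real.cos D := by
    apply le_of_sq_le_sq _ hc.le
    nlinarith
  have h4 : b ≤ Real.sin D := by
    apply le_of_sq_le_sq _ hsn.le
    nlinarith
  by_cases h5 : 0 ≤ ⟪e, z⟫ <;> nlinarith

structure Good (D : ℝ) (M L : Set (E 2)) : Prop where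
  MS : M ⊆ unitSphere 2
  LS : L ⊆ unitSphere 2
  ML : M = polar L
  LM : L = polar M
  ne : M.Nonempty
  diam : ∀ u ∈ M, ∀ v ∈ M, Real.cos D ≤ ⟪u, v⟫
  complete : ∀ x ∈ unitSphere 2, (∀ m ∈ M, Real.cos D ≤ ⟪x, m⟫) → x ∈ M

lemma seg_polar {A : Set (E 2)} {x y : E 2} (hx : x ∈ polar A) (hy : y ∈ polar A) (hxy : x ≠ -y) : seg x y ⊆ polar A := by
  intro z hz
  obtain ⟨a, b, ha, hb, h⟩ := seg_sub_cone (mem_us.1 hx.1) (mem_us.1 hy.1) hxy hz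
  refine ⟨hz.1, ?_⟩
  intro m hm
  rw [h, inner_add_right, inner_smul_right, inner_smul_right]
  have := hx.2 m hm
  have := hy.2 m hm
  nlinarith

lemma sInterior_of_gball {X : Set (E 2)} {q : E 2} {r : ℝ} (hr : 0 < r) (hq : ‖q‖ = 1) (h : gball q r ⊆ X) : q ∈ sInterior X := by
  refine ⟨h ⟨mem_us.2 hq, ?_⟩, r, hr, ?_⟩
  · unfold gdist; rw [inner_self_us hq]; simp [hr.le]
  · intro y hy hg; exact h ⟨hy, hg.le⟩

lemma reduced_good {w : ℝ} (hw1 : π / 2 < w) (hw2 : w < π) {L : Set (E 2)} (hL : IsReduced L) (hw : width L = w) :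
    Good (π - w) (polar L) L := by
  have hD0 : 0 < π - w := by linarith
  have hD : π - w < π / 2 := by linarith
  have hdiam := polar_diam hL.1 hw hw1 hw2
  refine ⟨fun _ h => h.1, hL.1.1.1, rfl, (polar_polar hL.1).symm, polar_nonempty hL.1, hdiam, ?_⟩
  intro x hx hxm
  by_contra hxn
  have hxn1 := mem_us.1 hx
  set L' : Set (E 2) := {z ∈ L | ⟪x, z⟫ ≤ 0} with hL'
  set S : Set (E 2) := insert x (polar L) with hS
  have hSS : S ⊆ unitSphere 2 := by
    rintro y (rfl | h)
    · exact hx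
    · exact h.1
  have hL'S : L' = polar S := by
    ext z
    constructor
    · rintro ⟨h1, h2⟩
      refine ⟨hL.1.1.1 h1, ?_⟩
      rintro y (rfl | h)
      · exact h2
      · rw [real_inner_comm]; exact h.2 z h1
    · rintro ⟨h1, h2⟩
      exact ⟨bipolar hL.1 (mem_us.1 h1) (fun u hu => h2 u (Or.inr hu)), h2 x (Or.inl rfl)⟩
  have hSd : ∀ s ∈ S, ∀ s' ∈ S, Real.cos (π - w) ≤ ⟪s, s'⟫ := by
    rintro s (rfl | hs) s' (rfl | hs')
    · rw [inner_self_us hxn1]; exact Real.cos_le_one _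
    · exact hxm s' hs'
    · rw [real_inner_comm]; exact hxm s hs
    · exact hdiam s hs s' hs'
  obtain ⟨p, hp⟩ := polar_nonempty hL.1
  have hpn := mem_us.1 hp.1
  have hball : gball (-p) (w - π / 2) ⊆ L' := by
    rw [hL'S, gball_eq (by rwa [norm_neg]) (by linarith) (by linarith)]
    rintro z ⟨hz, hz2⟩
    refine ⟨hz, ?_⟩
    intro m hm
    apply ball_sub_polar hD0 hD hpn (mem_us.1 (hSS hm)) (mem_us.1 hz) (hSd p (Or.inr hp) m hm)
    rw [← Real.cos_pi_div_two_sub, show π / 2 - (π - w) = w - π / 2 by ring]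
    rw [inner_neg_left, real_inner_comm] at hz2
    exact hz2
  have hbody : IsConvexBody L' := by
    refine ⟨⟨fun z hz => hL.1.1.1 hz.1, ?_, ?_⟩, ?_, ?_⟩
    · obtain ⟨u, hu, h⟩ := hL.1.1.2.1
      exact ⟨u, hu, fun z hz => h z hz.1⟩
    · intro a ha b hb
      have hab : a ≠ -b := by
        intro h
        obtain ⟨u, hu, hh⟩ := hL.1.1.2.1
        have h1 := hh a ha.1
        have h2 := hh b hb.1
        rw [h, inner_neg_right] at h1
        linarith
      rw [hL'S] at ha hb ⊢
      exact seg_polar ha hb hab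
    · rw [hL'S]; exact isCompact_polar S
    · exact ⟨-p, sInterior_of_gball (by linarith) (by rwa [norm_neg]) hball⟩
  have hne : L' ≠ L := by
    intro h
    apply hxn
    refine ⟨hx, ?_⟩
    intro a ha
    rw [← h] at ha
    rw [real_inner_comm]; exact ha.2
  have h1 := hL.2 L' hbody (fun z hz => hz.1) hne
  have h2 := le_width hbody hw1 hw2 (by
    rw [hL'S]
    exact double_polar hD0 hD hSS hSd)
  linarith

lemma Good.ball_sub {D : ℝ} {M L : Set (E 2)} (hD0 : 0 < D) (hD : D < π / 2) (h : Good D M L) {p : E 2} (hp : p ∈ M) :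
    gball (-p) (π / 2 - D) ⊆ L := by
  have hpn := mem_us.1 (h.MS hp)
  rw [h.LM, gball_eq (by rwa [norm_neg]) (by linarith) (by linarith)]
  rintro z ⟨hz, hz2⟩
  refine ⟨hz, ?_⟩
  intro m hm
  apply ball_sub_polar hD0 hD hpn (mem_us.1 (h.MS hm)) (mem_us.1 hz) (h.diam p hp m hm)
  rw [Real.cos_pi_div_two_sub] at hz2
  rw [inner_neg_left, real_inner_comm] at hz2
  exact hz2


/-- cone generated by a finite set -/
def fcone (F : Finset (E 2)) : Set (E 2) := {z | ∃ a : E 2 → ℝ, (∀ x, 0 ≤ a x) ∧ z = ∑ x ∈ F, a x • x}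

/-- a finite set of unit vectors in an open hemisphere -/
structure FinS (F : Finset (E 2)) (g : E 2) : Prop where
  ne : F.Nonempty
  us : ∀ x ∈ F, ‖x‖ = 1
  pos : ∀ x ∈ F, 0 < ⟪g, x⟫

lemma isClosed_coneOver {K : Set (E 2)} (hKs : K ⊆ unitSphere 2) (hc : IsCompact K) : IsClosed (coneOver K) := by
  apply IsSeqClosed.isClosed
  intro s z hs hsz
  choose a ha x hx hsx using hs
  have hxn : ∀ n, ‖s n‖ = a n := by
    intro n; rw [hsx n, norm_smul, mem_us.1 (hKs (hx n)), mul_one, Real.norm_of_nonneg (ha n)]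
  obtain ⟨y, hy, φ, hφ, hlim⟩ := hc.tendsto_subseq hx
  refine ⟨‖z‖, norm_nonneg _, y, hy, ?_⟩
  have h1 : Filter.Tendsto (fun n => ‖s (φ n)‖ • x (φ n)) Filter.atTop (nhds (‖z‖ • y)) :=
    ((hsz.comp hφ.tendsto_atTop).norm).smul hlim
  have h2 : Filter.Tendsto (fun n => ‖s (φ n)‖ • x (φ n)) Filter.atTop (nhds z) := by
    refine (hsz.comp hφ.tendsto_atTop).congr ?_
    intro n
    simp only [Function.comp]
    rw [hxn, ← hsx]
  exact tendsto_nhds_unique h2 h1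

lemma fcone_mem {F : Finset (E 2)} {x : E 2} (hx : x ∈ F) : x ∈ fcone F := by
  classical
  refine ⟨fun y => if y = x then 1 else 0, fun y => by positivity, ?_⟩
  simp [ite_smul, hx]

lemma fcone_add {F : Finset (E 2)} {x y : E 2} (hx : x ∈ fcone F) (hy : y ∈ fcone F) : x + y ∈ fcone F := by
  obtain ⟨a, ha, rfl⟩ := hx
  obtain ⟨b, hb, rfl⟩ := hy
  refine ⟨fun z => a z + b z, fun z => add_nonneg (ha z) (hb z), ?_⟩
  simp [add_smul, Finset.sum_add_distrib]

lemma fcone_smul {F : Finset (E 2)} {c : ℝ} (hc : 0 ≤ c) {x : E 2} (hx : x ∈ fcone F) : c • x ∈ fcone F := by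
  obtain ⟨a, ha, rfl⟩ := hx
  refine ⟨fun z => c * a z, fun z => mul_nonneg hc (ha z), ?_⟩
  simp [Finset.smul_sum, smul_smul]

lemma fcone_zero (F : Finset (E 2)) : (0 : E 2) ∈ fcone F := ⟨fun _ => 0, fun _ => le_rfl, by simp⟩

lemma FinS.inner_pos {F : Finset (E 2)} {g : E 2} (h : FinS F g) {z : E 2} (hz : z ∈ fcone F) (h0 : z ≠ 0) : 0 < ⟪g, z⟫ := by
  obtain ⟨a, ha, rfl⟩ := hz
  rw [inner_sum]
  simp only [inner_smul_right]
  have : ∃ x ∈ F, a x ≠ 0 := by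
    by_contra hcon
    push Not at hcon
    apply h0
    exact Finset.sum_eq_zero (fun x hx => by rw [hcon x hx, zero_smul])
  obtain ⟨x, hx, hx0⟩ := this
  apply Finset.sum_pos' (fun y hy => mul_nonneg (ha y) (h.pos y hy).le)
  exact ⟨x, hx, mul_pos (lt_of_le_of_ne (ha x) (Ne.symm hx0)) (h.pos x hx)⟩

lemma FinS.ccone {F : Finset (E 2)} {g : E 2} (h : FinS F g) : CCone (fcone F) := by
  refine ⟨?_, fcone_zero F, fun x hx y hy => fcone_add hx hy, fun a ha x hx => fcone_smul ha hx⟩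
  have hH : IsCompact (convexHull ℝ (F : Set (E 2))) := F.finite_toSet.isCompact_convexHull ℝ
  have hsub : convexHull ℝ (F : Set (E 2)) ⊆ fcone F := by
    apply convexHull_min
    · intro x hx; exact fcone_mem hx
    · intro x hx y hy a b ha hb _
      exact fcone_add (fcone_smul ha hx) (fcone_smul hb hy)
  have h0 : ∀ x ∈ convexHull ℝ (F : Set (E 2)), x ≠ 0 := by
    intro x hx
    have : convexHull ℝ (F : Set (E 2)) ⊆ {y | 0 < ⟪g, y⟫} := by
      apply convexHull_min
      · intro y hy; exact h.pos y hy
      · intro x hx y hy a b ha hb hab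
        simp only [mem_setOf_eq, inner_add_right, inner_smul_right] at *
        rcases ha.eq_or_lt with h1 | h1
        · have : b = 1 := by linarith
          subst this; rw [← h1]; linarith
        · have := mul_pos h1 hx
          have := mul_nonneg hb hy.le
          linarith
    rintro rfl
    have := this hx
    simp at this
  have hN : IsCompact (nrm '' convexHull ℝ (F : Set (E 2))) := by
    apply hH.image_of_continuousOn
    unfold nrm
    refine ContinuousOn.fun_smul ?_ ?_
    · apply ContinuousOn.inv₀ continuous_norm.continuousOn
      intro x hx; exact norm_ne_zero_iff.2 (h0 x hx)
    · exact continuousOn_id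
  have hNs : nrm '' convexHull ℝ (F : Set (E 2)) ⊆ unitSphere 2 := by
    rintro _ ⟨x, hx, rfl⟩
    exact mem_us.2 (norm_nrm (h0 x hx))
  have : fcone F = coneOver (nrm '' convexHull ℝ (F : Set (E 2))) := by
    ext z
    constructor
    · rintro ⟨a, ha, rfl⟩
      set s := ∑ x ∈ F, a x with hs
      have hs0 : 0 ≤ s := Finset.sum_nonneg (fun x _ => ha x)
      rcases hs0.eq_or_lt with h1 | h1
      · obtain ⟨x, hx⟩ := h.ne
        refine ⟨0, le_rfl, nrm x, ⟨x, subset_convexHull _ _ hx, rfl⟩, ?_⟩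
        rw [zero_smul]
        apply Finset.sum_eq_zero
        intro y hy
        rw [(Finset.sum_eq_zero_iff_of_nonneg (fun x _ => ha x)).1 h1.symm y hy, zero_smul]
      · set y := ∑ x ∈ F, (s⁻¹ * a x) • x with hy
        have hyH : y ∈ convexHull ℝ (F : Set (E 2)) := by
          apply Convex.sum_mem (convex_convexHull ℝ _)
          · intro x _; exact mul_nonneg (by positivity) (ha x)
          · rw [← Finset.mul_sum, ← hs, inv_mul_cancel₀ h1.ne']
          · intro x hx; exact subset_convexHull _ _ hx
        refine ⟨s * ‖y‖, by positivity, nrm y, ⟨y, hyH, rfl⟩, ?_⟩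
        rw [mul_smul, norm_smul_nrm, hy, Finset.smul_sum]
        apply Finset.sum_congr rfl
        intro x _
        rw [smul_smul, ← mul_assoc, mul_inv_cancel₀ h1.ne', one_mul]
    · rintro ⟨a, ha, _, ⟨x, hx, rfl⟩, rfl⟩
      unfold nrm
      exact fcone_smul ha (fcone_smul (by positivity) (hsub hx))
  rw [this]
  exact isClosed_coneOver hNs hN

lemma moreau_unique {C : Set (E 2)} {f n f' n' : E 2} (hf : f ∈ C) (hf' : f' ∈ C)
    (hn : ∀ y ∈ C, ⟪y, n⟫ ≤ 0) (hn' : ∀ y ∈ C, ⟪y, n'⟫ ≤ 0) (ho : ⟪f, n⟫ = 0) (ho' : ⟪f', n'⟫ = 0)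
    (h : f + n = f' + n') : f = f' := by
  have h1 : f - f' = n' - n := by
    rw [sub_eq_sub_iff_add_eq_add, h, add_comm]
  have h2 : ‖f - f'‖ ^ 2 = ⟪f, n'⟫ + ⟪f', n⟫ := by
    rw [← real_inner_self_eq_norm_sq]
    conv_lhs => rw [show ⟪f - f', f - f'⟫ = ⟪f - f', n' - n⟫ by rw [← h1]]
    rw [inner_sub_left, inner_sub_right, inner_sub_right, ho, ho']; ring
  have h3 := hn' f hf
  have h4 := hn f' hf'
  have h5 : ‖f - f'‖ ^ 2 = 0 := by nlinarith [sq_nonneg ‖f - f'‖]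
  have h6 : f - f' = 0 := by simpa using h5
  exact sub_eq_zero.1 h6

lemma fcone_polar {F : Finset (E 2)} {n : E 2} (h : ∀ x ∈ F, ⟪x, n⟫ ≤ 0) : ∀ y ∈ fcone F, ⟪y, n⟫ ≤ 0 := by
  rintro y ⟨a, ha, rfl⟩
  rw [sum_inner]
  apply Finset.sum_nonpos
  intro x hx
  rw [inner_smul_left]
  exact mul_nonpos_of_nonneg_of_nonpos (by simpa using ha x) (h x hx)

/-- ray -/
def ray (x : E 2) : Set (E 2) := {z | ∃ a : ℝ, 0 ≤ a ∧ z = a • x}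

lemma isClosed_ray {x : E 2} (hx : ‖x‖ = 1) : IsClosed (ray x) := by
  have : ray x = coneOver {x} := by ext z; simp [ray, coneOver]
  rw [this]
  exact isClosed_coneOver (by simpa [unitSphere] using hx) isCompact_singleton

/-- edge normals -/
def enorm (F : Finset (E 2)) : Set (E 2) :=
  {n | ‖n‖ = 1 ∧ (∀ x ∈ F, ⟪x, n⟫ ≤ 0) ∧ ∃ x ∈ F, ∃ y ∈ F, x ≠ y ∧ ⟪x, n⟫ = 0 ∧ ⟪y, n⟫ = 0}

lemma FinS.ne_neg {F : Finset (E 2)} {g : E 2} (h : FinS F g) {x y : E 2} (hx : x ∈ F) (hy : y ∈ F) : x ≠ -y := by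
  rintro rfl
  have h1 := h.pos _ hx
  have h2 := h.pos _ hy
  rw [inner_neg_right] at h1
  linarith

lemma FinS.inner_sq_lt {F : Finset (E 2)} {g : E 2} (h : FinS F g) {x y : E 2} (hx : x ∈ F) (hy : y ∈ F) (hxy : x ≠ y) :
    ⟪x, y⟫ ^ 2 < 1 := by
  have hxn := h.us x hx
  have hyn := h.us y hy
  have hlt : ⟪x, y⟫ < 1 := lt_of_le_of_ne (inner_le_one' hxn hyn) (fun h => hxy ((inner_eq_one_iff_of_norm_eq_one hxn hyn).1 h))
  have hgt : -1 < ⟪x, y⟫ := by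
    apply lt_of_le_of_ne (neg_one_le_inner' hxn hyn)
    intro h3
    apply h.ne_neg hx hy
    have h2 : ‖x + y‖ ^ 2 = 0 := by
      rw [norm_add_sq_real, hxn, hyn, ← h3]; norm_num
    have h3 : x + y = 0 := by simpa using h2
    exact eq_neg_of_add_eq_zero_left h3
  nlinarith

lemma perp_unique {x y n n' : E 2} (hn : ‖n‖ = 1) (hn' : ‖n'‖ = 1) (hx : ‖x‖ = 1) (hy : ‖y‖ = 1) (hxy : ⟪x, y⟫ ^ 2 < 1)
    (h1 : ⟪x, n⟫ = 0) (h2 : ⟪y, n⟫ = 0) (h1' : ⟪x, n'⟫ = 0) (h2' : ⟪y, n'⟫ = 0) : n' = n ∨ n' = -n := by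
  obtain ⟨e, f, hF⟩ := exists_frame hn
  have hxx := inner_self_us hx
  have hyy := inner_self_us hy
  have hnn := inner_self_us hn'
  rw [hF.inner_eq, h1] at hxx
  rw [hF.inner_eq, h2] at hyy
  rw [hF.inner_eq] at hnn
  rw [hF.inner_eq, h1] at h1' hxy
  rw [hF.inner_eq, h2] at h2'
  set x1 := ⟪x, e⟫
  set x2 := ⟪x, f⟫
  set y1 := ⟪y, e⟫
  set y2 := ⟪y, f⟫
  have hdet : 0 < (x1 * y2 - x2 * y1) ^ 2 := by
    have : (x1 * y2 - x2 * y1) ^ 2 = (x1 * x1 + x2 * x2) * (y1 * y1 + y2 * y2) - (x1 * y1 + x2 * y2) ^ 2 := by ring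
    rw [this]
    nlinarith
  have hdet0 : x1 * y2 - x2 * y1 ≠ 0 := by
    intro h; rw [h] at hdet; norm_num at hdet
  have ha : ⟪n', e⟫ = 0 := by
    have : (x1 * y2 - x2 * y1) * ⟪n', e⟫ = 0 := by linear_combination y2 * h1' - x2 * h2'
    exact (mul_eq_zero.1 this).resolve_left hdet0
  have hb : ⟪n', f⟫ = 0 := by
    have : (x1 * y2 - x2 * y1) * ⟪n', f⟫ = 0 := by linear_combination x1 * h2' - y1 * h1'
    exact (mul_eq_zero.1 this).resolve_left hdet0
  have hdec := hF.decomp n'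
  rw [ha, hb, zero_smul, zero_smul, zero_add, zero_add] at hdec
  rw [ha, hb] at hnn
  have : (⟪n', n⟫ - 1) * (⟪n', n⟫ + 1) = 0 := by linarith
  rcases mul_eq_zero.1 this with h | h
  · left; rw [hdec, show ⟪n', n⟫ = 1 by linarith, one_smul]
  · right; rw [hdec, show ⟪n', n⟫ = -1 by linarith, neg_one_smul]

lemma FinS.enorm_finite {F : Finset (E 2)} {g : E 2} (h : FinS F g) : (enorm F).Finite := by
  have hsub : enorm F ⊆ ⋃ x ∈ F, ⋃ y ∈ F, {n | ‖n‖ = 1 ∧ x ≠ y ∧ ⟪x, n⟫ = 0 ∧ ⟪y, n⟫ = 0} := by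
    rintro n ⟨hn, _, x, hx, y, hy, hr⟩
    simp only [mem_iUnion]
    exact ⟨x, hx, y, hy, hn, hr⟩
  refine Set.Finite.subset ?_ hsub
  refine F.finite_toSet.biUnion fun x hx => F.finite_toSet.biUnion fun y hy => ?_
  by_cases hemp : {n : E 2 | ‖n‖ = 1 ∧ x ≠ y ∧ ⟪x, n⟫ = 0 ∧ ⟪y, n⟫ = 0} = ∅
  · rw [hemp]; exact finite_empty
  · obtain ⟨n, hn, hxy, h1, h2⟩ := nonempty_iff_ne_empty.2 hemp
    refine Set.Finite.subset (Set.toFinite {n, -n}) ?_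
    rintro n' ⟨hn', _, h1', h2'⟩
    exact perp_unique hn hn' (h.us x hx) (h.us y hy) (h.inner_sq_lt hx hy hxy) h1 h2 h1' h2'

def ThE (F : Finset (E 2)) (n : E 2) : Set (E 2) := {y | y ∈ fcone F ∧ ⟪y, n⟫ = 0 ∧ ∀ x ∈ F, y ∉ ray x}

/-- planar cone for vertex pieces -/
def ThV (F : Finset (E 2)) : Set (E 2) := {y | y ≠ 0 ∧ ∀ x ∈ F, ⟪x, y⟫ ≤ 0}

/-- pieces -/
def piece (Θ : Set (E 2)) (c : E 2) (I : Set ℝ) : Set (E 2) := {z | z - ⟪z, c⟫ • c ∈ Θ ∧ ⟪z, c⟫ ∈ I}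

lemma measurableSet_piece {Θ : Set (E 2)} (hΘ : MeasurableSet Θ) (c : E 2) {I : Set ℝ} (hI : MeasurableSet I) :
    MeasurableSet (piece Θ c I) := by
  have h1 : Measurable (fun z : E 2 => z - ⟪z, c⟫ • c) := by fun_prop
  have h2 : Measurable (fun z : E 2 => ⟪z, c⟫) := by fun_prop
  exact (h1 hΘ).inter (h2 hI)

lemma FinS.meas_ThE {F : Finset (E 2)} {g : E 2} (h : FinS F g) (n : E 2) : MeasurableSet (ThE F n) := by
  have : ThE F n = (fcone F ∩ {y | ⟪y, n⟫ = 0}) ∩ ⋂ x ∈ F, (ray x)ᶜ := by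
    ext y; simp only [ThE, mem_setOf_eq, mem_inter_iff, mem_iInter, mem_compl_iff]; tauto
  rw [this]
  apply MeasurableSet.inter
  · exact (h.ccone.closed.inter (isClosed_eq (by fun_prop) continuous_const)).measurableSet
  · exact Finset.measurableSet_biInter _ fun x hx => (isClosed_ray (h.us x hx)).measurableSet.compl

lemma meas_ThV (F : Finset (E 2)) : MeasurableSet (ThV F) := by
  have : ThV F = {0}ᶜ ∩ ⋂ x ∈ F, {y | ⟪x, y⟫ ≤ 0} := by
    ext y; simp [ThV]
  rw [this]
  apply (measurableSet_singleton _).compl.inter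
  exact Finset.measurableSet_biInter _ fun x hx => (isClosed_le (by fun_prop) continuous_const).measurableSet

lemma cone_ThE (F : Finset (E 2)) (n : E 2) : ∀ a : ℝ, 0 < a → ∀ z, a • z ∈ ThE F n ↔ z ∈ ThE F n := by
  have key : ∀ a : ℝ, 0 < a → ∀ z, z ∈ ThE F n → a • z ∈ ThE F n := by
    rintro a ha z ⟨h1, h2, h3⟩
    refine ⟨fcone_smul ha.le h1, by rw [inner_smul_left, h2, mul_zero], ?_⟩
    rintro x hx ⟨b, hb, hh⟩
    apply h3 x hx
    refine ⟨a⁻¹ * b, by positivity, ?_⟩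
    rw [mul_smul, ← hh, smul_smul, inv_mul_cancel₀ ha.ne', one_smul]
  intro a ha z
  refine ⟨fun h => ?_, key a ha z⟩
  have := key a⁻¹ (by positivity) _ h
  rwa [smul_smul, inv_mul_cancel₀ ha.ne', one_smul] at this

lemma cone_ThV (F : Finset (E 2)) : ∀ a : ℝ, 0 < a → ∀ z, a • z ∈ ThV F ↔ z ∈ ThV F := by
  have key : ∀ a : ℝ, 0 < a → ∀ z, z ∈ ThV F → a • z ∈ ThV F := by
    rintro a ha z ⟨h1, h2⟩
    refine ⟨smul_ne_zero ha.ne' h1, ?_⟩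
    intro x hx
    rw [inner_smul_right]
    exact mul_nonpos_of_nonneg_of_nonpos ha.le (h2 x hx)
  intro a ha z
  refine ⟨fun h => ?_, key a ha z⟩
  have := key a⁻¹ (by positivity) _ h
  rwa [smul_smul, inv_mul_cancel₀ ha.ne', one_smul] at this

/-- scaling of pieces -/
lemma piece_scale {Θ : Set (E 2)} (hΘ : MeasurableSet Θ) (hcone : ∀ a : ℝ, 0 < a → ∀ z, a • z ∈ Θ ↔ z ∈ Θ)
    {c : E 2} (hc : ‖c‖ = 1) {i j : ℝ} (hij : i ≤ j) {I J : Set ℝ} (hI : MeasurableSet I) (hJ : MeasurableSet J)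
    (hIv : volume (I ∩ Ioo (-1) 1) = ENNReal.ofReal (j - i)) {l : ℝ} (hl : 0 ≤ l) (hJv : volume (J ∩ Ioo (-1) 1) = ENNReal.ofReal l) :
    (j - i) * sig.real (piece Θ c J) = l * sig.real (piece Θ c I) := by
  obtain ⟨e, f, hF⟩ := exists_frame hc
  have h1 := sig_prod hF hΘ hcone hI
  have h2 := sig_prod hF hΘ hcone hJ
  unfold piece Measure.real
  rw [h1, h2, ENNReal.toReal_mul, ENNReal.toReal_mul, hIv, hJv, ENNReal.toReal_ofReal hl, ENNReal.toReal_ofReal (by linarith)]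
  ring


/-- total edge strip mass -/
def Sm {F : Finset (E 2)} {g : E 2} (h : FinS F g) : ℝ := ∑ n ∈ h.enorm_finite.toFinset, sig.real (piece (ThE F n) n (Ioi 0))

/-- total vertex mass -/
def Vm (F : Finset (E 2)) : ℝ := ∑ x ∈ F, sig.real (piece (ThV F) x (Ioi 0))

lemma inner_nrm_self_left {x : E 2} (hx : x ≠ 0) : ⟪x, nrm x⟫ = ‖x‖ := by
  unfold nrm
  rw [inner_smul_right, real_inner_self_eq_norm_sq]
  have := norm_ne_zero_iff.2 hx
  field_simp

lemma inner_nrm_zero {x y : E 2} (h : ⟪x, y⟫ = 0) : ⟪x, nrm y⟫ = 0 := by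
  unfold nrm
  rw [inner_smul_right, h, mul_zero]

lemma inner_nrm_nonpos {x y : E 2} (h : ⟪x, y⟫ ≤ 0) : ⟪x, nrm y⟫ ≤ 0 := by
  unfold nrm
  rw [inner_smul_right]
  exact mul_nonpos_of_nonneg_of_nonpos (by positivity) h

lemma FinS.cover {F : Finset (E 2)} {g : E 2} (h : FinS F g) :
    4 * π ≤ sig.real (fcone F ∩ unitSphere 2) + Sm h + Vm F + sig.real (polar (F : Set (E 2))) := by
  have hsub : unitSphere 2 ⊆ (fcone F ∩ unitSphere 2) ∪ (⋃ n ∈ h.enorm_finite.toFinset, piece (ThE F n) n (Ioi 0)) ∪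
      (⋃ x ∈ F, piece (ThV F) x (Ioi 0)) ∪ polar (F : Set (E 2)) := by
    intro z hz
    obtain ⟨f, hf, n, hzfn, hfn, hn⟩ := h.ccone.moreau z
    by_cases hn0 : n = 0
    · left; left; left
      subst hn0
      rw [add_zero] at hzfn
      exact ⟨hzfn ▸ hf, hz⟩
    by_cases hf0 : f = 0
    · right
      subst hf0
      rw [zero_add] at hzfn
      subst hzfn
      exact ⟨hz, fun x hx => hn x (fcone_mem hx)⟩
    by_cases hray : ∃ x ∈ F, f ∈ ray x
    · left; right
      obtain ⟨x, hx, a, ha, hfa⟩ := hray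
      have ha0 : a ≠ 0 := by rintro rfl; apply hf0; rw [hfa, zero_smul]
      have hxx := inner_self_us (h.us x hx)
      have hxn : ⟪n, x⟫ = 0 := by
        rw [hfa, inner_smul_left, real_inner_comm] at hfn
        exact (mul_eq_zero.1 hfn).resolve_left ha0
      have hzx : ⟪z, x⟫ = a := by
        rw [hzfn, hfa, inner_add_left, inner_smul_left, hxx, hxn]; simp
      simp only [mem_iUnion]
      refine ⟨x, hx, ?_, ?_⟩
      · rw [hzx, hzfn, ← hfa, add_sub_cancel_left]
        exact ⟨hn0, fun y hy => hn y (fcone_mem hy)⟩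
      · rw [hzx]; exact lt_of_le_of_ne ha (Ne.symm ha0)
    · left; left; right
      push Not at hray
      simp only [mem_iUnion]
      have hzn : ⟪z, nrm n⟫ = ‖n‖ := by
        rw [hzfn, inner_add_left, inner_nrm_zero hfn, inner_nrm_self_left hn0, zero_add]
      have hzf : z - ⟪z, nrm n⟫ • nrm n = f := by
        rw [hzn, norm_smul_nrm, hzfn, add_sub_cancel_right]
      refine ⟨nrm n, ?_, ?_, ?_⟩
      · rw [Set.Finite.mem_toFinset]
        refine ⟨norm_nrm hn0, fun x hx => inner_nrm_nonpos (hn x (fcone_mem hx)), ?_⟩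
        obtain ⟨a, ha, hfa⟩ := hf
        have hsum : ∀ x ∈ F, a x * ⟪x, n⟫ = 0 := by
          have h1 : ∑ x ∈ F, a x * ⟪x, n⟫ = 0 := by
            rw [← hfn, hfa, sum_inner]
            exact Finset.sum_congr rfl fun x _ => by rw [inner_smul_left]; rfl
          exact (Finset.sum_eq_zero_iff_of_nonpos (fun x hx => mul_nonpos_of_nonneg_of_nonpos (ha x) (hn x (fcone_mem hx)))).1 h1
        have hx1 : ∃ x ∈ F, a x ≠ 0 := by
          by_contra hcon
          push Not at hcon
          apply hf0
          rw [hfa]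
          exact Finset.sum_eq_zero (fun x hx => by rw [hcon x hx, zero_smul])
        obtain ⟨x, hx, hax⟩ := hx1
        have hy1 : ∃ y ∈ F, y ≠ x ∧ a y ≠ 0 := by
          by_contra hcon
          push Not at hcon
          apply hray x hx
          refine ⟨a x, ha x, ?_⟩
          rw [hfa]
          apply Finset.sum_eq_single_of_mem x hx
          intro y hy hyx
          rw [hcon y hy hyx, zero_smul]
        obtain ⟨y, hy, hyx, hay⟩ := hy1
        exact ⟨x, hx, y, hy, hyx.symm, inner_nrm_zero ((mul_eq_zero.1 (hsum x hx)).resolve_left hax),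
          inner_nrm_zero ((mul_eq_zero.1 (hsum y hy)).resolve_left hay)⟩
      · rw [hzf]
        exact ⟨hf, inner_nrm_zero hfn, hray⟩
      · rw [hzn]; exact norm_pos_iff.2 hn0
  have h1 := measureReal_mono (μ := sig) hsub
  have h2 : sig.real (unitSphere 2) = 4 * π := by
    rw [← sig_real_univ, ← sig_inter_us univ, univ_inter]
  rw [h2] at h1
  refine h1.trans ?_
  refine (measureReal_union_le _ _).trans ?_
  gcongr
  refine (measureReal_union_le _ _).trans ?_
  gcongr
  · refine (measureReal_union_le _ _).trans ?_
    gcongr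
    exact measureReal_biUnion_finset_le _ _
  · exact measureReal_biUnion_finset_le _ _

lemma fcone_inner_ge {D : ℝ} {M L : Set (E 2)} (hc : 0 ≤ Real.cos D) (h : Good D M L) {F : Finset (E 2)} (hFM : (F : Set (E 2)) ⊆ M)
    {f m : E 2} (hf : f ∈ fcone F) (hm : m ∈ M) : Real.cos D * ‖f‖ ≤ ⟪f, m⟫ := by
  obtain ⟨a, ha, rfl⟩ := hf
  have h1 : ‖∑ x ∈ F, a x • x‖ ≤ ∑ x ∈ F, a x := by
    refine (norm_sum_le _ _).trans (Finset.sum_le_sum fun x hx => ?_)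
    rw [norm_smul, mem_us.1 (h.MS (hFM hx)), mul_one, Real.norm_of_nonneg (ha x)]
  calc _ ≤ Real.cos D * ∑ x ∈ F, a x := by gcongr
    _ = ∑ x ∈ F, a x * Real.cos D := by rw [Finset.mul_sum]; exact Finset.sum_congr rfl fun x _ => mul_comm _ _
    _ ≤ ∑ x ∈ F, a x * ⟪x, m⟫ := Finset.sum_le_sum fun x hx => mul_le_mul_of_nonneg_left (h.diam _ (hFM hx) _ hm) (ha x)
    _ = _ := by
      rw [sum_inner]
      exact Finset.sum_congr rfl fun x _ => by rw [inner_smul_left]; rfl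

lemma neg_mem_L {D : ℝ} (hD0 : 0 < D) (hD : D < π / 2) {M L : Set (E 2)} (h : Good D M L) {F : Finset (E 2)} (hFM : (F : Set (E 2)) ⊆ M)
    {z f : E 2} (hz : ‖z‖ = 1) (hf : f ∈ fcone F) (hzf : ⟪z, f⟫ = ‖f‖ ^ 2) (hfs : Real.sin D ≤ ‖f‖) : -z ∈ L := by
  have hc : 0 < Real.cos D := Real.cos_pos_of_mem_Ioo ⟨by linarith, hD⟩
  have hsn : 0 < Real.sin D := Real.sin_pos_of_pos_of_lt_pi hD0 (by linarith)
  have hfp : 0 < ‖f‖ := by linarith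
  have hf0 : f ≠ 0 := norm_pos_iff.1 hfp
  rw [h.LM]
  refine ⟨mem_us.2 (by rwa [norm_neg]), fun m hm => ?_⟩
  apply ball_sub_polar hD0 hD (norm_nrm hf0) (mem_us.1 (h.MS hm)) (by rwa [norm_neg])
  · unfold nrm
    rw [inner_smul_left]
    have := fcone_inner_ge hc.le h hFM hf hm
    simp only [RCLike.conj_to_real]
    rw [inv_mul_eq_div, le_div_iff₀ hfp]
    exact this
  · unfold nrm
    rw [inner_neg_left, neg_neg, inner_smul_right, hzf, sq, ← mul_assoc, inv_mul_cancel₀ hfp.ne', one_mul]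
    exact hfs

lemma FinS.lower {D : ℝ} (hD0 : 0 < D) (hD : D < π / 2) {M L : Set (E 2)} (h : Good D M L) {F : Finset (E 2)} {g : E 2}
    (hF : FinS F g) (hFM : (F : Set (E 2)) ⊆ M) :
    sig.real (fcone F ∩ unitSphere 2) + Real.cos D * Sm hF + (1 - Real.sin D) * Vm F ≤ sig.real L := by
  have hc : 0 < Real.cos D := Real.cos_pos_of_mem_Ioo ⟨by linarith, hD⟩
  have hsn : 0 < Real.sin D := Real.sin_pos_of_pos_of_lt_pi hD0 (by linarith)
  have hcs := Real.sin_sq_add_cos_sq D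
  have hc1 : Real.cos D < 1 := by nlinarith
  have hs1 : Real.sin D < 1 := by nlinarith
  set EP : E 2 → Set (E 2) := fun n => piece (ThE F n) n (Ioc 0 (Real.cos D)) ∩ unitSphere 2 with hEP
  set VP : E 2 → Set (E 2) := fun x => piece (ThV F) x (Ici (Real.sin D)) ∩ unitSphere 2 with hVP
  have mEP : ∀ n, MeasurableSet (EP n) := fun n => (measurableSet_piece (hF.meas_ThE n) n measurableSet_Ioc).inter measurable_us
  have mVP : ∀ x, MeasurableSet (VP x) := fun x => (measurableSet_piece (meas_ThV F) x measurableSet_Ici).inter measurable_us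
  have mL : MeasurableSet L := by rw [h.LM]; exact (isClosed_polar M).measurableSet
  have dE : ∀ n ∈ enorm F, ∀ z ∈ EP n, ∃ f ∈ fcone F, z = f + ⟪z, n⟫ • n ∧ ⟪f, ⟪z, n⟫ • n⟫ = 0 ∧
      (∀ y ∈ fcone F, ⟪y, ⟪z, n⟫ • n⟫ ≤ 0) ∧ 0 < ⟪z, n⟫ ∧ (∀ x ∈ F, f ∉ ray x) ∧ Real.sin D ≤ ‖f‖ := by
    rintro n ⟨hn, hnF, _⟩ z ⟨⟨⟨h1, h2, h3⟩, h4, h5⟩, h6⟩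
    refine ⟨z - ⟪z, n⟫ • n, h1, by simp, by rw [inner_smul_right, h2, mul_zero], ?_, h4, h3, ?_⟩
    · intro y hy
      rw [inner_smul_right]
      exact mul_nonpos_of_nonneg_of_nonpos h4.le (fcone_polar hnF y hy)
    · apply le_of_sq_le_sq _ (norm_nonneg _)
      rw [norm_sub_sq_real, inner_smul_right, norm_smul, hn, mem_us.1 h6, Real.norm_of_nonneg h4.le]
      nlinarith
  have dV : ∀ x ∈ F, ∀ z ∈ VP x, ∃ n, n ≠ 0 ∧ z = ⟪z, x⟫ • x + n ∧ ⟪⟪z, x⟫ • x, n⟫ = 0 ∧ (∀ y ∈ fcone F, ⟪y, n⟫ ≤ 0) ∧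
      Real.sin D ≤ ⟪z, x⟫ ∧ ⟪z, x⟫ • x ∈ fcone F := by
    rintro x hx z ⟨⟨⟨h1, h2⟩, h3⟩, h4⟩
    refine ⟨z - ⟪z, x⟫ • x, h1, by simp, ?_, fcone_polar h2, h3, fcone_smul (hsn.le.trans h3) (fcone_mem hx)⟩
    rw [inner_smul_left, inner_sub_right, inner_smul_right, inner_self_us (hF.us x hx), real_inner_comm]
    simp
  have hsub : (fcone F ∩ unitSphere 2) ∪ (⋃ n ∈ hF.enorm_finite.toFinset, EP n) ∪ (⋃ x ∈ F, VP x) ⊆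
      (LinearIsometryEquiv.neg ℝ : E 2 ≃ₗᵢ[ℝ] E 2) ⁻¹' L := by
    rintro z ((⟨hz, hzu⟩ | hz) | hz)
    · show -z ∈ L
      apply neg_mem_L hD0 hD h hFM (mem_us.1 hzu) hz
      · exact real_inner_self_eq_norm_sq _
      · rw [mem_us.1 hzu]; exact hs1.le
    · simp only [mem_iUnion] at hz
      obtain ⟨n, hn, hz⟩ := hz
      rw [Set.Finite.mem_toFinset] at hn
      obtain ⟨f, hf, e1, e2, e3, e4, e5, e6⟩ := dE n hn z hz
      show -z ∈ L
      apply neg_mem_L hD0 hD h hFM (mem_us.1 hz.2) hf _ e6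
      conv_lhs => rw [e1]
      rw [inner_add_left, real_inner_comm f (⟪z, n⟫ • n), e2, real_inner_self_eq_norm_sq, add_zero]
    · simp only [mem_iUnion] at hz
      obtain ⟨x, hx, hz⟩ := hz
      obtain ⟨n, e1, e2, e3, e4, e5, e6⟩ := dV x hx z hz
      show -z ∈ L
      have hxu := hF.us x hx
      apply neg_mem_L hD0 hD h hFM (mem_us.1 hz.2) e6
      · rw [inner_smul_right, norm_smul, hxu, mul_one, Real.norm_eq_abs, sq_abs, sq]
      · rw [norm_smul, hxu, mul_one, Real.norm_of_nonneg (hsn.le.trans e5)]; exact e5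
  have hmain := measureReal_mono (μ := sig) hsub
  have hLeq : sig.real ((LinearIsometryEquiv.neg ℝ : E 2 ≃ₗᵢ[ℝ] E 2) ⁻¹' L) = sig.real L := by
    unfold Measure.real; rw [sig_map_isometry _ mL]
  rw [hLeq] at hmain
  have hdisj1 : Disjoint (fcone F ∩ unitSphere 2) (⋃ n ∈ hF.enorm_finite.toFinset, EP n) := by
    rw [Set.disjoint_left]
    rintro z ⟨hz, _⟩ hz'
    simp only [mem_iUnion] at hz'
    obtain ⟨n, hn, hz'⟩ := hz'
    rw [Set.Finite.mem_toFinset] at hn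
    obtain ⟨f, hf, e1, e2, e3, e4, e5, e6⟩ := dE n hn z hz'
    have := moreau_unique (n := 0) hz hf (by simp) e3 (by simp) e2 (by rw [add_zero]; exact e1)
    rw [this] at e1
    have h0 : ⟪z, n⟫ • n = 0 := by
      rw [this]
      exact (left_eq_add.1 e1)
    rcases smul_eq_zero.1 h0 with h0 | h0
    · exact e4.ne' h0
    · have := hn.1; rw [h0] at this; simp at this
  have hdisj2 : Disjoint ((fcone F ∩ unitSphere 2) ∪ (⋃ n ∈ hF.enorm_finite.toFinset, EP n)) (⋃ x ∈ F, VP x) := by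
    rw [Set.disjoint_left]
    rintro z hz hz'
    simp only [mem_iUnion] at hz'
    obtain ⟨x, hx, hz'⟩ := hz'
    obtain ⟨m, d1, d2, d3, d4, d5, d6⟩ := dV x hx z hz'
    rcases hz with ⟨hz, _⟩ | hz
    · have := moreau_unique (n := 0) hz d6 (by simp) d4 (by simp) d3 (by rw [add_zero]; exact d2)
      rw [← this] at d2
      exact d1 (left_eq_add.1 d2)
    · simp only [mem_iUnion] at hz
      obtain ⟨n, hn, hz⟩ := hz
      rw [Set.Finite.mem_toFinset] at hn
      obtain ⟨f, hf, e1, e2, e3, e4, e5, e6⟩ := dE n hn z hz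
      have := moreau_unique hf d6 e3 d4 e2 d3 (by rw [← d2, ← e1])
      exact e5 x hx ⟨⟪z, x⟫, hsn.le.trans d5, this⟩
  rw [measureReal_union hdisj2 (Finset.measurableSet_biUnion _ fun x _ => mVP x) (measure_ne_top _ _) (measure_ne_top _ _),
    measureReal_union hdisj1 (Finset.measurableSet_biUnion _ fun x _ => mEP x) (measure_ne_top _ _) (measure_ne_top _ _),
    measureReal_biUnion_finset _ (fun x _ => mEP x), measureReal_biUnion_finset _ (fun x _ => mVP x)] at hmain
  · have hSE : ∑ n ∈ hF.enorm_finite.toFinset, sig.real (EP n) = Real.cos D * Sm hF := by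
      unfold Sm
      rw [Finset.mul_sum]
      apply Finset.sum_congr rfl
      intro n hn
      rw [Set.Finite.mem_toFinset] at hn
      rw [hEP]
      simp only
      rw [sig_inter_us]
      have := piece_scale (hF.meas_ThE n) (cone_ThE F n) hn.1 (i := 0) (j := 1) zero_le_one (I := Ioi 0) (J := Ioc 0 (Real.cos D))
        measurableSet_Ioi measurableSet_Ioc ?_ hc.le ?_
      · simpa using this
      · rw [show (Ioi (0:ℝ) ∩ Ioo (-1) 1) = Ioo 0 1 by ext x; simp; intros; linarith]; simp
      · rw [show (Ioc 0 (Real.cos D) ∩ Ioo (-1) 1) = Ioc 0 (Real.cos D) by ext x; simp; intros; (try constructor) <;> linarith]; simp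
    have hSV : ∑ x ∈ F, sig.real (VP x) = (1 - Real.sin D) * Vm F := by
      unfold Vm
      rw [Finset.mul_sum]
      apply Finset.sum_congr rfl
      intro x hx
      rw [hVP]
      simp only
      rw [sig_inter_us]
      have := piece_scale (meas_ThV F) (cone_ThV F) (hF.us x hx) (i := 0) (j := 1) zero_le_one (I := Ioi 0) (J := Ici (Real.sin D))
        measurableSet_Ioi measurableSet_Ici ?_ (l := 1 - Real.sin D) (by linarith) ?_
      · simpa using this
      · rw [show (Ioi (0:ℝ) ∩ Ioo (-1) 1) = Ioo 0 1 by ext x; simp; intros; linarith]; simp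
      · rw [show (Ici (Real.sin D) ∩ Ioo (-1) 1) = Ico (Real.sin D) 1 by
          ext x; simp; intros; linarith]; simp
    rw [hSE, hSV] at hmain
    exact hmain
  · intro x hx y hy hxy
    show Disjoint (VP x) (VP y)
    rw [Set.disjoint_left]
    rintro z hz hz'
    obtain ⟨m, d1, d2, d3, d4, d5, d6⟩ := dV x hx z hz
    obtain ⟨m', d1', d2', d3', d4', d5', d6'⟩ := dV y hy z hz'
    have := moreau_unique d6 d6' d4 d4' d3 d3' (by rw [← d2, ← d2'])
    apply hxy
    rw [← nrm_of_unit (hF.us x hx), ← nrm_of_unit (hF.us y hy), ← nrm_pos_smul (hsn.trans_le d5) x, this,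
      nrm_pos_smul (hsn.trans_le d5') y]
  · intro n hn n' hn' hnn
    show Disjoint (EP n) (EP n')
    rw [Set.disjoint_left]
    rintro z hz hz'
    simp only [Finset.mem_coe, Set.Finite.mem_toFinset] at hn hn'
    obtain ⟨f, hf, e1, e2, e3, e4, e5, e6⟩ := dE n hn z hz
    obtain ⟨f', hf', e1', e2', e3', e4', e5', e6'⟩ := dE n' hn' z hz'
    have := moreau_unique hf hf' e3 e3' e2 e2' (by rw [← e1, ← e1'])
    have h2 : ⟪z, n⟫ • n = ⟪z, n'⟫ • n' := by
      have h3 : f + ⟪z, n⟫ • n = f' + ⟪z, n'⟫ • n' := by rw [← e1, ← e1']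
      rw [this] at h3
      exact add_left_cancel h3
    apply hnn
    rw [← nrm_of_unit hn.1, ← nrm_of_unit hn'.1, ← nrm_pos_smul e4 n, h2, nrm_pos_smul e4' n']


lemma exists_frame_isom {e f c e' f' c' : E 2} (h : Frame e f c) (h' : Frame e' f' c') :
    ∃ J : E 2 ≃ₗᵢ[ℝ] E 2, ∀ z, J z = ⟪z, e⟫ • e' + ⟪z, f⟫ • f' + ⟪z, c⟫ • c' := by
  refine ⟨h.basis.equiv h'.basis (Equiv.refl _), fun z => ?_⟩
  have h0 : (h.basis.equiv h'.basis (Equiv.refl _)) e = e' := by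
    have := OrthonormalBasis.equiv_apply_basis h.basis h'.basis (Equiv.refl _) 0
    rw [h.basis_coe, h'.basis_coe] at this
    simpa using this
  have h1 : (h.basis.equiv h'.basis (Equiv.refl _)) f = f' := by
    have := OrthonormalBasis.equiv_apply_basis h.basis h'.basis (Equiv.refl _) 1
    rw [h.basis_coe, h'.basis_coe] at this
    simpa using this
  have h2 : (h.basis.equiv h'.basis (Equiv.refl _)) c = c' := by
    have := OrthonormalBasis.equiv_apply_basis h.basis h'.basis (Equiv.refl _) 2
    rw [h.basis_coe, h'.basis_coe] at this
    simpa using this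
  conv_lhs => rw [h.decomp z]
  rw [map_add, map_add, map_smul, map_smul, map_smul, h0, h1, h2]

lemma exists_perp (g u : E 2) : ∃ v : E 2, v ≠ 0 ∧ ⟪v, g⟫ = 0 ∧ ⟪v, u⟫ = 0 := by
  by_cases hg : g = 0
  · obtain ⟨c, hc⟩ : ∃ c : E 2, ‖c‖ = 1 ∧ ⟪c, u⟫ = 0 := by
      by_cases hu : u = 0
      · subst hu
        obtain ⟨c, hc⟩ := exists_norm_eq (E 2) zero_le_one
        exact ⟨c, hc, by simp⟩
      · obtain ⟨e, f, hF⟩ := exists_frame (norm_nrm hu)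
        refine ⟨e, ?_, ?_⟩
        · have := hF.ee; rw [real_inner_self_eq_norm_sq] at this
          nlinarith [norm_nonneg e]
        · rw [← norm_smul_nrm u, inner_smul_right, hF.ec, mul_zero]
    exact ⟨c, by rintro rfl; simp at hc, by simp [hg], hc.2⟩
  · obtain ⟨e, f, hF⟩ := exists_frame (norm_nrm hg)
    have key : ∀ a b : ℝ, ⟪a • e + b • f, g⟫ = 0 := by
      intro a b
      rw [← norm_smul_nrm g, inner_smul_right, inner_add_left, inner_smul_left, inner_smul_left, hF.ec, hF.fc]; simp
    have hne : ∀ a b : ℝ, a • e + b • f = 0 → a = 0 ∧ b = 0 := by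
      intro a b h
      have h1 : ⟪a • e + b • f, e⟫ = 0 := by rw [h]; simp
      have h2 : ⟪a • e + b • f, f⟫ = 0 := by rw [h]; simp
      rw [inner_add_left, inner_smul_left, inner_smul_left, hF.ee, real_inner_comm, hF.ef] at h1
      rw [inner_add_left, inner_smul_left, inner_smul_left, hF.ef, hF.ff] at h2
      simp at h1 h2
      exact ⟨h1, h2⟩
    by_cases h0 : ⟪e, u⟫ = 0
    · refine ⟨(1:ℝ) • e + (0:ℝ) • f, ?_, key _ _, by simp [h0]⟩
      intro h; have := (hne _ _ h).1; norm_num at this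
    · refine ⟨(-⟪f, u⟫) • e + ⟪e, u⟫ • f, ?_, key _ _, ?_⟩
      · intro h; exact h0 (hne _ _ h).2
      · rw [inner_add_left, inner_smul_left, inner_smul_left]; simp; ring

/-- cut cone -/
def cutC (F : Finset (E 2)) (n : E 2) : Set (E 2) :=
  {d | (∃ x ∈ F, ⟪x, n⟫ = 0 ∧ 0 < ⟪x, d⟫) ∧ (∃ x ∈ F, ⟪x, n⟫ = 0 ∧ ⟪x, d⟫ < 0) ∧ ∀ x ∈ F, ⟪x, n⟫ = 0 → ⟪x, d⟫ ≠ 0}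

lemma meas_cutC (F : Finset (E 2)) (n : E 2) : MeasurableSet (cutC F n) := by
  have : cutC F n = (⋃ x ∈ F, ({d : E 2 | ⟪x, n⟫ = 0} ∩ {d | 0 < ⟪x, d⟫})) ∩
      ((⋃ x ∈ F, ({d : E 2 | ⟪x, n⟫ = 0} ∩ {d | ⟪x, d⟫ < 0})) ∩ ⋂ x ∈ F, ({d : E 2 | ⟪x, n⟫ = 0} ∩ {d | ⟪x, d⟫ = 0})ᶜ) := by
    ext d
    simp only [cutC, mem_setOf_eq, mem_inter_iff, mem_iUnion, mem_iInter, mem_compl_iff, exists_prop, not_and]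
  rw [this]
  refine MeasurableSet.inter ?_ (MeasurableSet.inter ?_ ?_)
  · exact Finset.measurableSet_biUnion _ fun x _ => (MeasurableSet.const _).inter (isOpen_lt continuous_const (by fun_prop)).measurableSet
  · exact Finset.measurableSet_biUnion _ fun x _ => (MeasurableSet.const _).inter (isOpen_lt (by fun_prop) continuous_const).measurableSet
  · exact Finset.measurableSet_biInter _ fun x _ => ((MeasurableSet.const _).inter (isClosed_eq (by fun_prop) continuous_const).measurableSet).compl

lemma cone_cutC (F : Finset (E 2)) (n : E 2) : ∀ a : ℝ, 0 < a → ∀ z, a • z ∈ cutC F n ↔ z ∈ cutC F n := by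
  intro a ha z
  simp only [cutC, mem_setOf_eq, inner_smul_right, mul_pos_iff_of_pos_left ha, show ∀ b : ℝ, a * b < 0 ↔ b < 0 from fun b => by constructor <;> intro h <;> nlinarith, ne_eq, mul_eq_zero, ha.ne', false_or]

lemma FinS.cut_le {F : Finset (E 2)} {g : E 2} (h : FinS F g) {n : E 2} (hn : n ∈ enorm F) :
    sig.real (piece (cutC F n) n univ) ≤ 4 * sig.real (piece (ThE F n) n (Ioi 0)) := by
  obtain ⟨hn1, hnF, -⟩ := hn
  have hhalf : sig.real (piece (cutC F n) n univ) = 2 * sig.real (piece (cutC F n) n (Ioi 0)) := by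
    have := piece_scale (meas_cutC F n) (cone_cutC F n) hn1 (i := 0) (j := 1) zero_le_one (I := Ioi 0) (J := univ)
        measurableSet_Ioi MeasurableSet.univ ?_ (l := 2) (by norm_num) ?_
    · simpa using this
    · rw [show (Ioi (0:ℝ) ∩ Ioo (-1) 1) = Ioo 0 1 by ext x; simp; intros; linarith]; simp
    · rw [univ_inter]; simp; norm_num
  obtain ⟨e, f, hF⟩ := exists_frame hn1
  have hF1 : Frame f (-e) n := ⟨hF.ff, by rw [inner_neg_neg, hF.ee], hF.cc, by rw [inner_neg_right, real_inner_comm, hF.ef, neg_zero], hF.fc,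
    by rw [inner_neg_left, hF.ec, neg_zero]⟩
  have hF2 : Frame (-f) e n := ⟨by rw [inner_neg_neg, hF.ff], hF.ee, hF.cc, by rw [inner_neg_left, real_inner_comm, hF.ef, neg_zero],
    by rw [inner_neg_left, hF.fc, neg_zero], hF.ec⟩
  obtain ⟨J1, hJ1⟩ := exists_frame_isom hF hF1
  obtain ⟨J2, hJ2⟩ := exists_frame_isom hF hF2
  have hsub : piece (cutC F n) n (Ioi 0) ⊆ (J1 ⁻¹' piece (ThE F n) n (Ioi 0)) ∪ (J2 ⁻¹' piece (ThE F n) n (Ioi 0)) := by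
    rintro z ⟨⟨⟨x, hx, hxn, hxd⟩, ⟨y, hy, hyn, hyd⟩, hall⟩, hz⟩
    set d := z - ⟪z, n⟫ • n with hd
    have hde : ⟪z, e⟫ = ⟪d, e⟫ := by rw [hd, inner_sub_left, inner_smul_left, real_inner_comm e n, hF.ec]; simp
    have hdf : ⟪z, f⟫ = ⟪d, f⟫ := by rw [hd, inner_sub_left, inner_smul_left, real_inner_comm f n, hF.fc]; simp
    have hdn : ⟪d, n⟫ = 0 := by rw [hd, inner_sub_left, inner_smul_left, hF.cc]; simp
    set d1 := ⟪d, e⟫ with hd1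
    set d2 := ⟪d, f⟫ with hd2
    have hddec : d = d1 • e + d2 • f := by
      have := hF.decomp d
      rw [hdn, zero_smul, add_zero] at this
      exact this
    set Y := ⟪x, d⟫ • y - ⟪y, d⟫ • x with hY
    have hYC : Y ∈ fcone F := by
      rw [hY, sub_eq_add_neg, ← neg_smul]
      exact fcone_add (fcone_smul hxd.le (fcone_mem hy)) (fcone_smul (by linarith) (fcone_mem hx))
    have hYg : 0 < ⟪g, Y⟫ := by
      rw [hY, inner_sub_right, inner_smul_right, inner_smul_right]
      have := mul_pos hxd (h.pos y hy)
      have := mul_pos (neg_pos.2 hyd) (h.pos x hx)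
      linarith
    have hYn : ⟪Y, n⟫ = 0 := by
      rw [hY, inner_sub_left, inner_smul_left, inner_smul_left, hxn, hyn]; simp
    have hYd : ⟪Y, d⟫ = 0 := by
      rw [hY, inner_sub_left, inner_smul_left, inner_smul_left]; simp; ring
    set y1 := ⟪Y, e⟫
    set y2 := ⟪Y, f⟫
    have hYdec : Y = y1 • e + y2 • f := by
      have := hF.decomp Y
      rw [hYn, zero_smul, add_zero] at this
      exact this
    have horth : y1 * d1 + y2 * d2 = 0 := by
      have := hF.inner_eq Y d
      rw [hYd, hYn] at this
      linarith
    have hd0 : d ≠ 0 := by intro h0; rw [h0] at hxd; simp at hxd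
    have hdd : 0 < d1 ^ 2 + d2 ^ 2 := by
      have h1 := hF.inner_eq d d
      rw [hdn, real_inner_self_eq_norm_sq] at h1
      have := norm_pos_iff.2 hd0
      nlinarith
    set t := (y2 * d1 - y1 * d2) / (d1 ^ 2 + d2 ^ 2) with ht
    have hYt : Y = t • (d1 • f - d2 • e) := by
      rw [hYdec, smul_sub, smul_smul, smul_smul]
      have e1 : y1 = -(t * d2) := by rw [ht]; field_simp; linear_combination d1 * horth
      have e2 : y2 = t * d1 := by rw [ht]; field_simp; linear_combination d2 * horth
      rw [e1, e2, neg_smul]; abel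
    have ht0 : t ≠ 0 := by intro h0; rw [hYt, h0] at hYg; simp at hYg
    have hmem : ∀ s : ℝ, 0 < s → ∀ q, s • q = Y → q ∈ ThE F n := by
      intro s hs q hq
      rw [← cone_ThE F n s hs, hq]
      refine ⟨hYC, hYn, ?_⟩
      rintro x' hx' ⟨a, ha, hYa⟩
      have ha0 : a ≠ 0 := by rintro rfl; rw [hYa] at hYg; simp at hYg
      have h1 : ⟪x', n⟫ = 0 := by
        rw [hYa, inner_smul_left] at hYn
        exact (mul_eq_zero.1 hYn).resolve_left ha0
      have h2 : ⟪x', d⟫ = 0 := by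
        rw [hYa, inner_smul_left] at hYd
        exact (mul_eq_zero.1 hYd).resolve_left ha0
      exact hall x' hx' h1 h2
    rcases lt_or_gt_of_ne ht0 with ht1 | ht1
    · right
      have hJn : ⟪J2 z, n⟫ = ⟪z, n⟫ := by
        rw [hJ2, inner_add_left, inner_add_left, inner_smul_left, inner_smul_left, inner_smul_left, hF2.ec, hF2.fc, hF2.cc]; simp
      refine ⟨?_, by rw [hJn]; exact hz⟩
      rw [hJn]
      apply hmem (-t) (by linarith)
      rw [hYt, hJ2, hde, hdf, add_sub_cancel_right]
      module
    · left
      have hJn : ⟪J1 z, n⟫ = ⟪z, n⟫ := by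
        rw [hJ1, inner_add_left, inner_add_left, inner_smul_left, inner_smul_left, inner_smul_left, hF1.ec, hF1.fc, hF1.cc]; simp
      refine ⟨?_, by rw [hJn]; exact hz⟩
      rw [hJn]
      apply hmem t ht1
      rw [hYt, hJ1, hde, hdf, add_sub_cancel_right]
      module
  have h1 := (measureReal_mono (μ := sig) hsub).trans (measureReal_union_le _ _)
  have hm := measurableSet_piece (h.meas_ThE n) n (measurableSet_Ioi (a := (0:ℝ)))
  have e1 : sig.real (J1 ⁻¹' piece (ThE F n) n (Ioi 0)) = sig.real (piece (ThE F n) n (Ioi 0)) := by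
    unfold Measure.real; rw [sig_map_isometry _ hm]
  have e2 : sig.real (J2 ⁻¹' piece (ThE F n) n (Ioi 0)) = sig.real (piece (ThE F n) n (Ioi 0)) := by
    unfold Measure.real; rw [sig_map_isometry _ hm]
  rw [e1, e2] at h1
  rw [hhalf]
  linarith

lemma FinS.cut_exists {F : Finset (E 2)} {g : E 2} (h : FinS F g) {u v : E 2} (hv : v ≠ 0) (hvg : ⟪v, g⟫ = 0) (hvu : ⟪v, u⟫ = 0)
    (hgen : ∀ x ∈ F, ⟪x, u⟫ ≠ 0) (hp : ∃ x ∈ F, 0 < ⟪x, u⟫) (hm : ∃ x ∈ F, ⟪x, u⟫ < 0) :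
    ∃ n ∈ enorm F, u ∈ piece (cutC F n) n univ ∧ 0 < ⟪n, v⟫ := by
  classical
  set Q := (F ×ˢ F).filter (fun p => 0 < ⟪p.1, u⟫ ∧ ⟪p.2, u⟫ < 0) with hQ
  have hQn : Q.Nonempty := by
    obtain ⟨x, hx, hx'⟩ := hp
    obtain ⟨y, hy, hy'⟩ := hm
    exact ⟨(x, y), by rw [hQ, Finset.mem_filter, Finset.mem_product]; exact ⟨⟨hx, hy⟩, hx', hy'⟩⟩
  set Y : E 2 × E 2 → E 2 := fun p => ⟪p.1, u⟫ • p.2 - ⟪p.2, u⟫ • p.1 with hY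
  have hYi : ∀ p (z : E 2), ⟪Y p, z⟫ = ⟪p.1, u⟫ * ⟪p.2, z⟫ - ⟪p.2, u⟫ * ⟪p.1, z⟫ := by
    intro p z
    rw [hY, inner_sub_left, inner_smul_left, inner_smul_left]; rfl
  have hYg : ∀ p ∈ Q, 0 < ⟪Y p, g⟫ := by
    intro p hpq
    rw [hQ, Finset.mem_filter, Finset.mem_product] at hpq
    rw [hYi, real_inner_comm g p.2, real_inner_comm g p.1]
    have := mul_pos hpq.2.1 (h.pos _ hpq.1.2)
    have := mul_pos (neg_pos.2 hpq.2.2) (h.pos _ hpq.1.1)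
    linarith
  obtain ⟨p0, hp0, hmax⟩ := Q.exists_max_image (fun p => ⟪Y p, v⟫ / ⟪Y p, g⟫) hQn
  set l := ⟪Y p0, v⟫ / ⟪Y p0, g⟫ with hl
  set g' := v - l • g with hg'
  have hle : ∀ p ∈ Q, ⟪Y p, g'⟫ ≤ 0 := by
    intro p hpq
    have := hmax p hpq
    rw [div_le_iff₀ (hYg p hpq)] at this
    rw [hg', inner_sub_right, inner_smul_right]
    linarith
  have heq : ⟪Y p0, g'⟫ = 0 := by
    rw [hg', inner_sub_right, inner_smul_right, hl]
    have := (hYg p0 hp0).ne'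
    field_simp
    ring
  have hp0' := hp0
  rw [hQ, Finset.mem_filter, Finset.mem_product] at hp0'
  obtain ⟨⟨hF1, hF2⟩, hu1, hu2⟩ := hp0'
  set n := g' - (⟪p0.1, g'⟫ / ⟪p0.1, u⟫) • u with hn
  have hYn : ∀ p, ⟪Y p, n⟫ = ⟪Y p, g'⟫ := by
    intro p
    rw [hn, inner_sub_right, inner_smul_right, hYi p u]; ring
  have hn1 : ⟪p0.1, n⟫ = 0 := by
    rw [hn, inner_sub_right, inner_smul_right, div_mul_cancel₀ _ hu1.ne', sub_self]
  have hn2 : ⟪p0.2, n⟫ = 0 := by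
    have h1 := hYn p0
    rw [heq, hYi, hn1, mul_zero, sub_zero] at h1
    exact (mul_eq_zero.1 h1).resolve_left hu1.ne'
  have hnv : 0 < ⟪n, v⟫ := by
    have h1 : 0 < ‖v‖ := norm_pos_iff.2 hv
    rw [hn, hg', inner_sub_left, inner_sub_left, inner_smul_left, inner_smul_left, real_inner_comm v g, real_inner_comm v u, hvg, hvu, real_inner_self_eq_norm_sq]
    simp only [mul_zero, sub_zero]
    positivity
  have hn0 : n ≠ 0 := by intro h0; rw [h0] at hnv; simp at hnv
  have hnF : ∀ x ∈ F, ⟪x, n⟫ ≤ 0 := by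
    intro x hx
    rcases lt_or_gt_of_ne (hgen x hx) with hx' | hx'
    · have h1 : (p0.1, x) ∈ Q := by rw [hQ, Finset.mem_filter, Finset.mem_product]; exact ⟨⟨hF1, hx⟩, hu1, hx'⟩
      have h2 := hle _ h1
      rw [← hYn, hYi] at h2
      simp only [hn1, mul_zero, sub_zero] at h2
      exact nonpos_of_mul_nonpos_right h2 hu1
    · have h1 : (x, p0.2) ∈ Q := by rw [hQ, Finset.mem_filter, Finset.mem_product]; exact ⟨⟨hx, hF2⟩, hx', hu2⟩
      have h2 := hle _ h1
      rw [← hYn, hYi] at h2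
      simp only [hn2, mul_zero, zero_sub] at h2
      have h3 : (-⟪p0.2, u⟫) * ⟪x, n⟫ ≤ 0 := by linarith
      exact nonpos_of_mul_nonpos_right h3 (by linarith)
  have hproj : ∀ x, ⟪x, nrm n⟫ = 0 → ⟪x, u - ⟪u, nrm n⟫ • nrm n⟫ = ⟪x, u⟫ := by
    intro x hx
    rw [inner_sub_right, inner_smul_right, hx, mul_zero, sub_zero]
  refine ⟨nrm n, ⟨norm_nrm hn0, fun x hx => inner_nrm_nonpos (hnF x hx), p0.1, hF1, p0.2, hF2, ?_, inner_nrm_zero hn1, inner_nrm_zero hn2⟩, ?_, ?_⟩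
  · intro h0; rw [h0] at hu1; linarith
  · refine ⟨⟨⟨p0.1, hF1, inner_nrm_zero hn1, ?_⟩, ⟨p0.2, hF2, inner_nrm_zero hn2, ?_⟩, ?_⟩, mem_univ _⟩
    · rw [hproj _ (inner_nrm_zero hn1)]; exact hu1
    · rw [hproj _ (inner_nrm_zero hn2)]; exact hu2
    · intro x hx hxn
      rw [hproj _ hxn]
      exact hgen x hx
  · unfold nrm
    rw [inner_smul_left]
    have := norm_pos_iff.2 hn0
    simp only [RCLike.conj_to_real]
    positivity

lemma two_cover (s : Finset (E 2)) (A : E 2 → Set (E 2)) (hA : ∀ n, MeasurableSet (A n)) {G : Set (E 2)} (hG : MeasurableSet G)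
    (H : ∀ u ∈ G, ∃ n ∈ s, ∃ n' ∈ s, n ≠ n' ∧ u ∈ A n ∧ u ∈ A n') : 2 * sig.real G ≤ ∑ n ∈ s, sig.real (A n) := by
  classical
  have h1 : 2 * sig G ≤ ∑ n ∈ s, sig (A n) := by
    calc 2 * sig G = ∫⁻ u, G.indicator (fun _ => 2) u ∂sig := by rw [lintegral_indicator hG]; simp
      _ ≤ ∫⁻ u, ∑ n ∈ s, (A n).indicator 1 u ∂sig := by
        apply lintegral_mono
        intro u
        by_cases hu : u ∈ G
        · obtain ⟨n, hn, n', hn', hnn, h1, h2⟩ := H u hu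
          simp only [indicator_of_mem hu]
          calc (2 : ENNReal) = ∑ m ∈ ({n, n'} : Finset (E 2)), (A m).indicator 1 u := by
                rw [Finset.sum_pair hnn, indicator_of_mem h1, indicator_of_mem h2]; norm_num
            _ ≤ _ := Finset.sum_le_sum_of_subset (by
                intro m hm; simp only [Finset.mem_insert, Finset.mem_singleton] at hm
                rcases hm with rfl | rfl <;> assumption)
        · simp only [indicator_of_notMem hu]; exact bot_le
      _ = _ := by
        rw [lintegral_finset_sum _ (fun n _ => measurable_one.indicator (hA n))]
        exact Finset.sum_congr rfl fun n _ => lintegral_indicator_one (hA n)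
  have h2 := ENNReal.toReal_mono (by simp [ENNReal.sum_eq_top]) h1
  rw [ENNReal.toReal_mul, ENNReal.toReal_sum (fun n _ => measure_ne_top _ _)] at h2
  exact h2

lemma FinS.crofton {F : Finset (E 2)} {g : E 2} (h : FinS F g) : 2 * π ≤ Sm h + sig.real (polar (F : Set (E 2))) := by
  set P := polar (F : Set (E 2)) with hP
  have hPm : MeasurableSet P := (isClosed_polar _).measurableSet
  set N : E 2 → Set (E 2) := fun x => {z | ⟪z, x⟫ ∈ Icc 0 0} with hN
  have hNm : ∀ x, MeasurableSet (N x) := fun x => (by fun_prop : Measurable fun z : E 2 => ⟪z, x⟫) measurableSet_Icc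
  have hN0 : ∀ x ∈ F, sig.real (N x) = 0 := by
    intro x hx
    rw [hN]
    simp only
    rw [sig_zone (h.us x hx) le_rfl (by norm_num) (by norm_num)]; simp
  set NP := (LinearIsometryEquiv.neg ℝ : E 2 ≃ₗᵢ[ℝ] E 2) ⁻¹' P with hNP
  have hNPm : MeasurableSet NP := (LinearIsometryEquiv.neg ℝ : E 2 ≃ₗᵢ[ℝ] E 2).continuous.measurable hPm
  set G := unitSphere 2 \ (P ∪ NP ∪ ⋃ x ∈ F, N x) with hG
  have hGm : MeasurableSet G := measurable_us.diff ((hPm.union hNPm).union (Finset.measurableSet_biUnion _ fun x _ => hNm x))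
  have h1 : 2 * sig.real G ≤ ∑ n ∈ h.enorm_finite.toFinset, sig.real (piece (cutC F n) n univ) := by
    apply two_cover _ _ (fun n => measurableSet_piece (meas_cutC F n) n MeasurableSet.univ) hGm
    rintro u ⟨hu, hu'⟩
    simp only [mem_union, mem_iUnion, not_or, not_exists] at hu'
    obtain ⟨⟨hu1, hu2⟩, hu3⟩ := hu'
    have hgen : ∀ x ∈ F, ⟪x, u⟫ ≠ 0 := by
      intro x hx h0
      apply hu3 x hx
      show ⟪u, x⟫ ∈ Icc 0 0
      rw [real_inner_comm, h0]; simp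
    have hp : ∃ x ∈ F, 0 < ⟪x, u⟫ := by
      by_contra hcon
      push Not at hcon
      exact hu1 ⟨hu, hcon⟩
    have hm : ∃ x ∈ F, ⟪x, u⟫ < 0 := by
      by_contra hcon
      push Not at hcon
      apply hu2
      refine ⟨mem_us.2 (by simpa using mem_us.1 hu), ?_⟩
      intro x hx
      show ⟪x, -u⟫ ≤ 0
      rw [inner_neg_right]
      linarith [hcon x hx]
    obtain ⟨v, hv, hvg, hvu⟩ := exists_perp g u
    obtain ⟨n, hn, hun, hnv⟩ := h.cut_exists hv hvg hvu hgen hp hm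
    obtain ⟨n', hn', hun', hnv'⟩ := h.cut_exists (neg_ne_zero.2 hv) (by rw [inner_neg_left, hvg, neg_zero]) (by rw [inner_neg_left, hvu, neg_zero]) hgen hp hm
    refine ⟨n, h.enorm_finite.mem_toFinset.2 hn, n', h.enorm_finite.mem_toFinset.2 hn', ?_, hun, hun'⟩
    rintro rfl
    rw [inner_neg_right] at hnv'
    linarith
  have h2 : ∑ n ∈ h.enorm_finite.toFinset, sig.real (piece (cutC F n) n univ) ≤ 4 * Sm h := by
    unfold Sm
    rw [Finset.mul_sum]
    exact Finset.sum_le_sum fun n hn => h.cut_le (h.enorm_finite.mem_toFinset.1 hn)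
  have h3 : 4 * π ≤ sig.real G + (sig.real P + sig.real P) := by
    have hs : unitSphere 2 ⊆ G ∪ (P ∪ NP ∪ ⋃ x ∈ F, N x) := by
      intro z hz
      by_cases hz' : z ∈ P ∪ NP ∪ ⋃ x ∈ F, N x
      · exact Or.inr hz'
      · exact Or.inl ⟨hz, hz'⟩
    have h4 : sig.real (unitSphere 2) = 4 * π := by
      rw [← sig_real_univ, ← sig_inter_us univ, univ_inter]
    have h5 := (measureReal_mono (μ := sig) hs).trans (measureReal_union_le _ _)
    have h6 := measureReal_union_le (μ := sig) (P ∪ NP) (⋃ x ∈ F, N x)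
    have h7 := measureReal_union_le (μ := sig) P NP
    have h8 := measureReal_biUnion_finset_le (μ := sig) F N
    rw [Finset.sum_eq_zero hN0] at h8
    have h9 : sig.real NP = sig.real P := by unfold Measure.real; rw [hNP, sig_map_isometry _ hPm]
    linarith
  linarith

lemma FinS.main_ineq {D : ℝ} (hD0 : 0 < D) (hD : D < π / 2) {M L : Set (E 2)} (h : Good D M L) {F : Finset (E 2)} {g : E 2}
    (hF : FinS F g) (hFM : (F : Set (E 2)) ⊆ M) :
    sig.real (fcone F ∩ unitSphere 2) * Real.sin D + 2 * π * (1 - Real.sin D) + (2 * π - sig.real (polar (F : Set (E 2)))) * Real.cos D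
      ≤ sig.real L := by
  have h1 := hF.cover
  have h2 := hF.lower hD0 hD h hFM
  have h3 := hF.crofton
  have hc : 0 < Real.cos D := Real.cos_pos_of_mem_Ioo ⟨by linarith, hD⟩
  have hsn : 0 < Real.sin D := Real.sin_pos_of_pos_of_lt_pi hD0 (by linarith)
  have hcs := Real.sin_sq_add_cos_sq D
  have hc1 : Real.cos D < 1 := by nlinarith
  have hs1 : Real.sin D < 1 := by nlinarith
  have hsc : 1 ≤ Real.sin D + Real.cos D := by nlinarith
  set A := sig.real (fcone F ∩ unitSphere 2)
  set A' := sig.real (polar (F : Set (E 2)))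
  set S := Sm hF
  set V := Vm F
  nlinarith [mul_nonneg (sub_nonneg.2 hsc) (sub_nonneg.2 h3), mul_nonneg (sub_nonneg.2 hs1.le) (sub_nonneg.2 h1)]


lemma fcone_mono {F G : Finset (E 2)} (h : F ⊆ G) : fcone F ⊆ fcone G := by
  classical
  rintro z ⟨a, ha, rfl⟩
  refine ⟨fun x => if x ∈ F then a x else 0, fun x => ?_, ?_⟩
  · by_cases hx : x ∈ F <;> simp [hx, ha x]
  · rw [← Finset.sum_subset h]
    · exact Finset.sum_congr rfl fun x hx => by simp [hx]
    · intro x _ hx; simp [hx]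

lemma Good.ineq {D : ℝ} (hD0 : 0 < D) (hD : D < π / 2) {M L : Set (E 2)} (h : Good D M L) :
    sig.real M * Real.sin D + 2 * π * (1 - Real.sin D) + (2 * π - sig.real L) * Real.cos D ≤ sig.real L := by
  classical
  have hc : 0 < Real.cos D := Real.cos_pos_of_mem_Ioo ⟨by linarith, hD⟩
  have hsn : 0 < Real.sin D := Real.sin_pos_of_pos_of_lt_pi hD0 (by linarith)
  obtain ⟨g, hg⟩ := h.ne
  haveI : Nonempty M := ⟨⟨g, hg⟩⟩
  set d : ℕ → E 2 := fun i => (TopologicalSpace.denseSeq M i : E 2) with hd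
  have hdM : ∀ i, d i ∈ M := fun i => (TopologicalSpace.denseSeq M i).2
  have hdense : M ⊆ closure (range d) := by
    intro m hm
    have h1 := TopologicalSpace.denseRange_denseSeq M ⟨m, hm⟩
    have h2 := mem_closure_image (f := ((↑) : M → E 2)) continuous_subtype_val.continuousAt h1
    rw [← range_comp] at h2
    exact h2
  set F : ℕ → Finset (E 2) := fun n => (Finset.range (n + 1)).image d with hF
  have hFM : ∀ n, (F n : Set (E 2)) ⊆ M := by
    intro n x hx
    simp only [hF, Finset.coe_image, mem_image] at hx
    obtain ⟨i, _, rfl⟩ := hx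
    exact hdM i
  have hFmono : ∀ n m, n ≤ m → F n ⊆ F m := by
    intro n m hnm
    exact Finset.image_subset_image (Finset.range_mono (by omega))
  have hFS : ∀ n, FinS (F n) g := by
    intro n
    refine ⟨⟨d 0, Finset.mem_image.2 ⟨0, by simp, rfl⟩⟩, fun x hx => mem_us.1 (h.MS (hFM n hx)), fun x hx => ?_⟩
    exact hc.trans_le (h.diam _ hg _ (hFM n hx))
  have hineq := fun n => (hFS n).main_ineq hD0 hD h (hFM n)
  have hdF : ∀ i, d i ∈ F i := fun i => Finset.mem_image.2 ⟨i, by simp, rfl⟩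
  -- limits
  have lim1 : Filter.Tendsto (fun n => sig.real (polar (F n : Set (E 2)))) Filter.atTop (nhds (sig.real L)) := by
    have hL : L = ⋂ n, polar (F n : Set (E 2)) := by
      rw [h.LM]
      ext z
      simp only [mem_iInter]
      constructor
      · rintro ⟨hz, hz'⟩ n
        exact ⟨hz, fun x hx => hz' x (hFM n hx)⟩
      · intro hz
        refine ⟨(hz 0).1, fun m hm => ?_⟩
        have hcl : IsClosed {y : E 2 | ⟪y, z⟫ ≤ 0} := isClosed_le (by fun_prop) continuous_const
        have hs : range d ⊆ {y : E 2 | ⟪y, z⟫ ≤ 0} := by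
          rintro _ ⟨i, rfl⟩
          exact (hz i).2 _ (hdF i)
        exact closure_minimal hs hcl (hdense hm)
    have := tendsto_measure_iInter_atTop (μ := sig) (s := fun n => polar (F n : Set (E 2)))
      (fun n => (isClosed_polar _).measurableSet.nullMeasurableSet)
      (fun n m hnm z hz => ⟨hz.1, fun x hx => hz.2 x (hFmono n m hnm hx)⟩) ⟨0, measure_ne_top _ _⟩
    rw [← hL] at this
    exact (ENNReal.tendsto_toReal (measure_ne_top _ _)).comp this
  have lim2 : Filter.Tendsto (fun n => sig.real (fcone (F n) ∩ unitSphere 2)) Filter.atTop (nhds (sig.real (⋃ n, fcone (F n) ∩ unitSphere 2))) := by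
    have := tendsto_measure_iUnion_atTop (μ := sig) (s := fun n => fcone (F n) ∩ unitSphere 2)
      (fun n m hnm => inter_subset_inter_left _ (fcone_mono (hFmono n m hnm)))
    exact (ENNReal.tendsto_toReal (measure_ne_top _ _)).comp this
  have hMle : sig.real M ≤ sig.real (⋃ n, fcone (F n) ∩ unitSphere 2) := by
    rw [← iUnion_inter, sig_inter_us]
    set C := ⋃ n, fcone (F n) with hC
    have hCm : MeasurableSet C := MeasurableSet.iUnion fun n => (hFS n).ccone.closed.measurableSet
    have hMm : MeasurableSet M := by rw [h.ML]; exact (isClosed_polar _).measurableSet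
    have hCs : ∀ a : ℝ, 0 ≤ a → ∀ x ∈ C, a • x ∈ C := by
      intro a ha x hx
      simp only [hC, mem_iUnion] at hx ⊢
      obtain ⟨n, hn⟩ := hx
      exact ⟨n, fcone_smul ha hn⟩
    have hCadd : ∀ x ∈ C, ∀ y ∈ C, x + y ∈ C := by
      intro x hx y hy
      simp only [hC, mem_iUnion] at hx hy ⊢
      obtain ⟨n, hn⟩ := hx
      obtain ⟨m, hm⟩ := hy
      exact ⟨max n m, fcone_add (fcone_mono (hFmono _ _ (le_max_left _ _)) hn) (fcone_mono (hFmono _ _ (le_max_right _ _)) hm)⟩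
    have hCc : Convex ℝ C := by
      intro x hx y hy a b ha hb _
      exact hCadd _ (hCs a ha x hx) _ (hCs b hb y hy)
    have hMC : M ⊆ closure C := by
      refine hdense.trans (closure_mono ?_)
      rintro _ ⟨i, rfl⟩
      exact mem_iUnion.2 ⟨i, fcone_mem (hdF i)⟩
    have hcls : ∀ a : ℝ, 0 ≤ a → ∀ x ∈ closure C, a • x ∈ closure C := by
      intro a ha x hx
      exact map_mem_closure (continuous_const_smul a) hx (fun y hy => hCs a ha y hy)
    have hle : sig M ≤ sig C := by
      rw [sig_apply hMm, sig_apply hCm]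
      gcongr 3 * ?_
      have hsub : nrm ⁻¹' M ∩ Metric.ball 0 1 ⊆ (nrm ⁻¹' C ∩ Metric.ball 0 1) ∪ frontier C := by
        rintro x ⟨hx, hxb⟩
        have h1 : x ∈ closure C := by
          rw [← norm_smul_nrm x]
          exact hcls _ (norm_nonneg _) _ (hMC hx)
        by_cases h2 : x ∈ interior C
        · left
          refine ⟨?_, hxb⟩
          exact hCs _ (by positivity) _ (interior_subset h2)
        · right; exact ⟨h1, h2⟩
      refine (measure_mono hsub).trans ((measure_union_le _ _).trans ?_)
      rw [hCc.addHaar_frontier volume, add_zero]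
    exact ENNReal.toReal_mono (measure_ne_top _ _) hle
  have lim := ((lim2.mul_const (Real.sin D)).add_const (2 * π * (1 - Real.sin D))).add
    (((tendsto_const_nhds (x := 2 * π)).sub lim1).mul_const (Real.cos D))
  have := le_of_tendsto' lim hineq
  nlinarith


lemma sector_iff {θ α : ℝ} (h0 : 0 < θ) (h1 : θ < 2 * π) (ha0 : 0 < α) (ha : α < π) :
    (0 < Real.sin θ ∧ 0 < Real.sin α * Real.cos θ - Real.cos α * Real.sin θ) ↔ θ < α := by
  rw [← Real.sin_sub]
  constructor
  · rintro ⟨h2, h3⟩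
    by_contra hcon
    push Not at hcon
    rcases le_or_gt θ π with h | h
    · have := Real.sin_nonpos_of_nonpos_of_neg_pi_le (x := α - θ) (by linarith) (by linarith)
      linarith
    · have : Real.sin (θ - 2 * π) ≤ 0 := Real.sin_nonpos_of_nonpos_of_neg_pi_le (by linarith) (by linarith)
      rw [Real.sin_sub_two_pi] at this
      linarith
  · intro h
    exact ⟨Real.sin_pos_of_pos_of_lt_pi h0 (by linarith), Real.sin_pos_of_pos_of_lt_pi (by linarith) (by linarith)⟩

/-- spherical sector -/
def sect (e f c : E 2) (α i j : ℝ) : Set (E 2) :=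
  {z | 0 < ⟪z, f⟫ ∧ 0 < Real.sin α * ⟪z, e⟫ - Real.cos α * ⟪z, f⟫ ∧ ⟪z, c⟫ ∈ Icc i j}

lemma meas_sect (e f c : E 2) (α i j : ℝ) : MeasurableSet (sect e f c α i j) := by
  unfold sect
  have h1 : Measurable (fun z : E 2 => ⟪z, f⟫) := by fun_prop
  have h2 : Measurable (fun z : E 2 => Real.sin α * ⟪z, e⟫ - Real.cos α * ⟪z, f⟫) := by fun_prop
  have h3 : Measurable (fun z : E 2 => ⟪z, c⟫) := by fun_prop
  exact (h1 measurableSet_Ioi).inter ((h2 measurableSet_Ioi).inter (h3 measurableSet_Icc))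

lemma sig_sect {e f c : E 2} (h : Frame e f c) {α i j : ℝ} (ha0 : 0 < α) (ha : α < π) (hij : i ≤ j) (hi : -1 ≤ i) (hj : j ≤ 1) :
    sig.real (sect e f c α i j) = α * (j - i) := by
  have key : ∀ p ∈ rect, (0 < ⟪Psi e f c p, f⟫ ∧ 0 < Real.sin α * ⟪Psi e f c p, e⟫ - Real.cos α * ⟪Psi e f c p, f⟫) ↔ p.1 < α := by
    intro p hp
    have hs := rect_sqrt_pos hp
    rw [Psi_inner_e h, Psi_inner_f h, ← sector_iff hp.1.1 hp.1.2 ha0 ha, mul_pos_iff_of_pos_left hs]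
    rw [show Real.sin α * (√(1 - p.2 ^ 2) * Real.cos p.1) - Real.cos α * (√(1 - p.2 ^ 2) * Real.sin p.1) =
      √(1 - p.2 ^ 2) * (Real.sin α * Real.cos p.1 - Real.cos α * Real.sin p.1) by ring, mul_pos_iff_of_pos_left hs]
  apply le_antisymm
  · have := sig_le_sector h (meas_sect e f c α i j) ha0.le hij ?_
    · rwa [sub_zero] at this
    · rintro p hp ⟨h1, h2, h3⟩
      rw [Psi_inner_c h] at h3
      exact ⟨⟨hp.1.1.le, ((key p hp).1 ⟨h1, h2⟩).le⟩, h3⟩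
  · have := sig_ge_sector h (meas_sect e f c α i j) ha0.le hij le_rfl (by linarith) hi hj ?_
    · rwa [sub_zero] at this
    · intro p hp h1 h2
      have := (key p hp).2 h1.2
      refine ⟨this.1, this.2, ?_⟩
      rw [Psi_inner_c h]
      exact ⟨h2.1.le, h2.2.le⟩

lemma sig_lune {n₁ n₂ : E 2} (h₁ : ‖n₁‖ = 1) (h₂ : ‖n₂‖ = 1) {α : ℝ} (ha0 : 0 < α) (ha : α < π) (h : ⟪n₁, n₂⟫ = -Real.cos α) :
    sig.real {z | 0 < ⟪z, n₁⟫ ∧ 0 < ⟪z, n₂⟫} = 2 * α := by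
  have hs : 0 < Real.sin α := Real.sin_pos_of_pos_of_lt_pi ha0 ha
  have hsc := Real.sin_sq_add_cos_sq α
  have h11 := inner_self_us h₁
  have h22 := inner_self_us h₂
  set e := (Real.sin α)⁻¹ • (n₂ + Real.cos α • n₁) with he
  have h1e : ⟪e, n₁⟫ = 0 := by
    rw [he, inner_smul_left, inner_add_left, inner_smul_left, h11, real_inner_comm, h]; simp
  have hee : ⟪e, e⟫ = 1 := by
    conv_lhs => rw [he]
    rw [inner_smul_left, inner_smul_right, inner_add_left, inner_add_right, inner_add_right, inner_smul_left, inner_smul_right, inner_smul_left,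
      inner_smul_right, h11, h22, h, real_inner_comm, h]
    simp only [RCLike.conj_to_real]
    field_simp
    linarith
  have hen : ‖e‖ = 1 := by
    rw [real_inner_self_eq_norm_sq] at hee
    nlinarith [norm_nonneg e]
  obtain ⟨c, hF⟩ := exists_frame' h₁ hen h1e
  have hF' : Frame e n₁ c := ⟨hee, h11, hF.ff, h1e, hF.ef, by rw [real_inner_comm]; exact hF.fc⟩
  have hn2 : n₂ = Real.sin α • e - Real.cos α • n₁ := by
    rw [he, smul_smul, mul_inv_cancel₀ hs.ne', one_smul]; abel
  clear_value e
  have hz2 : ∀ z : E 2, ⟪z, n₂⟫ = Real.sin α * ⟪z, e⟫ - Real.cos α * ⟪z, n₁⟫ := by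
    intro z
    conv_lhs => rw [hn2]
    rw [inner_sub_right, real_inner_smul_right, real_inner_smul_right]
  have := sig_sect hF' ha0 ha (i := -1) (j := 1) (by norm_num) le_rfl le_rfl
  rw [show α * (1 - -1) = 2 * α by ring] at this
  rw [← this, ← sig_inter_us, ← sig_inter_us (sect _ _ _ _ _ _)]
  congr 1
  ext z
  simp only [sect, mem_inter_iff, mem_setOf_eq]
  constructor
  · rintro ⟨⟨a, b⟩, hz⟩
    refine ⟨⟨a, ?_, ?_⟩, hz⟩
    · rw [hz2] at b; exact b
    · have hcn : ‖c‖ = 1 := by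
        have := hF.ff; rw [real_inner_self_eq_norm_sq] at this; nlinarith [norm_nonneg c]
      exact ⟨neg_one_le_inner' (mem_us.1 hz) hcn, inner_le_one' (mem_us.1 hz) hcn⟩
  · rintro ⟨⟨a, b, _⟩, hz⟩
    refine ⟨⟨a, ?_⟩, hz⟩
    rw [hz2]; exact b

/-- open triangle given by normals -/
def tri (n₁ n₂ n₃ : E 2) : Set (E 2) := {z | 0 < ⟪z, n₁⟫ ∧ 0 < ⟪z, n₂⟫ ∧ 0 < ⟪z, n₃⟫}

lemma meas_pos (n : E 2) : MeasurableSet {z : E 2 | 0 < ⟪z, n⟫} :=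
  (by fun_prop : Measurable fun z : E 2 => ⟪z, n⟫) measurableSet_Ioi

lemma meas_tri (n₁ n₂ n₃ : E 2) : MeasurableSet (tri n₁ n₂ n₃) :=
  (meas_pos n₁).inter ((meas_pos n₂).inter (meas_pos n₃))

lemma sig_half {n : E 2} (hn : ‖n‖ = 1) : sig.real {z | 0 < ⟪z, n⟫} = 2 * π := by
  have h1 := sig_zone hn (i := 0) (j := 1) zero_le_one (by norm_num) le_rfl
  have h2 := sig_zone hn (i := 0) (j := 0) le_rfl (by norm_num) (by norm_num)
  apply le_antisymm
  · rw [← sig_inter_us]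
    have : {z : E 2 | 0 < ⟪z, n⟫} ∩ unitSphere 2 ⊆ {z | ⟪z, n⟫ ∈ Icc (0:ℝ) 1} := by
      rintro z ⟨hz, hz'⟩
      exact ⟨(le_of_lt hz), inner_le_one' (mem_us.1 hz') hn⟩
    have := measureReal_mono (μ := sig) this
    linarith
  · have : {z | ⟪z, n⟫ ∈ Icc (0:ℝ) 1} ⊆ {z : E 2 | 0 < ⟪z, n⟫} ∪ {z | ⟪z, n⟫ ∈ Icc (0:ℝ) 0} := by
      rintro z hz
      rcases hz.1.eq_or_lt with h | h
      · right; show ⟪z, n⟫ ∈ Icc (0:ℝ) 0; rw [← h]; simp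
      · left; exact h
    have := (measureReal_mono (μ := sig) this).trans (measureReal_union_le _ _)
    linarith

lemma sig_neg {X : Set (E 2)} (hX : MeasurableSet X) : sig.real {z | -z ∈ X} = sig.real X := by
  have := sig_map_isometry (LinearIsometryEquiv.neg ℝ : E 2 ≃ₗᵢ[ℝ] E 2) hX
  unfold Measure.real
  rw [← this]; rfl

lemma girard {n₁ n₂ n₃ : E 2} (h₁ : ‖n₁‖ = 1) (h₂ : ‖n₂‖ = 1) (h₃ : ‖n₃‖ = 1) {a₁ a₂ a₃ : ℝ}
    (ha₁ : a₁ ∈ Ioo 0 π) (ha₂ : a₂ ∈ Ioo 0 π) (ha₃ : a₃ ∈ Ioo 0 π)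
    (h12 : ⟪n₁, n₂⟫ = -Real.cos a₃) (h13 : ⟪n₁, n₃⟫ = -Real.cos a₂) (h23 : ⟪n₂, n₃⟫ = -Real.cos a₁) :
    sig.real (tri n₁ n₂ n₃) = a₁ + a₂ + a₃ - π := by
  set A := {z : E 2 | 0 < ⟪z, n₁⟫} with hA
  set B := {z : E 2 | 0 < ⟪z, n₂⟫} with hB
  set C := {z : E 2 | 0 < ⟪z, n₃⟫} with hC
  have mA : MeasurableSet A := meas_pos n₁
  have mB : MeasurableSet B := meas_pos n₂
  have mC : MeasurableSet C := meas_pos n₃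
  have l12 : sig.real (A ∩ B) = 2 * a₃ := sig_lune h₁ h₂ ha₃.1 ha₃.2 h12
  have l13 : sig.real (A ∩ C) = 2 * a₂ := sig_lune h₁ h₃ ha₂.1 ha₂.2 h13
  have l23 : sig.real (B ∩ C) = 2 * a₁ := sig_lune h₂ h₃ ha₁.1 ha₁.2 h23
  have sA : sig.real A = 2 * π := sig_half h₁
  have sB : sig.real B = 2 * π := sig_half h₂
  have sC : sig.real C = 2 * π := sig_half h₃
  have hT : sig.real (tri n₁ n₂ n₃) = sig.real ((A ∩ B) ∩ C) := by
    congr 1; ext z; simp [tri, hA, hB, hC, and_assoc]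
  have e1 := measureReal_union_add_inter (μ := sig) (s := A) mB
  have e2 := measureReal_union_add_inter (μ := sig) (s := A ∪ B) mC
  have e3 : (A ∪ B) ∩ C = (A ∩ C) ∪ (B ∩ C) := union_inter_distrib_right _ _ _
  have e4 := measureReal_union_add_inter (μ := sig) (s := A ∩ C) (mB.inter mC)
  have e5 : (A ∩ C) ∩ (B ∩ C) = (A ∩ B) ∩ C := by ext z; simp; tauto
  rw [e3] at e2
  rw [e5] at e4
  have e6 := measureReal_add_measureReal_compl (μ := sig) ((mA.union mB).union mC)
  rw [sig_real_univ] at e6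
  have e7 : sig.real ((A ∪ B ∪ C)ᶜ) = sig.real ((A ∩ B) ∩ C) := by
    rw [← hT, ← sig_neg (meas_tri n₁ n₂ n₃)]
    apply le_antisymm
    · have hN0 : ∀ n : E 2, ‖n‖ = 1 → sig.real {z | ⟪z, n⟫ ∈ Icc (0:ℝ) 0} = 0 := by
        intro n hn
        rw [sig_zone hn le_rfl (by norm_num) (by norm_num)]; simp
      have : (A ∪ B ∪ C)ᶜ ⊆ {z | -z ∈ tri n₁ n₂ n₃} ∪ ({z | ⟪z, n₁⟫ ∈ Icc (0:ℝ) 0} ∪ ({z | ⟪z, n₂⟫ ∈ Icc (0:ℝ) 0} ∪ {z | ⟪z, n₃⟫ ∈ Icc (0:ℝ) 0})) := by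
        intro z hz
        simp only [hA, hB, hC, mem_compl_iff, mem_union, mem_setOf_eq, not_or, not_lt] at hz
        simp only [mem_union, mem_setOf_eq, tri, inner_neg_left, mem_Icc]
        rcases hz.1.1.eq_or_lt with h | h
        · right; left; rw [h]; simp
        rcases hz.1.2.eq_or_lt with h' | h'
        · right; right; left; rw [h']; simp
        rcases hz.2.eq_or_lt with h'' | h''
        · right; right; right; rw [h'']; simp
        left; exact ⟨by linarith, by linarith, by linarith⟩
      have u1 := (measureReal_mono (μ := sig) this).trans (measureReal_union_le _ _)
      have u2 := measureReal_union_le (μ := sig) {z | ⟪z, n₁⟫ ∈ Icc (0:ℝ) 0} ({z | ⟪z, n₂⟫ ∈ Icc (0:ℝ) 0} ∪ {z | ⟪z, n₃⟫ ∈ Icc (0:ℝ) 0})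
      have u3 := measureReal_union_le (μ := sig) {z | ⟪z, n₂⟫ ∈ Icc (0:ℝ) 0} {z | ⟪z, n₃⟫ ∈ Icc (0:ℝ) 0}
      have := hN0 n₁ h₁
      have := hN0 n₂ h₂
      have := hN0 n₃ h₃
      linarith
    · refine measureReal_mono ?_ (measure_ne_top _ _)
      intro z hz
      simp only [tri, mem_setOf_eq, inner_neg_left] at hz
      simp only [hA, hB, hC, mem_compl_iff, mem_union, mem_setOf_eq, not_or, not_lt]
      exact ⟨⟨by linarith, by linarith⟩, by linarith⟩
  rw [hT]
  linarith


lemma good_compact {M L : Set (E 2)} {D : ℝ} (h : Good D M L) : IsCompact M := by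
  rw [h.ML]; exact isCompact_polar _

/-- circumscribed cap data -/
structure Circ (D : ℝ) (M : Set (E 2)) (c : E 2) (R : ℝ) : Prop where
  hc : ‖c‖ = 1
  R0 : 0 ≤ R
  RD : R < D
  cap : ∀ m ∈ M, Real.cos R ≤ ⟪c, m⟫
  con : ∀ b : E 2, ⟪c, b⟫ = 0 → ∃ m ∈ M, ⟪c, m⟫ = Real.cos R ∧ ⟪m, b⟫ ≤ 0

lemma exists_circ {M L : Set (E 2)} {D : ℝ} (hD0 : 0 < D) (hD : D < π / 2) (h : Good D M L) :
    ∃ c R, Circ D M c R := by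
  have hcD : 0 < Real.cos D := Real.cos_pos_of_mem_Ioo ⟨by linarith, hD⟩
  have hcD1 : Real.cos D < 1 := by
    have := Real.cos_lt_cos_of_nonneg_of_le_pi_div_two le_rfl hD.le hD0
    simpa using this
  have hconv : Convex ℝ (closure (convexHull ℝ M)) := (convex_convexHull ℝ M).closure
  have hne : (closure (convexHull ℝ M)).Nonempty := h.ne.convexHull.closure
  obtain ⟨y, hy, hmin⟩ := exists_norm_eq_iInf_of_complete_convex hne isClosed_closure.isComplete hconv 0
  have cmin : ∀ {T : Set (E 2)}, M ⊆ T → Convex ℝ T → IsClosed T → closure (convexHull ℝ M) ⊆ T :=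
    fun h1 h2 h3 => closure_minimal (convexHull_min h1 h2) h3
  have lcl : ∀ (a : E 2) (t : ℝ), IsClosed {z : E 2 | t ≤ ⟪a, z⟫} := fun a t =>
    isClosed_le continuous_const (by fun_prop)
  rw [norm_eq_iInf_iff_real_inner_le_zero hconv hy] at hmin
  have hmin' : ∀ m ∈ M, ⟪y, y⟫ ≤ ⟪y, m⟫ := by
    intro m hm
    have := hmin m (subset_closure (subset_convexHull ℝ M hm))
    rw [zero_sub, inner_neg_left, inner_sub_right] at this
    linarith
  have lin : ∀ (a : E 2) (t : ℝ), Convex ℝ {z : E 2 | t ≤ ⟪a, z⟫} := by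
    intro a t u hu v hv p q hp hq hpq
    simp only [mem_setOf_eq] at *
    rw [inner_add_right, real_inner_smul_right, real_inner_smul_right]
    calc t = p * t + q * t := by rw [← add_mul, hpq, one_mul]
      _ ≤ _ := by gcongr
  have h1 : ∀ m ∈ M, Real.cos D ≤ ⟪m, y⟫ := fun m hm =>
    cmin (fun v hv => h.diam m hm v hv) (lin m _) (lcl m _) hy
  have h2 : Real.cos D ≤ ⟪y, y⟫ :=
    cmin (fun v hv => by
      show _ ≤ ⟪y, v⟫
      rw [real_inner_comm]; exact h1 v hv) (lin y _) (lcl y _) hy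
  have hyn : 0 < ‖y‖ := by
    rw [norm_pos_iff]; rintro rfl; rw [inner_zero_left] at h2; linarith
  have hyy : ⟪y, y⟫ = ‖y‖ ^ 2 := real_inner_self_eq_norm_sq y
  have hy1 : ‖y‖ ≤ 1 := by
    have : closure (convexHull ℝ M) ⊆ Metric.closedBall 0 1 :=
      cmin (fun v hv => by
        have := mem_us.1 (h.MS hv)
        simp [this]) (convex_closedBall _ _) Metric.isClosed_closedBall
    simpa using this hy
  have hcos : Real.cos (Real.arccos ‖y‖) = ‖y‖ := Real.cos_arccos (by linarith) hy1
  have hcy : ∀ m, ⟪nrm y, m⟫ = ‖y‖⁻¹ * ⟪y, m⟫ := by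
    intro m; unfold nrm; rw [real_inner_smul_left]
  refine ⟨nrm y, Real.arccos ‖y‖, norm_nrm (norm_pos_iff.1 hyn), Real.arccos_nonneg _, ?_, ?_, ?_⟩
  · rw [← Real.arccos_cos hD0.le (by linarith)]
    apply Real.arccos_lt_arccos (by linarith) _ hy1
    nlinarith
  · intro m hm
    rw [hcos, hcy, le_inv_mul_iff₀ hyn]
    have := hmin' m hm
    nlinarith
  · intro b hb
    by_contra hcon
    push Not at hcon
    have hMc := good_compact h
    have hcap : ∀ m ∈ M, ‖y‖ ≤ ⟪nrm y, m⟫ := by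
      intro m hm
      rw [hcy, le_inv_mul_iff₀ hyn]
      have := hmin' m hm
      nlinarith
    rw [hcos] at hcon
    have hex : ∃ t : ℝ, t > 0 ∧ ∀ m ∈ M, ‖y‖ < ⟪nrm y + t • b, m⟫ := by
      have hN : IsCompact (M ∩ {m | ⟪m, b⟫ ≤ 0}) := hMc.inter_right (isClosed_le (by fun_prop) continuous_const)
      rcases (M ∩ {m | ⟪m, b⟫ ≤ 0}).eq_empty_or_nonempty with h0 | h0
      · refine ⟨1, one_pos, fun m hm => ?_⟩
        have : 0 < ⟪m, b⟫ := by
          by_contra hh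
          push Not at hh
          have : m ∈ M ∩ {m | ⟪m, b⟫ ≤ 0} := ⟨hm, hh⟩
          rw [h0] at this; exact this
        rw [inner_add_left, real_inner_smul_left, one_mul]
        linarith [hcap m hm, real_inner_comm b m]
      · obtain ⟨m₀, ⟨hm₀, hm₀b⟩, hmn⟩ := hN.exists_isMinOn h0 (f := fun m => ⟪nrm y, m⟫) (by fun_prop)
        rw [isMinOn_iff] at hmn
        simp only [mem_setOf_eq] at hm₀b
        have hη : ‖y‖ < ⟪nrm y, m₀⟫ := by
          apply lt_of_le_of_ne (hcap _ hm₀)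
          intro hh
          have := hcon m₀ hm₀ hh.symm
          linarith
        set η := ⟪nrm y, m₀⟫ - ‖y‖ with hηd
        have hη0 : 0 < η := by linarith
        have ht : 0 < η / (‖b‖ + 1) := by positivity
        refine ⟨η / (‖b‖ + 1), ht, fun m hm => ?_⟩
        rw [inner_add_left, real_inner_smul_left]
        rcases le_or_gt ⟪m, b⟫ 0 with hmb | hmb
        · have h1 := hmn m ⟨hm, hmb⟩
          have h2 : -‖b‖ ≤ ⟪b, m⟫ := by
            have := abs_real_inner_le_norm b m
            rw [mem_us.1 (h.MS hm), mul_one, abs_le] at this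
            exact this.1
          have h3 : η / (‖b‖ + 1) * (-‖b‖) ≤ η / (‖b‖ + 1) * ⟪b, m⟫ := mul_le_mul_of_nonneg_left h2 ht.le
          have h4 : η / (‖b‖ + 1) * (‖b‖ + 1) = η := by field_simp
          nlinarith
        · have h5 : 0 < η / (‖b‖ + 1) * ⟪b, m⟫ := mul_pos ht (by rw [real_inner_comm]; exact hmb)
          linarith [hcap m hm]
    obtain ⟨t, ht, htm⟩ := hex
    obtain ⟨m₁, hm₁, hmn⟩ := hMc.exists_isMinOn h.ne (f := fun m => ⟪nrm y + t • b, m⟫) (by fun_prop)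
    rw [isMinOn_iff] at hmn
    have h1 := cmin (T := {z | ⟪nrm y + t • b, m₁⟫ ≤ ⟪nrm y + t • b, z⟫}) hmn (lin _ _) (lcl _ _) hy
    simp only [mem_setOf_eq] at h1
    have h2 := htm m₁ hm₁
    have hyb : ⟪y, b⟫ = 0 := by
      rw [hcy] at hb
      exact (mul_eq_zero.1 hb).resolve_left (inv_ne_zero hyn.ne')
    have h3 : ⟪nrm y + t • b, y⟫ = ‖y‖ := by
      rw [inner_add_left, real_inner_smul_left, real_inner_comm y b, hyb, hcy, hyy]
      field_simp; ring
    linarith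

lemma gdist_tri {x y z : E 2} (hx : ‖x‖ = 1) (hy : ‖y‖ = 1) (hz : ‖z‖ = 1) : gdist x z ≤ gdist x y + gdist y z := by
  rw [gdist_eq_angle hx hz, gdist_eq_angle hx hy, gdist_eq_angle hy hz]
  exact InnerProductGeometry.angle_le_angle_add_angle _ _ _

lemma Circ.ball {M L : Set (E 2)} {D R t : ℝ} {c : E 2} (hD : D < π / 2) (h : Good D M L) (C : Circ D M c R)
    (ht0 : 0 ≤ t) (ht : t + R ≤ D) : gball c t ⊆ M := by
  have hR := C.R0
  intro x hx
  have hx1 := mem_us.1 hx.1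
  refine h.complete x hx.1 fun m hm => ?_
  have hm1 := mem_us.1 (h.MS hm)
  rw [← gdist_le_iff hx1 hm1 (by linarith) (by linarith [Real.pi_pos])]
  have h1 : gdist c m ≤ R := (gdist_le_iff C.hc hm1 hR (by linarith [Real.pi_pos])).2 (C.cap m hm)
  have h2 := gdist_tri hx1 C.hc hm1
  have h3 : gdist x c = gdist c x := by unfold gdist; rw [real_inner_comm]
  have := hx.2
  linarith

/-- contact directions -/
def dirs (M : Set (E 2)) (c : E 2) (R : ℝ) : Set (E 2) :=
  {e | ‖e‖ = 1 ∧ ⟪e, c⟫ = 0 ∧ Real.cos R • c + Real.sin R • e ∈ M}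

lemma dirs_closed {M L : Set (E 2)} {D R : ℝ} {c : E 2} (h : Good D M L) : IsClosed (dirs M c R) := by
  have hM := (good_compact h).isClosed
  refine IsClosed.inter (isClosed_eq (by fun_prop) continuous_const) (IsClosed.inter (isClosed_eq (by fun_prop) continuous_const) ?_)
  exact hM.preimage (by fun_prop : Continuous fun e : E 2 => Real.cos R • c + Real.sin R • e)

lemma dirs_compact {M L : Set (E 2)} {D R : ℝ} {c : E 2} (h : Good D M L) : IsCompact (dirs M c R) :=
  (isCompact_sphere (0 : E 2) 1).of_isClosed_subset (dirs_closed h) (fun e he => by simp [he.1])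

lemma dirs_con {M L : Set (E 2)} {D R : ℝ} {c : E 2} (hD : D < π / 2) (h : Good D M L) (C : Circ D M c R) (hR : 0 < R) (b : E 2)
    (hb : ⟪c, b⟫ = 0) : ∃ e ∈ dirs M c R, ⟪e, b⟫ ≤ 0 := by
  obtain ⟨m, hm, h1, h2⟩ := C.con b hb
  have hs : 0 < Real.sin R := Real.sin_pos_of_pos_of_lt_pi hR (by linarith [C.RD, Real.pi_pos])
  have hm1 := inner_self_us (mem_us.1 (h.MS hm))
  have hc1 := inner_self_us C.hc
  have hsc := Real.sin_sq_add_cos_sq R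
  have hmc : ⟪m, c⟫ = Real.cos R := by rw [real_inner_comm, h1]
  refine ⟨(Real.sin R)⁻¹ • (m - Real.cos R • c), ⟨?_, ?_, ?_⟩, ?_⟩
  · have : ⟪m - Real.cos R • c, m - Real.cos R • c⟫ = Real.sin R ^ 2 := by
      simp only [inner_sub_left, inner_sub_right, real_inner_smul_left, real_inner_smul_right, hm1, hc1, h1, hmc]
      linarith
    rw [real_inner_self_eq_norm_sq] at this
    have : ‖m - Real.cos R • c‖ = Real.sin R := by
      rw [sq_eq_sq₀ (norm_nonneg _) hs.le] at this; exact this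
    rw [norm_smul, this, norm_inv, Real.norm_eq_abs, abs_of_pos hs, inv_mul_cancel₀ hs.ne']
  · simp only [inner_sub_left, real_inner_smul_left, hc1, hmc]; ring
  · rw [smul_smul, mul_inv_cancel₀ hs.ne', one_smul]; simpa using hm
  · simp only [inner_sub_left, real_inner_smul_left, hb]
    rw [mul_zero, sub_zero]
    exact mul_nonpos_of_nonneg_of_nonpos (inv_pos.2 hs).le h2

lemma dirs_pair {M L : Set (E 2)} {D R φ : ℝ} {c : E 2} (h : Good D M L) (hc : ‖c‖ = 1) (hs : 0 < Real.sin R)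
    (hφ : Real.cos φ * Real.sin R ^ 2 = Real.cos R ^ 2 - Real.cos D) {e e' : E 2} (he : e ∈ dirs M c R) (he' : e' ∈ dirs M c R) :
    - Real.cos φ ≤ ⟪e, e'⟫ := by
  have := h.diam _ he.2.2 _ he'.2.2
  have hc1 := inner_self_us hc
  have h1 := he.2.1
  have h2 : ⟪c, e'⟫ = 0 := by rw [real_inner_comm]; exact he'.2.1
  simp only [inner_add_left, inner_add_right, real_inner_smul_left, real_inner_smul_right, hc1, h1, h2] at this
  have h3 : 0 ≤ (⟪e, e'⟫ + Real.cos φ) * Real.sin R ^ 2 := by nlinarith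
  have := nonneg_of_mul_nonneg_left h3 (by positivity)
  linarith

lemma planar {e f c x : E 2} (hF : Frame e f c) (hx : ‖x‖ = 1) (hxc : ⟪x, c⟫ = 0) :
    (0 ≤ ⟪x, f⟫ → x = Real.cos (Real.arccos ⟪x, e⟫) • e + Real.sin (Real.arccos ⟪x, e⟫) • f) ∧
    (⟪x, f⟫ ≤ 0 → x = Real.cos (Real.arccos ⟪x, e⟫) • e - Real.sin (Real.arccos ⟪x, e⟫) • f) := by
  have he : ‖e‖ = 1 := by
    have := hF.ee; rw [real_inner_self_eq_norm_sq] at this; nlinarith [norm_nonneg e]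
  have h1 := hF.inner_eq x x
  rw [inner_self_us hx, hxc] at h1
  have hd := hF.decomp x
  rw [hxc, zero_smul, add_zero] at hd
  rw [Real.cos_arccos (neg_one_le_inner' hx he) (inner_le_one' hx he), Real.sin_arccos]
  have h2 : 1 - ⟪x, e⟫ ^ 2 = ⟪x, f⟫ ^ 2 := by nlinarith
  rw [h2, Real.sqrt_sq_eq_abs]
  constructor
  · intro hf; rw [abs_of_nonneg hf]; exact hd
  · intro hf; rw [abs_of_nonpos hf, neg_smul, sub_neg_eq_add]; exact hd

lemma triple {M L : Set (E 2)} {D R φ : ℝ} {c : E 2} (hD : D < π / 2) (h : Good D M L) (C : Circ D M c R) (hR : 0 < R)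
    (hφ0 : 0 < φ) (hφπ : φ < π)
    (hφ : Real.cos φ * Real.sin R ^ 2 = Real.cos R ^ 2 - Real.cos D) :
    φ ≤ π / 3 ∧ ∃ e₁ ∈ dirs M c R, ∃ e₂ ∈ dirs M c R, ∃ e₃ ∈ dirs M c R,
      2 * φ ≤ gdist e₁ e₂ ∧ 2 * φ ≤ gdist e₁ e₃ ∧ 2 * φ ≤ gdist e₂ e₃ := by
  have hs : 0 < Real.sin R := Real.sin_pos_of_pos_of_lt_pi hR (by linarith [C.RD, Real.pi_pos])
  obtain ⟨e, he, -⟩ := dirs_con hD h C hR 0 (by simp)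
  obtain ⟨f, hF⟩ := exists_frame' C.hc he.1 he.2.1
  have hcf : ⟪c, f⟫ = 0 := by rw [real_inner_comm]; exact hF.fc
  have hce : ⟪c, e⟫ = 0 := by rw [real_inner_comm]; exact hF.ec
  have hfe : ⟪f, e⟫ = 0 := by rw [real_inner_comm]; exact hF.ef
  have hcomp := dirs_compact (c := c) (R := R) h
  have hc1 : IsCompact (dirs M c R ∩ {x | 0 ≤ ⟪x, f⟫}) :=
    hcomp.inter_right (isClosed_le continuous_const (by fun_prop))
  have hc2 : IsCompact (dirs M c R ∩ {x | ⟪x, f⟫ ≤ 0}) :=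
    hcomp.inter_right (isClosed_le (by fun_prop) continuous_const)
  obtain ⟨e₂, ⟨h2, h2f⟩, m2⟩ := hc1.exists_isMinOn ⟨e, he, hF.ef.ge⟩ (f := fun x => ⟪x, e⟫) (by fun_prop)
  obtain ⟨e₃, ⟨h3, h3f⟩, m3⟩ := hc2.exists_isMinOn ⟨e, he, hF.ef.le⟩ (f := fun x => ⟪x, e⟫) (by fun_prop)
  simp only [mem_setOf_eq] at h2f h3f
  rw [isMinOn_iff] at m2 m3
  have p2 := (planar hF h2.1 h2.2.1).1 h2f
  have p3 := (planar hF h3.1 h3.2.1).2 h3f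
  have hee := hF.ee
  have hff := hF.ff
  have hef := hF.ef
  set α := Real.arccos ⟪e₂, e⟫ with hα
  set γ := Real.arccos ⟪e₃, e⟫ with hγ
  have hα0 : 0 ≤ α := Real.arccos_nonneg _
  have hγ0 : 0 ≤ γ := Real.arccos_nonneg _
  have hαπ : α ≤ π := Real.arccos_le_pi _
  have hγπ : γ ≤ π := Real.arccos_le_pi _
  have key : π ≤ α + γ := by
    by_contra hlt
    push Not at hlt
    obtain ⟨x, hx, hxb⟩ := dirs_con hD h C hR (Real.cos ((α - γ) / 2) • e + Real.sin ((α - γ) / 2) • f)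
      (by simp only [inner_add_right, real_inner_smul_right, hce, hcf]; ring)
    rcases le_total 0 ⟪x, f⟫ with h0 | h0
    · have px := (planar hF hx.1 hx.2.1).1 h0
      have hle : Real.arccos ⟪x, e⟫ ≤ α := Real.arccos_le_arccos (m2 x ⟨hx, h0⟩)
      have hge := Real.arccos_nonneg ⟪x, e⟫
      generalize Real.arccos ⟪x, e⟫ = a at *
      have : 0 < ⟪x, Real.cos ((α - γ) / 2) • e + Real.sin ((α - γ) / 2) • f⟫ := by
        rw [px]
        simp only [inner_add_right, inner_add_left, real_inner_smul_right, real_inner_smul_left, hee, hff, hef, hfe]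
        have : 0 < Real.cos (a - (α - γ) / 2) := Real.cos_pos_of_mem_Ioo ⟨by linarith, by linarith⟩
        rw [Real.cos_sub] at this
        linarith
      linarith
    · have px := (planar hF hx.1 hx.2.1).2 h0
      have hle : Real.arccos ⟪x, e⟫ ≤ γ := Real.arccos_le_arccos (m3 x ⟨hx, h0⟩)
      have hge := Real.arccos_nonneg ⟪x, e⟫
      generalize Real.arccos ⟪x, e⟫ = a at *
      have : 0 < ⟪x, Real.cos ((α - γ) / 2) • e + Real.sin ((α - γ) / 2) • f⟫ := by
        rw [px]
        simp only [inner_add_right, inner_sub_left, real_inner_smul_right, real_inner_smul_left, hee, hff, hef, hfe]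
        have : 0 < Real.cos (a + (α - γ) / 2) := Real.cos_pos_of_mem_Ioo ⟨by linarith, by linarith⟩
        rw [Real.cos_add] at this
        linarith
      linarith
  have i2 : ⟪e, e₂⟫ = Real.cos α := by
    rw [p2]; simp only [inner_add_right, real_inner_smul_right, hee, hef]; ring
  have i3 : ⟪e, e₃⟫ = Real.cos γ := by
    rw [p3]; simp only [inner_sub_right, real_inner_smul_right, hee, hef]; ring
  have i23 : ⟪e₂, e₃⟫ = Real.cos (α + γ) := by
    rw [p2, p3, Real.cos_add]
    simp only [inner_sub_right, inner_add_left, real_inner_smul_right, real_inner_smul_left, hee, hef, hff, hfe]; ring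
  have q2 := dirs_pair h C.hc hs hφ he h2
  have q3 := dirs_pair h C.hc hs hφ he h3
  have q23 := dirs_pair h C.hc hs hφ h2 h3
  rw [i2, ← Real.cos_pi_sub] at q2
  rw [i3, ← Real.cos_pi_sub] at q3
  rw [i23, show α + γ = (α + γ - π) + π by ring, Real.cos_add_pi] at q23
  have a2 : α ≤ π - φ := by
    by_contra hh; push Not at hh
    have := Real.cos_lt_cos_of_nonneg_of_le_pi (by linarith) hαπ hh
    linarith
  have a3 : γ ≤ π - φ := by
    by_contra hh; push Not at hh
    have := Real.cos_lt_cos_of_nonneg_of_le_pi (by linarith) hγπ hh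
    linarith
  have a23 : φ ≤ α + γ - π := by
    by_contra hh; push Not at hh
    have := Real.cos_lt_cos_of_nonneg_of_le_pi (by linarith) hφπ.le hh
    linarith
  refine ⟨by linarith, e, he, e₂, h2, e₃, h3, ?_, ?_, ?_⟩
  · unfold gdist; rw [i2, Real.arccos_cos hα0 hαπ]; linarith
  · unfold gdist; rw [i3, Real.arccos_cos hγ0 hγπ]; linarith
  · unfold gdist
    rw [i23, show α + γ = 2 * π - (2 * π - (α + γ)) by ring, Real.cos_two_pi_sub, Real.arccos_cos (by linarith) (by linarith)]
    linarith


def Sec (e e' : E 2) (φ : ℝ) : Set (E 2) := {z | 0 < ⟪z, e'⟫ ∧ 0 < Real.sin φ * ⟪z, e⟫ - Real.cos φ * ⟪z, e'⟫}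

lemma Frame.n1 {e f c : E 2} (h : Frame e f c) : ‖e‖ = 1 := by
  have := h.ee; rw [real_inner_self_eq_norm_sq] at this; nlinarith [norm_nonneg e]
lemma Frame.n2 {e f c : E 2} (h : Frame e f c) : ‖f‖ = 1 := by
  have := h.ff; rw [real_inner_self_eq_norm_sq] at this; nlinarith [norm_nonneg f]
lemma Frame.n3 {e f c : E 2} (h : Frame e f c) : ‖c‖ = 1 := by
  have := h.cc; rw [real_inner_self_eq_norm_sq] at this; nlinarith [norm_nonneg c]

lemma norm_one_of_inner {x : E 2} (h : ⟪x, x⟫ = 1) : ‖x‖ = 1 := by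
  rw [real_inner_self_eq_norm_sq] at h; nlinarith [norm_nonneg x]

set_option maxHeartbeats 2000000 in
lemma quarter {M L : Set (E 2)} {D R φ β : ℝ} {c e e' : E 2} (hD0 : 0 < D) (hD : D < π / 2) (h : Good D M L) (C : Circ D M c R)
    (hR : 0 < R) (hφ0 : 0 < φ) (hφ1 : φ ≤ π / 3)
    (hφ : Real.cos φ * Real.sin R ^ 2 = Real.cos R ^ 2 - Real.cos D)
    (hF : Frame e e' c) (he : Real.cos R • c + Real.sin R • e ∈ M)
    (hβ0 : 0 < β) (hβ1 : β < π / 2)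
    (hβc : Real.sin D * Real.cos β = Real.sin R * Real.cos R * (1 + Real.cos φ))
    (hβs : Real.sin D * Real.sin β = Real.sin R * Real.sin φ) :
    φ - β * (1 + Real.cos D) ≤ sig.real (M ∩ Sec e e' φ) := by
  have hpi := Real.pi_pos
  have hRD := C.RD
  have hsR : 0 < Real.sin R := Real.sin_pos_of_pos_of_lt_pi hR (by linarith)
  have hsD : 0 < Real.sin D := Real.sin_pos_of_pos_of_lt_pi hD0 (by linarith)
  have hsφ : 0 < Real.sin φ := Real.sin_pos_of_pos_of_lt_pi hφ0 (by linarith)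
  have hsβ : 0 < Real.sin β := Real.sin_pos_of_pos_of_lt_pi hβ0 (by linarith)
  have hsr : 0 < Real.sin (D - R) := Real.sin_pos_of_pos_of_lt_pi (by linarith) (by linarith)
  have scφ := Real.sin_sq_add_cos_sq φ
  have scR := Real.sin_sq_add_cos_sq R
  have scβ := Real.sin_sq_add_cos_sq β
  have scr := Real.sin_sq_add_cos_sq (D - R)
  have ad1 : Real.sin D = Real.sin (D - R) * Real.cos R + Real.cos (D - R) * Real.sin R := by
    rw [← Real.sin_add]; ring_nf
  have ad2 : Real.cos D = Real.cos (D - R) * Real.cos R - Real.sin (D - R) * Real.sin R := by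
    rw [← Real.cos_add]; ring_nf
  have ee := hF.ee
  have ff := hF.ff
  have cc := hF.cc
  have ef := hF.ef
  have ec := hF.ec
  have fc := hF.fc
  have fe : ⟪e', e⟫ = 0 := by rw [real_inner_comm]; exact ef
  have ce : ⟪c, e⟫ = 0 := by rw [real_inner_comm]; exact ec
  have cf : ⟪c, e'⟫ = 0 := by rw [real_inner_comm]; exact fc
  obtain ⟨T, hT⟩ : ∃ T, T = Real.cos φ • e + Real.sin φ • e' := ⟨_, rfl⟩
  obtain ⟨ν, hν⟩ : ∃ T, T = Real.sin φ • e - Real.cos φ • e' := ⟨_, rfl⟩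
  obtain ⟨o, ho⟩ : ∃ o, o = Real.cos R • c - Real.sin R • T := ⟨_, rfl⟩
  obtain ⟨eo, heo⟩ : ∃ o, o = Real.sin R • c + Real.cos R • T := ⟨_, rfl⟩
  obtain ⟨x, hx⟩ : ∃ x, x = Real.cos R • c + Real.sin R • e := ⟨_, rfl⟩
  obtain ⟨t, ht⟩ : ∃ x, x = Real.cos (D - R) • c + Real.sin (D - R) • T := ⟨_, rfl⟩
  obtain ⟨ν', hν'⟩ : ∃ x, x = Real.sin β • eo - Real.cos β • ν := ⟨_, rfl⟩
  have TT : ⟪T, T⟫ = 1 := by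
    rw [hT]; simp only [inner_add_left, inner_add_right, real_inner_smul_left, real_inner_smul_right, ee, ff, ef, fe]; linarith
  have Tc : ⟪T, c⟫ = 0 := by
    rw [hT]; simp only [inner_add_left, real_inner_smul_left, ec, fc]; ring
  have cT : ⟪c, T⟫ = 0 := by rw [real_inner_comm]; exact Tc
  have Tν : ⟪T, ν⟫ = 0 := by
    rw [hT, hν]; simp only [inner_add_left, inner_sub_right, real_inner_smul_left, real_inner_smul_right, ee, ff, ef, fe]; ring
  have νν : ⟪ν, ν⟫ = 1 := by
    rw [hν]; simp only [inner_sub_left, inner_sub_right, real_inner_smul_left, real_inner_smul_right, ee, ff, ef, fe]; linarith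
  have cν : ⟪c, ν⟫ = 0 := by
    rw [hν]; simp only [inner_sub_right, real_inner_smul_right, ce, cf]; ring
  have Te : ⟪T, e⟫ = Real.cos φ := by
    rw [hT]; simp only [inner_add_left, real_inner_smul_left, ee, fe]; ring
  have eT : ⟪e, T⟫ = Real.cos φ := by rw [real_inner_comm]; exact Te
  have Tf : ⟪T, e'⟫ = Real.sin φ := by
    rw [hT]; simp only [inner_add_left, real_inner_smul_left, ef, ff]; ring
  have eν : ⟪e, ν⟫ = Real.sin φ := by
    rw [hν]; simp only [inner_sub_right, real_inner_smul_right, ee, ef]; ring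
  have νf : ⟪ν, e'⟫ = - Real.cos φ := by
    rw [hν]; simp only [inner_sub_left, real_inner_smul_left, ff, ef]; ring
  have hFo : Frame eo ν o := by
    refine ⟨?_, νν, ?_, ?_, ?_, ?_⟩
    · rw [heo]; simp only [inner_add_left, inner_add_right, real_inner_smul_left, real_inner_smul_right, TT, cc, Tc, cT]; linarith
    · rw [ho]; simp only [inner_sub_left, inner_sub_right, real_inner_smul_left, real_inner_smul_right, TT, cc, Tc, cT]; linarith
    · rw [heo]; simp only [inner_add_left, real_inner_smul_left, Tν, cν]; ring
    · rw [heo, ho]; simp only [inner_add_left, inner_sub_right, real_inner_smul_left, real_inner_smul_right, TT, cc, Tc, cT]; ring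
    · rw [real_inner_comm, ho]; simp only [inner_sub_left, real_inner_smul_left, Tν, cν]; ring
  have hνin : ∀ z : E 2, ⟪z, ν⟫ = Real.sin φ * ⟪z, e⟫ - Real.cos φ * ⟪z, e'⟫ := by
    intro z; rw [hν, inner_sub_right, real_inner_smul_right, real_inner_smul_right]
  have hν'in : ∀ z : E 2, ⟪z, ν'⟫ = Real.sin β * ⟪z, eo⟫ - Real.cos β * ⟪z, ν⟫ := by
    intro z; rw [hν', inner_sub_right, real_inner_smul_right, real_inner_smul_right]
  have xν : ⟪x, ν⟫ = Real.sin R * Real.sin φ := by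
    rw [hx]; simp only [inner_add_left, real_inner_smul_left, cν, eν]; ring
  have tν : ⟪t, ν⟫ = 0 := by
    rw [ht]; simp only [inner_add_left, real_inner_smul_left, cν, Tν]; ring
  have xeo : ⟪x, eo⟫ = Real.sin D * Real.cos β := by
    rw [hβc, hx, heo]; simp only [inner_add_left, inner_add_right, real_inner_smul_left, real_inner_smul_right, cc, cT, ec, eT]; ring
  have teo : ⟪t, eo⟫ = Real.sin D := by
    rw [ad1, ht, heo]; simp only [inner_add_left, inner_add_right, real_inner_smul_left, real_inner_smul_right, cc, cT, Tc, TT]; ring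
  have xo : ⟪x, o⟫ = Real.cos D := by
    rw [hx, ho]; simp only [inner_add_left, inner_sub_right, real_inner_smul_left, real_inner_smul_right, cc, cT, ec, eT]; linarith
  have to' : ⟪t, o⟫ = Real.cos D := by
    rw [ad2, ht, ho]; simp only [inner_add_left, inner_sub_right, real_inner_smul_left, real_inner_smul_right, cc, cT, Tc, TT]; ring
  have xf : ⟪x, e'⟫ = 0 := by
    rw [hx]; simp only [inner_add_left, real_inner_smul_left, cf, ef]; ring
  have tf : ⟪t, e'⟫ = Real.sin (D - R) * Real.sin φ := by
    rw [ht]; simp only [inner_add_left, real_inner_smul_left, cf, Tf]; ring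
  have of : ⟪o, e'⟫ = - (Real.sin R * Real.sin φ) := by
    rw [ho]; simp only [inner_sub_left, real_inner_smul_left, cf, Tf]; ring
  have eof : ⟪eo, e'⟫ = Real.cos R * Real.sin φ := by
    rw [heo]; simp only [inner_add_left, real_inner_smul_left, cf, Tf]; ring
  have xν' : ⟪x, ν'⟫ = 0 := by
    rw [hν'in, xeo, xν, ← hβs]; ring
  have tν' : ⟪t, ν'⟫ = Real.sin β * Real.sin D := by
    rw [hν'in, teo, tν]; ring
  have hsrt : Real.sin (D - R) • o = Real.sin D • c - Real.sin R • t := by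
    rw [ho, ht, ad1]; module
  -- membership facts
  have hball : gball c (D - R) ⊆ M := C.ball hD h (by linarith) (by linarith)
  have hcM : c ∈ M := by
    apply hball
    rw [gball_eq C.hc (by linarith) (by linarith)]
    exact ⟨mem_us.2 C.hc, by rw [cc]; exact Real.cos_le_one _⟩
  have htn : ‖t‖ = 1 := norm_one_of_inner (by
    rw [ht]; simp only [inner_add_left, inner_add_right, real_inner_smul_left, real_inner_smul_right, TT, cc, Tc, cT]; linarith)
  have htM : t ∈ M := by
    apply hball
    rw [gball_eq C.hc (by linarith) (by linarith)]
    refine ⟨mem_us.2 htn, ?_⟩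
    rw [ht]; simp only [inner_add_right, real_inner_smul_right, cc, cT]; linarith
  rw [← hx] at he
  have hdec : ∀ z : E 2, 0 < ⟪z, ν⟫ → 0 < ⟪z, ν'⟫ → ∃ a b d : ℝ, 0 < b ∧ 0 < d ∧ z = a • o + b • x + d • t := by
    intro z h1 h2
    refine ⟨⟪z - (⟪z, ν⟫ / (Real.sin R * Real.sin φ)) • x - (⟪z, ν'⟫ / (Real.sin β * Real.sin D)) • t, o⟫,
      ⟪z, ν⟫ / (Real.sin R * Real.sin φ), ⟪z, ν'⟫ / (Real.sin β * Real.sin D), by positivity, by positivity, ?_⟩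
    set y := z - (⟪z, ν⟫ / (Real.sin R * Real.sin φ)) • x - (⟪z, ν'⟫ / (Real.sin β * Real.sin D)) • t with hy
    have y1 : ⟪y, ν⟫ = 0 := by
      rw [hy]; simp only [inner_sub_left, real_inner_smul_left, xν, tν]
      field_simp; ring
    have y2 : ⟪y, ν'⟫ = 0 := by
      rw [hy]; simp only [inner_sub_left, real_inner_smul_left, xν', tν']
      field_simp; ring
    have y3 : ⟪y, eo⟫ = 0 := by
      rw [hν'in, y1] at y2
      have : Real.sin β * ⟪y, eo⟫ = 0 := by linarith
      exact (mul_eq_zero.1 this).resolve_left hsβ.ne'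
    have y4 := hFo.decomp y
    rw [y1, y3, zero_smul, zero_smul, zero_add, zero_add] at y4
    rw [← y4, hy]; abel
  have hmem : ∀ z : E 2, ‖z‖ = 1 → 0 < ⟪z, ν⟫ → 0 < ⟪z, ν'⟫ → Real.cos D ≤ ⟪z, o⟫ → 0 < ⟪z, e'⟫ → z ∈ M := by
    intro z hz h1 h2 h3 h4
    obtain ⟨a, b, d, hb, hd, rfl⟩ := hdec z h1 h2
    have hon := inner_self_us hFo.n3
    have h3' : Real.cos D ≤ a + (b + d) * Real.cos D := by
      have : ⟪a • o + b • x + d • t, o⟫ = a + (b + d) * Real.cos D := by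
        simp only [inner_add_left, real_inner_smul_left, hon, xo, to']; ring
      linarith
    have h4' : 0 < d * Real.sin (D - R) - a * Real.sin R := by
      have : ⟪a • o + b • x + d • t, e'⟫ = (d * Real.sin (D - R) - a * Real.sin R) * Real.sin φ := by
        simp only [inner_add_left, real_inner_smul_left, xf, of, tf]; ring
      rw [this] at h4
      exact pos_of_mul_pos_left h4 hsφ.le
    rcases le_or_gt a 0 with ha | ha
    · apply h.complete _ (mem_us.2 hz)
      intro m hm
      have := inner_le_one' hFo.n3 (mem_us.1 (h.MS hm))
      have i1 := h.diam x he m hm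
      have i2 := h.diam t htM m hm
      simp only [inner_add_left, real_inner_smul_left]
      have k1 : a * 1 ≤ a * ⟪o, m⟫ := mul_le_mul_of_nonpos_left this ha
      have k2 : b * Real.cos D ≤ b * ⟪x, m⟫ := mul_le_mul_of_nonneg_left i1 hb.le
      have k3 : d * Real.cos D ≤ d * ⟪t, m⟫ := mul_le_mul_of_nonneg_left i2 hd.le
      linarith
    · rw [h.ML] at he hcM htM ⊢
      refine ⟨mem_us.2 hz, fun l hl => ?_⟩
      have i1 := he.2 l hl
      have i2 := hcM.2 l hl
      have i3 := htM.2 l hl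
      have e1 : Real.sin (D - R) * ⟪l, o⟫ = Real.sin D * ⟪l, c⟫ - Real.sin R * ⟪l, t⟫ := by
        rw [← real_inner_smul_right, hsrt, inner_sub_right, real_inner_smul_right, real_inner_smul_right]
      simp only [inner_add_right, real_inner_smul_right]
      have e2 : Real.sin (D - R) * (a * ⟪l, o⟫ + b * ⟪l, x⟫ + d * ⟪l, t⟫) =
          a * (Real.sin D * ⟪l, c⟫) + Real.sin (D - R) * b * ⟪l, x⟫ + (d * Real.sin (D - R) - a * Real.sin R) * ⟪l, t⟫ := by
        linear_combination a * e1
      have j1 : a * (Real.sin D * ⟪l, c⟫) ≤ 0 :=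
        mul_nonpos_of_nonneg_of_nonpos ha.le (mul_nonpos_of_nonneg_of_nonpos hsD.le i2)
      have j2 : Real.sin (D - R) * b * ⟪l, x⟫ ≤ 0 := mul_nonpos_of_nonneg_of_nonpos (by positivity) i1
      have j3 : (d * Real.sin (D - R) - a * Real.sin R) * ⟪l, t⟫ ≤ 0 := mul_nonpos_of_nonneg_of_nonpos h4'.le i3
      have j4 : Real.sin (D - R) * (a * ⟪l, o⟫ + b * ⟪l, x⟫ + d * ⟪l, t⟫) ≤ 0 := by rw [e2]; linarith
      by_contra hh
      push Not at hh
      have := mul_pos hsr hh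
      linarith
  -- Girard
  have hcβ : Real.sin β * Real.cos R * Real.sin φ = Real.cos β * (1 - Real.cos φ) := by
    have : Real.sin D * (Real.sin β * Real.cos R * Real.sin φ - Real.cos β * (1 - Real.cos φ)) = 0 := by
      have e1 : Real.sin D * (Real.sin β * Real.cos R * Real.sin φ - Real.cos β * (1 - Real.cos φ)) =
        (Real.sin D * Real.sin β) * (Real.cos R * Real.sin φ) - (Real.sin D * Real.cos β) * (1 - Real.cos φ) := by ring
      rw [e1, hβs, hβc]
      linear_combination (Real.sin R * Real.cos R) * scφ
    have := (mul_eq_zero.1 this).resolve_left hsD.ne'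
    linarith
  have ν'n : ‖ν'‖ = 1 := norm_one_of_inner (by
    rw [hν']
    have a1 := hFo.ee
    have a2 := hFo.ef
    have a3 : ⟪ν, eo⟫ = 0 := by rw [real_inner_comm]; exact a2
    simp only [inner_sub_left, inner_sub_right, real_inner_smul_left, real_inner_smul_right, a1, a2, a3, νν]; linarith)
  have G := girard (n₁ := ν) (n₂ := ν') (n₃ := -e') (a₁ := β) (a₂ := π - φ) (a₃ := β) hFo.n2 ν'n (by rw [norm_neg]; exact hF.n2)
    ⟨hβ0, by linarith⟩ ⟨by linarith, by linarith⟩ ⟨hβ0, by linarith⟩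
    (by
      have a3 : ⟪ν, eo⟫ = 0 := by rw [real_inner_comm]; exact hFo.ef
      rw [hν'in, a3, νν]; ring)
    (by rw [inner_neg_right, νf, Real.cos_pi_sub])
    (by
      rw [inner_neg_right, hν', inner_sub_left, real_inner_smul_left, real_inner_smul_left, eof, νf]
      linarith)
  have hQ := sig_sect hFo hβ0 (by linarith : β < π) (i := Real.cos D) (j := 1) (Real.cos_le_one _) (Real.neg_one_le_cos _) le_rfl
  have hsub : sect eo ν o β (Real.cos D) 1 ∩ unitSphere 2 ⊆ (M ∩ Sec e e' φ) ∪ (tri ν ν' (-e') ∪ {z | ⟪z, e'⟫ ∈ Icc (0:ℝ) 0}) := by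
    rintro z ⟨⟨z1, z2, z3⟩, z4⟩
    rw [← hν'in] at z2
    rcases lt_trichotomy ⟪z, e'⟫ 0 with h0 | h0 | h0
    · right; left; exact ⟨z1, z2, by rw [inner_neg_right]; linarith⟩
    · right; right; show ⟪z, e'⟫ ∈ Icc (0:ℝ) 0; rw [h0]; simp
    · left; refine ⟨hmem z (mem_us.1 z4) z1 z2 z3.1 h0, h0, ?_⟩
      rw [← hνin]; exact z1
  have u1 := (measureReal_mono (μ := sig) hsub).trans (measureReal_union_le _ _)
  have u2 := measureReal_union_le (μ := sig) (tri ν ν' (-e')) {z | ⟪z, e'⟫ ∈ Icc (0:ℝ) 0}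
  rw [sig_zone hF.n2 le_rfl (by norm_num) (by norm_num), G] at u2
  rw [sig_inter_us, hQ] at u1
  linarith


lemma meas_Sec (e e' : E 2) (φ : ℝ) : MeasurableSet (Sec e e' φ) :=
  ((by fun_prop : Measurable fun z : E 2 => ⟪z, e'⟫) measurableSet_Ioi).inter
    ((by fun_prop : Measurable fun z : E 2 => Real.sin φ * ⟪z, e⟫ - Real.cos φ * ⟪z, e'⟫) measurableSet_Ioi)

lemma Sec_angle {e f c z : E 2} {φ : ℝ} (hF : Frame e f c) (hφ0 : 0 < φ) (hφ1 : φ ≤ π / 3) (hz : z ∈ Sec e f φ) :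
    InnerProductGeometry.angle (z - ⟪z, c⟫ • c) e < φ := by
  have hpi := Real.pi_pos
  obtain ⟨hB, hA⟩ := hz
  have hsφ : 0 < Real.sin φ := Real.sin_pos_of_pos_of_lt_pi hφ0 (by linarith)
  have hcφ : 0 < Real.cos φ := Real.cos_pos_of_mem_Ioo ⟨by linarith, by linarith⟩
  have scφ := Real.sin_sq_add_cos_sq φ
  have hd := hF.decomp z
  have hp : z - ⟪z, c⟫ • c = ⟪z, e⟫ • e + ⟪z, f⟫ • f := by
    rw [sub_eq_iff_eq_add]; exact hd
  have fe : ⟪f, e⟫ = 0 := by rw [real_inner_comm]; exact hF.ef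
  have hpe : ⟪z - ⟪z, c⟫ • c, e⟫ = ⟪z, e⟫ := by
    rw [hp, inner_add_left, real_inner_smul_left, real_inner_smul_left, hF.ee, fe]; ring
  have hpp : ‖z - ⟪z, c⟫ • c‖ ^ 2 = ⟪z, e⟫ ^ 2 + ⟪z, f⟫ ^ 2 := by
    rw [hp, ← real_inner_self_eq_norm_sq]
    simp only [inner_add_left, inner_add_right, real_inner_smul_left, real_inner_smul_right, hF.ee, hF.ff, hF.ef, fe]; ring
  set p := z - ⟪z, c⟫ • c
  have hA0 : 0 < ⟪z, e⟫ := by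
    have : 0 < Real.sin φ * ⟪z, e⟫ := by nlinarith [mul_pos hcφ hB]
    exact pos_of_mul_pos_right this hsφ.le
  have hp0 : 0 < ‖p‖ := by
    have := sq_nonneg ‖p‖
    apply lt_of_le_of_ne (norm_nonneg _)
    intro h0; rw [← h0] at hpp; nlinarith
  unfold InnerProductGeometry.angle
  rw [hpe, hF.n1, mul_one]
  have key : Real.cos φ < ⟪z, e⟫ / ‖p‖ := by
    rw [lt_div_iff₀ hp0]
    apply lt_of_pow_lt_pow_left₀ 2 hA0.le
    rw [mul_pow, hpp]
    have h1 : (Real.cos φ * ⟪z, f⟫) ^ 2 < (Real.sin φ * ⟪z, e⟫) ^ 2 :=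
      pow_lt_pow_left₀ (by linarith) (by positivity) (by norm_num)
    nlinarith
  rw [← Real.arccos_cos hφ0.le (by linarith)] 
  apply Real.arccos_lt_arccos (Real.neg_one_le_cos _) key
  rw [div_le_one hp0]
  exact le_of_sq_le_sq (by rw [hpp]; nlinarith) hp0.le

structure CapSet (M : Set (E 2)) (c e : E 2) (φ v r : ℝ) (A : Set (E 2)) : Prop where
  meas : MeasurableSet A
  low : v ≤ sig.real (M ∩ A)
  up : sig.real (gball c r ∩ A) ≤ 2 * φ * (1 - Real.cos r)
  ang : ∀ z ∈ A, InnerProductGeometry.angle (z - ⟪z, c⟫ • c) e < φ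

lemma Frame.flip {e f c : E 2} (h : Frame e f c) : Frame e (-f) c :=
  ⟨h.ee, by rw [inner_neg_neg]; exact h.ff, h.cc, by rw [inner_neg_right, h.ef, neg_zero], h.ec, by rw [inner_neg_left, h.fc, neg_zero]⟩

lemma exists_cap {M L : Set (E 2)} {D R φ β : ℝ} {c e : E 2} (hD0 : 0 < D) (hD : D < π / 2) (h : Good D M L) (C : Circ D M c R)
    (hR : 0 < R) (hφ0 : 0 < φ) (hφ1 : φ ≤ π / 3)
    (hφ : Real.cos φ * Real.sin R ^ 2 = Real.cos R ^ 2 - Real.cos D)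
    (he : e ∈ dirs M c R)
    (hβ0 : 0 < β) (hβ1 : β < π / 2)
    (hβc : Real.sin D * Real.cos β = Real.sin R * Real.cos R * (1 + Real.cos φ))
    (hβs : Real.sin D * Real.sin β = Real.sin R * Real.sin φ) :
    ∃ A, CapSet M c e φ (2 * (φ - β * (1 + Real.cos D))) (D - R) A := by
  have hpi := Real.pi_pos
  have hRD := C.RD
  obtain ⟨f, hF⟩ := exists_frame' C.hc he.1 he.2.1
  have hF' := hF.flip
  have q1 := quarter hD0 hD h C hR hφ0 hφ1 hφ hF he.2.2 hβ0 hβ1 hβc hβs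
  have q2 := quarter hD0 hD h C hR hφ0 hφ1 hφ hF' he.2.2 hβ0 hβ1 hβc hβs
  have gs : ∀ f, Frame e f c → sig.real (gball c (D - R) ∩ Sec e f φ) ≤ φ * (1 - Real.cos (D - R)) := by
    intro f hF
    rw [← sig_sect hF hφ0 (by linarith) (Real.cos_le_one _) (Real.neg_one_le_cos _) le_rfl]
    refine measureReal_mono ?_ (measure_ne_top _ _)
    rintro z ⟨z1, z2⟩
    rw [gball_eq C.hc (by linarith) (by linarith)] at z1
    refine ⟨z2.1, z2.2, ?_, ?_⟩
    · rw [real_inner_comm]; exact z1.2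
    · exact inner_le_one' (mem_us.1 z1.1) C.hc
  have g1 := gs f hF
  have g2 := gs _ hF'
  refine ⟨Sec e f φ ∪ Sec e (-f) φ, (meas_Sec _ _ _).union (meas_Sec _ _ _), ?_, ?_, ?_⟩
  · rw [inter_union_distrib_left, measureReal_union]
    · linarith
    · rw [Set.disjoint_left]
      rintro z ⟨_, z1⟩ ⟨_, z2⟩
      have := z1.1
      have := z2.1
      rw [inner_neg_right] at this
      linarith
    · have hM := (good_compact h).isClosed.measurableSet
      exact hM.inter (meas_Sec _ _ _)
  · rw [inter_union_distrib_left]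
    refine (measureReal_union_le _ _).trans ?_
    linarith
  · rintro z (hz | hz)
    · exact Sec_angle hF hφ0 hφ1 hz
    · exact Sec_angle hF' hφ0 hφ1 hz

lemma cap_disj {M : Set (E 2)} {c e e' : E 2} {φ v r : ℝ} {A A' : Set (E 2)} (h : CapSet M c e φ v r A) (h' : CapSet M c e' φ v r A')
    (he : ‖e‖ = 1) (he' : ‖e'‖ = 1) (hd : 2 * φ ≤ gdist e e') : Disjoint A A' := by
  rw [Set.disjoint_left]
  intro z hz hz'
  have h1 := h.ang z hz
  have h2 := h'.ang z hz'
  rw [gdist_eq_angle he he'] at hd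
  have := InnerProductGeometry.angle_le_angle_add_angle e (z - ⟪z, c⟫ • c) e'
  rw [InnerProductGeometry.angle_comm e (z - ⟪z, c⟫ • c)] at this
  linarith

lemma six {M L : Set (E 2)} {D R φ β : ℝ} {c : E 2} (hD0 : 0 < D) (hD : D < π / 2) (h : Good D M L) (C : Circ D M c R)
    (hR : 0 < R) (hφ0 : 0 < φ) (hφπ : φ < π)
    (hφ : Real.cos φ * Real.sin R ^ 2 = Real.cos R ^ 2 - Real.cos D)
    (hβ0 : 0 < β) (hβ1 : β < π / 2)
    (hβc : Real.sin D * Real.cos β = Real.sin R * Real.cos R * (1 + Real.cos φ))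
    (hβs : Real.sin D * Real.sin β = Real.sin R * Real.sin φ) :
    φ ≤ π / 3 ∧ 6 * (φ - β * (1 + Real.cos D)) + (2 * π - 6 * φ) * (1 - Real.cos (D - R)) ≤ sig.real M := by
  have hpi := Real.pi_pos
  have hRD := C.RD
  obtain ⟨hφ1, e₁, he₁, e₂, he₂, e₃, he₃, d12, d13, d23⟩ := triple hD h C hR hφ0 hφπ hφ
  refine ⟨hφ1, ?_⟩
  obtain ⟨A₁, c1⟩ := exists_cap hD0 hD h C hR hφ0 hφ1 hφ he₁ hβ0 hβ1 hβc hβs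
  obtain ⟨A₂, c2⟩ := exists_cap hD0 hD h C hR hφ0 hφ1 hφ he₂ hβ0 hβ1 hβc hβs
  obtain ⟨A₃, c3⟩ := exists_cap hD0 hD h C hR hφ0 hφ1 hφ he₃ hβ0 hβ1 hβc hβs
  have D12 := cap_disj c1 c2 he₁.1 he₂.1 d12
  have D13 := cap_disj c1 c3 he₁.1 he₃.1 d13
  have D23 := cap_disj c2 c3 he₂.1 he₃.1 d23
  have hball : gball c (D - R) ⊆ M := C.ball hD h (by linarith) (by linarith)
  have key : ∀ X : Set (E 2), sig.real X = sig.real (X ∩ A₁) + sig.real (X ∩ A₂) + sig.real (X ∩ A₃) + sig.real (((X \ A₁) \ A₂) \ A₃) := by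
    intro X
    have k1 := measureReal_inter_add_diff (μ := sig) (s := X) c1.meas
    have k2 := measureReal_inter_add_diff (μ := sig) (s := (X \ A₁)) c2.meas
    have k3 := measureReal_inter_add_diff (μ := sig) (s := ((X \ A₁) \ A₂)) c3.meas
    have j1 : (X \ A₁) ∩ A₂ = X ∩ A₂ := by
      ext z; simp only [mem_inter_iff, mem_diff]
      constructor
      · rintro ⟨⟨a, _⟩, b⟩; exact ⟨a, b⟩
      · rintro ⟨a, b⟩; exact ⟨⟨a, fun hh => Set.disjoint_left.1 D12 hh b⟩, b⟩
    have j2 : ((X \ A₁) \ A₂) ∩ A₃ = X ∩ A₃ := by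
      ext z; simp only [mem_inter_iff, mem_diff]
      constructor
      · rintro ⟨⟨⟨a, _⟩, _⟩, b⟩; exact ⟨a, b⟩
      · rintro ⟨a, b⟩; exact ⟨⟨⟨a, fun hh => Set.disjoint_left.1 D13 hh b⟩, fun hh => Set.disjoint_left.1 D23 hh b⟩, b⟩
    rw [j1] at k2
    rw [j2] at k3
    linarith
  have kM := key M
  have kB := key (gball c (D - R))
  rw [sig_gball C.hc (by linarith) (by linarith)] at kB
  have hmono : sig.real (((gball c (D - R) \ A₁) \ A₂) \ A₃) ≤ sig.real (((M \ A₁) \ A₂) \ A₃) :=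
    measureReal_mono (diff_subset_diff_left (diff_subset_diff_left (diff_subset_diff_left hball))) (measure_ne_top _ _)
  have := c1.low
  have := c2.low
  have := c3.low
  have := c1.up
  have := c2.up
  have := c3.up
  linarith


lemma calc_arcsin {k s q : ℝ} (hk : 1 / 2 < k) (hk1 : k ≤ 1) (hs0 : 0 ≤ s) (hs : s ≤ π / 6) (hq : 0 ≤ q)
    (h : q ^ 2 * (k ^ 2 - Real.sin s ^ 2) ≤ Real.cos s ^ 2) :
    q * (π / 6 - s) ≤ Real.arcsin (1 / (2 * k)) - Real.arcsin (Real.sin s / k) := by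
  have hpi := Real.pi_pos
  have hk0 : 0 < k := by linarith
  have hsin : ∀ u ∈ Icc 0 (π / 6), 0 ≤ Real.sin u ∧ Real.sin u ≤ 1 / 2 := by
    intro u hu
    refine ⟨Real.sin_nonneg_of_nonneg_of_le_pi hu.1 (by linarith [hu.2]), ?_⟩
    rw [← Real.sin_pi_div_six]
    exact Real.sin_le_sin_of_le_of_le_pi_div_two (by linarith [hu.1]) (by linarith) hu.2
  have hlt : ∀ u ∈ Icc 0 (π / 6), Real.sin u / k < 1 := by
    intro u hu
    rw [div_lt_one hk0]; linarith [(hsin u hu).2]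
  have hder : ∀ u ∈ Icc 0 (π / 6), HasDerivAt (fun u => Real.arcsin (Real.sin u / k))
      (1 / √(1 - (Real.sin u / k) ^ 2) * (Real.cos u / k)) u := by
    intro u hu
    have h0 : 0 ≤ Real.sin u / k := div_nonneg (hsin u hu).1 hk0.le
    exact (Real.hasDerivAt_arcsin (by linarith) (hlt u hu).ne).comp u ((Real.hasDerivAt_sin u).div_const k)
  have key := (convex_Icc s (π / 6)).mul_sub_le_image_sub_of_le_deriv (f := fun u => Real.arcsin (Real.sin u / k)) (C := q)
    (fun u hu => (hder u ⟨hs0.trans hu.1, hu.2⟩).continuousAt.continuousWithinAt)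
    (fun u hu => by
      rw [interior_Icc] at hu
      exact (hder u ⟨hs0.trans hu.1.le, hu.2.le⟩).differentiableAt.differentiableWithinAt)
    (fun u hu => by
      rw [interior_Icc] at hu
      have hu' : u ∈ Icc 0 (π / 6) := ⟨hs0.trans hu.1.le, hu.2.le⟩
      rw [(hder u hu').deriv]
      have hsu := hsin u hu'
      have hcu : 0 < Real.cos u := Real.cos_pos_of_mem_Ioo ⟨by linarith [hu'.1], by linarith [hu'.2]⟩
      have h1 : 0 < k ^ 2 - Real.sin u ^ 2 := by nlinarith
      have e1 : 1 - (Real.sin u / k) ^ 2 = (k ^ 2 - Real.sin u ^ 2) / k ^ 2 := by field_simp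
      rw [e1, Real.sqrt_div h1.le, Real.sqrt_sq hk0.le]
      have h2 : 0 < √(k ^ 2 - Real.sin u ^ 2) := Real.sqrt_pos.2 h1
      rw [show 1 / (√(k ^ 2 - Real.sin u ^ 2) / k) * (Real.cos u / k) = Real.cos u / √(k ^ 2 - Real.sin u ^ 2) by field_simp]
      rw [le_div_iff₀ h2]
      apply le_of_sq_le_sq _ hcu.le
      rw [mul_pow, Real.sq_sqrt h1.le]
      have c1 := Real.sin_sq_add_cos_sq u
      have c2 := Real.sin_sq_add_cos_sq s
      have hmono : Real.sin s ^ 2 ≤ Real.sin u ^ 2 := by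
        apply pow_le_pow_left₀ (hsin s ⟨hs0, hs⟩).1
        exact Real.sin_le_sin_of_le_of_le_pi_div_two (by linarith) (by linarith [hu'.2]) hu.1.le
      rcases le_total q 1 with hq1 | hq1
      · have : q ^ 2 ≤ 1 := by nlinarith
        nlinarith
      · have : 1 ≤ q ^ 2 := by nlinarith
        nlinarith)
    s ⟨le_rfl, hs⟩ (π / 6) ⟨hs, le_rfl⟩ hs
  simp only [Real.sin_pi_div_six] at key
  rw [show 1 / (2 * k) = 1 / 2 / k by field_simp]
  exact key

/-- half angle at the vertices of the regular triangle -/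
def beta0 (D : ℝ) : ℝ := Real.arcsin (1 / (2 * Real.cos (D / 2)))

lemma k_facts {D : ℝ} (hD0 : 0 < D) (hD : D < π / 2) :
    1 / 2 < Real.cos (D / 2) ∧ Real.cos (D / 2) ≤ 1 ∧ 1 + Real.cos D = 2 * Real.cos (D / 2) ^ 2 ∧
    1 - Real.cos D = 2 * Real.sin (D / 2) ^ 2 ∧ Real.sin D = 2 * Real.sin (D / 2) * Real.cos (D / 2) ∧ 0 < Real.sin (D / 2) := by
  have hpi := Real.pi_pos
  have e1 := Real.cos_sq (D / 2)
  have e2 := Real.sin_sq_add_cos_sq (D / 2)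
  rw [show 2 * (D / 2) = D by ring] at e1
  refine ⟨?_, Real.cos_le_one _, by linarith, by linarith, ?_, ?_⟩
  · rw [← Real.cos_pi_div_three]
    exact Real.cos_lt_cos_of_nonneg_of_le_pi (by linarith) (by linarith) (by linarith)
  · rw [← Real.sin_two_mul]; ring_nf
  · exact Real.sin_pos_of_pos_of_lt_pi (by linarith) (by linarith)

set_option maxHeartbeats 1000000 in
lemma lowM {M L : Set (E 2)} {D : ℝ} (hD0 : 0 < D) (hD : D < π / 2) (h : Good D M L) :
    2 * π - 6 * beta0 D * (1 + Real.cos D) ≤ sig.real M := by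
  have hpi := Real.pi_pos
  obtain ⟨k1, k2, k3, k4, k5, k6⟩ := k_facts hD0 hD
  obtain ⟨c, R, C⟩ := exists_circ hD0 hD h
  have hRD := C.RD
  set k := Real.cos (D / 2) with hk
  have sck := Real.sin_sq_add_cos_sq (D / 2)
  rw [← hk] at sck
  have hk0 : 0 < k := by linarith
  rcases le_or_gt R (D / 2) with hR | hR
  · have hb := C.ball hD h (t := D / 2) (by linarith) (by linarith)
    have h1 := measureReal_mono (μ := sig) hb
    rw [sig_gball C.hc (by linarith) (by linarith), ← hk] at h1
    have h2 := calc_arcsin (k := k) (s := 0) (q := 1 / k) k1 k2 le_rfl (by linarith) (by positivity)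
      (by rw [Real.sin_zero, Real.cos_zero]; apply le_of_eq; field_simp; norm_num)
    rw [Real.sin_zero, zero_div, Real.arcsin_zero, sub_zero, sub_zero, one_div, inv_mul_le_iff₀ hk0] at h2
    have h3 : beta0 D = Real.arcsin (1 / (2 * k)) := rfl
    rw [h3, k3]
    have := mul_le_mul_of_nonneg_left h2 hk0.le
    nlinarith
  · have hR0 : 0 < R := by linarith
    have hsR : 0 < Real.sin R := Real.sin_pos_of_pos_of_lt_pi hR0 (by linarith)
    have hcR : 0 < Real.cos R := Real.cos_pos_of_mem_Ioo ⟨by linarith, by linarith⟩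
    have scR := Real.sin_sq_add_cos_sq R
    have hlt : Real.sin (D / 2) < Real.sin R := Real.sin_lt_sin_of_lt_of_le_pi_div_two (by linarith) (by linarith) hR
    obtain ⟨s, hs⟩ : ∃ s, s = Real.arccos (Real.sin (D / 2) / Real.sin R) := ⟨_, rfl⟩
    have hq0 : 0 < Real.sin (D / 2) / Real.sin R := by positivity
    have hq1 : Real.sin (D / 2) / Real.sin R < 1 := by rw [div_lt_one hsR]; exact hlt
    have hcs : Real.cos s * Real.sin R = Real.sin (D / 2) := by
      rw [hs, Real.cos_arccos (by linarith) hq1.le]; field_simp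
    have hs0 : 0 < s := by rw [hs]; exact Real.arccos_pos.2 hq1
    have hs1 : s < π / 2 := by rw [hs]; exact Real.arccos_lt_pi_div_two.2 hq0
    have hcs0 : 0 < Real.cos s := Real.cos_pos_of_mem_Ioo ⟨by linarith, by linarith⟩
    have scs := Real.sin_sq_add_cos_sq s
    have hcos2 : Real.cos (2 * s) = 2 * Real.cos s ^ 2 - 1 := Real.cos_two_mul s
    have hsin2 : Real.sin (2 * s) = 2 * Real.sin s * Real.cos s := Real.sin_two_mul s
    have hcs2 : Real.cos s ^ 2 * Real.sin R ^ 2 = Real.sin (D / 2) ^ 2 := by rw [← hcs]; ring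
    have hφ : Real.cos (2 * s) * Real.sin R ^ 2 = Real.cos R ^ 2 - Real.cos D := by
      rw [hcos2]; linear_combination 2 * hcs2 - scR - k4
    have hφ1 := (triple hD h C hR0 (by linarith : 0 < 2 * s) (by linarith) hφ).1
    have hs6 : s ≤ π / 6 := by linarith
    have hss0 : 0 < Real.sin s := Real.sin_pos_of_pos_of_lt_pi hs0 (by linarith)
    have hss1 : Real.sin s ≤ 1 / 2 := by
      rw [← Real.sin_pi_div_six]
      exact Real.sin_le_sin_of_le_of_le_pi_div_two (by linarith) (by linarith) hs6
    obtain ⟨β, hβ⟩ : ∃ β, β = Real.arcsin (Real.sin s / k) := ⟨_, rfl⟩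
    have hr1 : Real.sin s / k < 1 := by rw [div_lt_one hk0]; linarith
    have hr0 : 0 < Real.sin s / k := by positivity
    have hβ0 : 0 < β := by rw [hβ]; exact Real.arcsin_pos.2 hr0
    have hβ1 : β < π / 2 := by rw [hβ]; exact Real.arcsin_lt_pi_div_two.2 hr1
    have hsβ : Real.sin β * k = Real.sin s := by
      rw [hβ, Real.sin_arcsin (by linarith) hr1.le]; field_simp
    have hcβ0 : 0 < Real.cos β := Real.cos_pos_of_mem_Ioo ⟨by linarith, by linarith⟩
    have scβ := Real.sin_sq_add_cos_sq β
    have hkR : k ^ 2 - Real.sin s ^ 2 = Real.cos R ^ 2 * Real.cos s ^ 2 := by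
      linear_combination sck - scs - Real.cos s ^ 2 * scR + hcs2
    have hcβ : Real.cos β * k = Real.cos R * Real.cos s := by
      have : (Real.cos β * k) ^ 2 = (Real.cos R * Real.cos s) ^ 2 := by
        have e : Real.sin s ^ 2 = Real.sin β ^ 2 * k ^ 2 := by rw [← hsβ]; ring
        linear_combination hkR + k ^ 2 * scβ + e
      exact (pow_left_inj₀ (by positivity) (by positivity) (by norm_num)).1 this
    have hβc : Real.sin D * Real.cos β = Real.sin R * Real.cos R * (1 + Real.cos (2 * s)) := by
      rw [k5, hcos2]
      linear_combination 2 * Real.sin (D / 2) * hcβ - 2 * Real.cos R * Real.cos s * hcs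
    have hβs : Real.sin D * Real.sin β = Real.sin R * Real.sin (2 * s) := by
      rw [k5, hsin2]
      linear_combination 2 * Real.sin (D / 2) * hsβ - 2 * Real.sin s * hcs
    have h6 := (six hD0 hD h C hR0 (by linarith : 0 < 2 * s) (by linarith) hφ hβ0 hβ1 hβc hβs).2
    have hcr : 0 ≤ Real.cos (D - R) := Real.cos_nonneg_of_neg_pi_div_two_le_of_le (by linarith) (by linarith)
    have hprod : Real.cos (D - R) * Real.cos R ≤ k ^ 2 := by
      have e1 := Real.cos_add (D - R) R
      have e2 := Real.cos_sub (D - R) R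
      have e3 := Real.cos_le_one (D - R - R)
      rw [show D - R + R = D by ring] at e1
      linarith
    have hcalc := calc_arcsin (k := k) (s := s) (q := Real.cos (D - R) / k ^ 2) k1 k2 hs0.le hs6 (by positivity) (by
      rw [hkR, div_pow, div_mul_eq_mul_div, div_le_iff₀ (by positivity)]
      have : (Real.cos (D - R) * Real.cos R) ^ 2 ≤ (k ^ 2) ^ 2 := pow_le_pow_left₀ (by positivity) hprod 2
      have := mul_le_mul_of_nonneg_right this (sq_nonneg (Real.cos s))
      linarith)
    rw [← hβ, div_mul_eq_mul_div, div_le_iff₀ (by positivity)] at hcalc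
    have h3 : beta0 D = Real.arcsin (1 / (2 * k)) := rfl
    rw [← h3] at hcalc
    rw [k3] at h6 ⊢
    nlinarith


lemma sig_lune_zone {n₁ n₂ c : E 2} (h₁ : ‖n₁‖ = 1) (h₂ : ‖n₂‖ = 1) (hc : ‖c‖ = 1) {α i j : ℝ} (ha0 : 0 < α) (ha : α < π)
    (h : ⟪n₁, n₂⟫ = - Real.cos α) (h1c : ⟪n₁, c⟫ = 0) (h2c : ⟪n₂, c⟫ = 0) (hij : i ≤ j) (hi : -1 ≤ i) (hj : j ≤ 1) :
    sig.real {z | 0 < ⟪z, n₁⟫ ∧ 0 < ⟪z, n₂⟫ ∧ ⟪z, c⟫ ∈ Icc i j} = α * (j - i) := by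
  have hs : 0 < Real.sin α := Real.sin_pos_of_pos_of_lt_pi ha0 ha
  have sc := Real.sin_sq_add_cos_sq α
  have h11 := inner_self_us h₁
  have h22 := inner_self_us h₂
  have h' : ⟪n₂, n₁⟫ = - Real.cos α := by rw [real_inner_comm]; exact h
  obtain ⟨e, he⟩ : ∃ e, e = (Real.sin α)⁻¹ • (n₂ + Real.cos α • n₁) := ⟨_, rfl⟩
  have hF : Frame e n₁ c := by
    refine ⟨?_, h11, inner_self_us hc, ?_, ?_, h1c⟩
    · rw [he]
      simp only [inner_add_left, inner_add_right, real_inner_smul_left, real_inner_smul_right, h11, h22, h, h']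
      field_simp; linarith
    · rw [he]
      simp only [inner_add_left, real_inner_smul_left, h11, h']
      ring
    · rw [he]
      simp only [inner_add_left, real_inner_smul_left, h1c, h2c]
      ring
  have hn2 : n₂ = Real.sin α • e - Real.cos α • n₁ := by
    rw [he, smul_smul, mul_inv_cancel₀ hs.ne', one_smul]; abel
  rw [← sig_sect hF ha0 ha hij hi hj]
  congr 1
  ext z
  have : ⟪z, n₂⟫ = Real.sin α * ⟪z, e⟫ - Real.cos α * ⟪z, n₁⟫ := by
    conv_lhs => rw [hn2]
    rw [inner_sub_right, real_inner_smul_right, real_inner_smul_right]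
  simp only [sect, mem_setOf_eq, this]

structure Reg (c : ℝ) (S x y z : E 2) : Prop where
  xx : ⟪x, x⟫ = 1
  yy : ⟪y, y⟫ = 1
  zz : ⟪z, z⟫ = 1
  xy : ⟪x, y⟫ = c
  yz : ⟪y, z⟫ = c
  xz : ⟪x, z⟫ = c
  hS : S = x + y + z

lemma Reg.yx {c : ℝ} {S x y z : E 2} (h : Reg c S x y z) : ⟪y, x⟫ = c := by rw [real_inner_comm]; exact h.xy
lemma Reg.zy {c : ℝ} {S x y z : E 2} (h : Reg c S x y z) : ⟪z, y⟫ = c := by rw [real_inner_comm]; exact h.yz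
lemma Reg.zx {c : ℝ} {S x y z : E 2} (h : Reg c S x y z) : ⟪z, x⟫ = c := by rw [real_inner_comm]; exact h.xz
lemma Reg.rot {c : ℝ} {S x y z : E 2} (h : Reg c S x y z) : Reg c S y z x :=
  ⟨h.yy, h.zz, h.xx, h.yz, h.zx, h.yx, by rw [h.hS]; abel⟩

def NN (c : ℝ) (S x : E 2) : E 2 := (√((1 + c) * (1 - c) * (1 + 2 * c)))⁻¹ • ((1 + 2 * c) • x - c • S)

def gg (c : ℝ) : ℝ := (√((1 + c) * (1 - c) * (1 + 2 * c)))⁻¹ * ((1 - c) * (1 + 2 * c))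

lemma gg_pos {c : ℝ} (h0 : 0 < c) (h1 : c < 1) : 0 < gg c := by
  have : 0 < 1 - c := by linarith
  unfold gg; positivity

lemma Reg.N_self {c : ℝ} {S x y z : E 2} (h : Reg c S x y z) : ⟪x, NN c S x⟫ = gg c := by
  unfold NN gg
  rw [h.hS]
  simp only [real_inner_smul_right, inner_sub_right, inner_add_right, h.xx, h.xy, h.xz]
  ring

lemma Reg.N_y {c : ℝ} {S x y z : E 2} (h : Reg c S x y z) : ⟪y, NN c S x⟫ = 0 := by
  unfold NN
  rw [h.hS]
  simp only [real_inner_smul_right, inner_sub_right, inner_add_right, h.yx, h.yy, h.yz]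
  ring

lemma Reg.N_z {c : ℝ} {S x y z : E 2} (h : Reg c S x y z) : ⟪z, NN c S x⟫ = 0 := by
  unfold NN
  rw [h.hS]
  simp only [real_inner_smul_right, inner_sub_right, inner_add_right, h.zx, h.zy, h.zz]
  ring

lemma Reg.N_norm {c : ℝ} {S x y z : E 2} (h0 : 0 < c) (h1 : c < 1) (h : Reg c S x y z) : ‖NN c S x‖ = 1 := by
  have : 0 < 1 - c := by linarith
  have hp : 0 < (1 + c) * (1 - c) * (1 + 2 * c) := by positivity
  apply norm_one_of_inner
  unfold NN
  obtain ⟨i, hi⟩ : ∃ i, i = (√((1 + c) * (1 - c) * (1 + 2 * c)))⁻¹ := ⟨_, rfl⟩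
  have hii : i * i * ((1 + c) * (1 - c) * (1 + 2 * c)) = 1 := by
    rw [hi, ← mul_inv, Real.mul_self_sqrt hp.le, inv_mul_cancel₀ hp.ne']
  rw [← hi]
  rw [h.hS]
  simp only [real_inner_smul_right, real_inner_smul_left, inner_sub_right, inner_add_right, inner_sub_left, inner_add_left, h.xx, h.xy, h.xz,
    h.yx, h.yy, h.yz, h.zx, h.zy, h.zz]
  linear_combination hii

lemma Reg.N_N {c : ℝ} {S x y z : E 2} (h0 : 0 < c) (h1 : c < 1) (h : Reg c S x y z) : ⟪NN c S x, NN c S y⟫ = - (c / (1 + c)) := by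
  have : 0 < 1 - c := by linarith
  have hp : 0 < (1 + c) * (1 - c) * (1 + 2 * c) := by positivity
  unfold NN
  obtain ⟨i, hi⟩ : ∃ i, i = (√((1 + c) * (1 - c) * (1 + 2 * c)))⁻¹ := ⟨_, rfl⟩
  have hii : i * i * ((1 + c) * (1 - c) * (1 + 2 * c)) = 1 := by
    rw [hi, ← mul_inv, Real.mul_self_sqrt hp.le, inv_mul_cancel₀ hp.ne']
  rw [← hi]
  rw [h.hS]
  simp only [real_inner_smul_right, real_inner_smul_left, inner_sub_right, inner_add_right, inner_sub_left, inner_add_left, h.xx, h.xy, h.xz,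
    h.yx, h.yy, h.yz, h.zx, h.zy, h.zz]
  rw [← neg_div, eq_div_iff (by positivity)]
  linear_combination (-c) * hii

lemma Reg.decomp {c : ℝ} {S x y z : E 2} (h0 : 0 < c) (h1 : c < 1) (h : Reg c S x y z) (v : E 2) :
    gg c • v = ⟪v, NN c S x⟫ • x + ⟪v, NN c S y⟫ • y + ⟪v, NN c S z⟫ • z := by
  have hg := gg_pos h0 h1
  have hy := h.rot
  have hz := h.rot.rot
  have hLI : LinearIndependent ℝ ![x, y, z] := by
    rw [Fintype.linearIndependent_iff]
    intro g hg0
    simp only [Fin.sum_univ_three, Matrix.cons_val_zero, Matrix.cons_val_one, Matrix.cons_val_two, Matrix.head_cons, Matrix.tail_cons,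
      Matrix.cons_val] at hg0
    have k : ∀ u : E 2, g 0 * ⟪x, u⟫ + g 1 * ⟪y, u⟫ + g 2 * ⟪z, u⟫ = 0 := by
      intro u
      rw [← real_inner_smul_left, ← real_inner_smul_left, ← real_inner_smul_left, ← inner_add_left, ← inner_add_left, hg0, inner_zero_left]
    have k1 := k (NN c S x)
    have k2 := k (NN c S y)
    have k3 := k (NN c S z)
    rw [h.N_self, h.N_y, h.N_z] at k1
    rw [hy.N_self, hy.N_y, hy.N_z] at k2
    rw [hz.N_self, hz.N_y, hz.N_z] at k3
    have j1 : g 0 = 0 := by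
      have : g 0 * gg c = 0 := by linarith
      exact (mul_eq_zero.1 this).resolve_right hg.ne'
    have j2 : g 1 = 0 := by
      have : g 1 * gg c = 0 := by linarith
      exact (mul_eq_zero.1 this).resolve_right hg.ne'
    have j3 : g 2 = 0 := by
      have : g 2 * gg c = 0 := by linarith
      exact (mul_eq_zero.1 this).resolve_right hg.ne'
    intro i; fin_cases i <;> assumption
  have hsp := hLI.span_eq_top_of_card_eq_finrank' (by simp)
  have hv : v ∈ Submodule.span ℝ (Set.range ![x, y, z]) := by rw [hsp]; trivial
  rw [Submodule.mem_span_range_iff_exists_fun] at hv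
  obtain ⟨a, ha⟩ := hv
  simp only [Fin.sum_univ_three, Matrix.cons_val_zero, Matrix.cons_val_one, Matrix.cons_val_two, Matrix.head_cons, Matrix.tail_cons,
      Matrix.cons_val] at ha
  rw [← ha]
  simp only [inner_add_left, real_inner_smul_left, h.N_self, h.N_y, h.N_z, hy.N_self, hy.N_y, hy.N_z, hz.N_self, hz.N_y, hz.N_z]
  module

lemma beta0_facts {D : ℝ} (hD0 : 0 < D) (hD : D < π / 2) : 0 < beta0 D ∧ 2 * beta0 D < π ∧
    Real.cos (2 * beta0 D) = Real.cos D / (1 + Real.cos D) := by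
  obtain ⟨k1, k2, k3, k4, k5, k6⟩ := k_facts hD0 hD
  have hpos : 0 < 1 / (2 * Real.cos (D / 2)) := by
    have : 0 < Real.cos (D / 2) := by linarith
    positivity
  have hlt : 1 / (2 * Real.cos (D / 2)) < 1 := by rw [div_lt_one (by linarith)]; linarith
  refine ⟨Real.arcsin_pos.2 hpos, ?_, ?_⟩
  · have := Real.arcsin_lt_pi_div_two.2 hlt
    unfold beta0; linarith
  · rw [Real.cos_two_mul, Real.cos_sq']
    unfold beta0
    rw [Real.sin_arcsin (by linarith) hlt.le, k3]
    have : 0 < Real.cos (D / 2) := by linarith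
    have e : Real.cos D = 2 * Real.cos (D / 2) ^ 2 - 1 := by linarith
    rw [e]
    field_simp
    ring

set_option maxHeartbeats 1000000 in
/-- the vertical region at a vertex -/
lemma vertical {D : ℝ} (hD0 : 0 < D) (hD : D < π / 2) {S x y z v : E 2} (h : Reg (Real.cos D) S x y z) (hv : ‖v‖ = 1)
    (hW : ∀ u : E 2, ‖u‖ = 1 → Real.cos D ≤ ⟪u, x⟫ → Real.cos D ≤ ⟪u, y⟫ → Real.cos D ≤ ⟪u, z⟫ → 0 ≤ ⟪v, u⟫)
    (hy : ⟪v, NN (Real.cos D) S y⟫ < 0) (hz : ⟪v, NN (Real.cos D) S z⟫ < 0) : Real.sin D ≤ ⟪v, x⟫ := by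
  have hc0 : 0 < Real.cos D := Real.cos_pos_of_mem_Ioo ⟨by linarith, hD⟩
  have hs0 : 0 < Real.sin D := Real.sin_pos_of_pos_of_lt_pi hD0 (by linarith [Real.pi_pos])
  have sc := Real.sin_sq_add_cos_sq D
  have hc1 : Real.cos D < 1 := by nlinarith
  have hg := gg_pos hc0 hc1
  have hd := h.decomp hc0 hc1 v
  set c := Real.cos D with hcdef
  obtain ⟨a, ha⟩ : ∃ a, a = -⟪v, NN c S y⟫ := ⟨_, rfl⟩
  obtain ⟨b, hb⟩ : ∃ b, b = -⟪v, NN c S z⟫ := ⟨_, rfl⟩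
  have ha0 : 0 < a := by linarith
  have hb0 : 0 < b := by linarith
  -- P = a (y - c x) + b (z - c x)
  obtain ⟨P, hP⟩ : ∃ P, P = a • (y - c • x) + b • (z - c • x) := ⟨_, rfl⟩
  have xP : ⟪x, P⟫ = 0 := by
    rw [hP]; simp only [inner_add_right, inner_sub_right, real_inner_smul_right, h.xx, h.xy, h.xz]; ring
  have Px : ⟪P, x⟫ = 0 := by rw [real_inner_comm]; exact xP
  have Py : ⟪P, y⟫ = a * (1 - c ^ 2) + b * (c * (1 - c)) := by
    rw [hP]; simp only [inner_add_left, inner_sub_left, real_inner_smul_left, h.xy, h.yy, h.zy]; ring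
  have Pz : ⟪P, z⟫ = a * (c * (1 - c)) + b * (1 - c ^ 2) := by
    rw [hP]; simp only [inner_add_left, inner_sub_left, real_inner_smul_left, h.xz, h.yz, h.zz]; ring
  have PP : ⟪P, P⟫ = (a ^ 2 + b ^ 2) * (1 - c ^ 2) + 2 * a * b * (c * (1 - c)) := by
    have : ⟪P, P⟫ = a * ⟪P, y⟫ + b * ⟪P, z⟫ - (a + b) * c * ⟪P, x⟫ := by
      have e : ⟪P, a • (y - c • x) + b • (z - c • x)⟫ = a * ⟪P, y⟫ + b * ⟪P, z⟫ - (a + b) * c * ⟪P, x⟫ := by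
        simp only [inner_add_right, inner_sub_right, real_inner_smul_right]
        ring
      rw [← hP] at e; exact e
    rw [this, Px, Py, Pz]; ring
  have hvP : gg c • v = (gg c * ⟪v, x⟫) • x - P := by
    have e1 : gg c * ⟪v, x⟫ = ⟪v, NN c S x⟫ - a * c - b * c := by
      rw [← real_inner_smul_left, hd]
      simp only [inner_add_left, real_inner_smul_left, h.xx, h.yx, h.zx, ha, hb]; ring
    rw [e1, hd, hP, ha, hb]; module
  have hPn : ‖P‖ ^ 2 = (a ^ 2 + b ^ 2) * (1 - c ^ 2) + 2 * a * b * (c * (1 - c)) := by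
    rw [← real_inner_self_eq_norm_sq]; exact PP
  have h1c : 0 < 1 - c := by linarith
  have h1c2 : 0 < 1 - c ^ 2 := by nlinarith
  have hP0 : 0 < ‖P‖ := by
    apply lt_of_le_of_ne (norm_nonneg _)
    intro hh; rw [← hh] at hPn
    have : 0 < (a ^ 2 + b ^ 2) * (1 - c ^ 2) + 2 * a * b * (c * (1 - c)) := by positivity
    rw [← hPn] at this; norm_num at this
  have hPle : ‖P‖ ≤ Real.sin D * (a + b) := by
    apply le_of_sq_le_sq _ (by positivity)
    rw [hPn, mul_pow]
    have : Real.sin D ^ 2 = 1 - c ^ 2 := by linarith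
    rw [this]
    nlinarith [mul_pos ha0 hb0, mul_pos (mul_pos ha0 hb0) h1c]
  -- the test direction
  have hun : ‖c • x + (Real.sin D * ‖P‖⁻¹) • P‖ = 1 := by
    apply norm_one_of_inner
    simp only [inner_add_left, inner_add_right, real_inner_smul_left, real_inner_smul_right, h.xx, xP, Px, real_inner_self_eq_norm_sq P]
    field_simp
    linear_combination ‖P‖ * sc
  have key := hW (c • x + (Real.sin D * ‖P‖⁻¹) • P) hun
    (by rw [inner_add_left, real_inner_smul_left, real_inner_smul_left, h.xx, Px]; linarith)
    (by
      rw [inner_add_left, real_inner_smul_left, real_inner_smul_left, h.xy, Py]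
      have : c * (1 - c) ≤ Real.sin D * ‖P‖⁻¹ * (a * (1 - c ^ 2) + b * (c * (1 - c))) := by
        rw [mul_assoc, ← div_eq_inv_mul, ← mul_div_assoc, le_div_iff₀ hP0]
        calc c * (1 - c) * ‖P‖ ≤ c * (1 - c) * (Real.sin D * (a + b)) := by gcongr
          _ = Real.sin D * (a * (c * (1 - c)) + b * (c * (1 - c))) := by ring
          _ ≤ _ := by
            gcongr
            nlinarith
      nlinarith)
    (by
      rw [inner_add_left, real_inner_smul_left, real_inner_smul_left, h.xz, Pz]
      have : c * (1 - c) ≤ Real.sin D * ‖P‖⁻¹ * (a * (c * (1 - c)) + b * (1 - c ^ 2)) := by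
        rw [mul_assoc, ← div_eq_inv_mul, ← mul_div_assoc, le_div_iff₀ hP0]
        calc c * (1 - c) * ‖P‖ ≤ c * (1 - c) * (Real.sin D * (a + b)) := by gcongr
          _ = Real.sin D * (a * (c * (1 - c)) + b * (c * (1 - c))) := by ring
          _ ≤ _ := by
            gcongr
            nlinarith
      nlinarith)
  have k1 : 0 ≤ gg c * ⟪v, c • x + (Real.sin D * ‖P‖⁻¹) • P⟫ := mul_nonneg hg.le key
  rw [← real_inner_smul_left, hvP] at k1
  simp only [inner_sub_left, inner_add_right, real_inner_smul_left, real_inner_smul_right, h.xx, xP, Px, real_inner_self_eq_norm_sq P] at k1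
  have k2 : Real.sin D * ‖P‖ ≤ c * (gg c * ⟪v, x⟫) := by
    have : Real.sin D * ‖P‖⁻¹ * ‖P‖ ^ 2 = Real.sin D * ‖P‖ := by field_simp
    linarith
  have hnv : gg c ^ 2 = (gg c * ⟪v, x⟫) ^ 2 + ‖P‖ ^ 2 := by
    have e1 : ⟪gg c • v, gg c • v⟫ = gg c ^ 2 := by
      rw [real_inner_smul_left, real_inner_smul_right, inner_self_us hv]; ring
    rw [← e1, hvP]
    simp only [inner_sub_left, inner_sub_right, real_inner_smul_left, real_inner_smul_right, h.xx, xP, Px, real_inner_self_eq_norm_sq P]; ring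
  have hq0 : 0 < gg c * ⟪v, x⟫ := by
    have : 0 < c * (gg c * ⟪v, x⟫) := lt_of_lt_of_le (by positivity) k2
    exact pos_of_mul_pos_right this hc0.le
  have k3 : (Real.sin D * ‖P‖) ^ 2 ≤ (c * (gg c * ⟪v, x⟫)) ^ 2 := pow_le_pow_left₀ (by positivity) k2 2
  have k4 : (Real.sin D * gg c) ^ 2 ≤ (gg c * ⟪v, x⟫) ^ 2 := by
    generalize gg c * ⟪v, x⟫ = q at *
    have e1 : q ^ 2 = Real.sin D ^ 2 * q ^ 2 + c ^ 2 * q ^ 2 := by linear_combination (-q ^ 2) * sc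
    rw [mul_pow, mul_pow] at k3
    rw [mul_pow, hnv]
    linarith
  have k5 := le_of_sq_le_sq k4 hq0.le
  rw [mul_comm] at k5
  exact le_of_mul_le_mul_left k5 hg


def WW (c : ℝ) (x y z : E 2) : Set (E 2) :=
  {v ∈ unitSphere 2 | ∀ u : E 2, ‖u‖ = 1 → c ≤ ⟪u, x⟫ → c ≤ ⟪u, y⟫ → c ≤ ⟪u, z⟫ → 0 ≤ ⟪v, u⟫}

lemma meas_WW (c : ℝ) (x y z : E 2) : MeasurableSet (WW c x y z) := by
  apply IsClosed.measurableSet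
  have : WW c x y z = unitSphere 2 ∩ ⋂ u ∈ {u : E 2 | ‖u‖ = 1 ∧ c ≤ ⟪u, x⟫ ∧ c ≤ ⟪u, y⟫ ∧ c ≤ ⟪u, z⟫}, {v : E 2 | 0 ≤ ⟪v, u⟫} := by
    ext v
    simp only [WW, mem_setOf_eq, mem_inter_iff, mem_iInter, and_congr_right_iff]
    intro _
    constructor
    · rintro h u ⟨h1, h2, h3, h4⟩; exact h u h1 h2 h3 h4
    · intro h u h1 h2 h3 h4; exact h u ⟨h1, h2, h3, h4⟩
  rw [this]
  apply IsClosed.inter Metric.isClosed_sphere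
  apply isClosed_biInter
  intro u _
  exact isClosed_le continuous_const (by fun_prop)

lemma hemi_sconvex (u g : E 2) (hg : ‖g‖ = 1) : SConvex {z ∈ unitSphere 2 | 0 ≤ ⟪u, z⟫ ∧ 0 < ⟪g, z⟫} := by
  refine ⟨fun z hz => hz.1, ⟨g, mem_us.2 hg, fun z hz => hz.2.2⟩, ?_⟩
  rintro p ⟨hp, hp1, hp2⟩ q ⟨hq, hq1, hq2⟩ z hz
  have hne : p ≠ -q := by
    rintro rfl
    rw [inner_neg_right] at hp2; linarith
  obtain ⟨a, b, ha, hb, rfl⟩ := seg_sub_cone (mem_us.1 hp) (mem_us.1 hq) hne hz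
  refine ⟨hz.1, ?_, ?_⟩
  · rw [inner_add_right, real_inner_smul_right, real_inner_smul_right]; positivity
  · rw [inner_add_right, real_inner_smul_right, real_inner_smul_right]
    rcases ha.lt_or_eq with h | h
    · positivity
    · rcases hb.lt_or_eq with h' | h'
      · positivity
      · exfalso
        have := mem_us.1 hz.1
        rw [← h, ← h'] at this
        simp at this

lemma Reg.xn {c : ℝ} {S x y z : E 2} (h : Reg c S x y z) : ‖x‖ = 1 := norm_one_of_inner h.xx

lemma Reg.center {c : ℝ} {S x y z : E 2} (h0 : 0 < c) (h1 : c < 1) (h : Reg c S x y z) : c < ⟪nrm S, x⟫ ∧ ‖nrm S‖ = 1 := by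
  have hSx : ⟪S, x⟫ = 1 + 2 * c := by
    rw [h.hS]; simp only [inner_add_left, h.xx, h.yx, h.zx]; ring
  have hSS : ‖S‖ ^ 2 = 3 * (1 + 2 * c) := by
    rw [← real_inner_self_eq_norm_sq, h.hS]
    simp only [inner_add_left, inner_add_right, h.xx, h.xy, h.xz, h.yx, h.yy, h.yz, h.zx, h.zy, h.zz]; ring
  have hS0 : S ≠ 0 := by
    rintro rfl
    simp at hSS; linarith
  have hn : 0 < ‖S‖ := norm_pos_iff.2 hS0
  refine ⟨?_, norm_nrm hS0⟩
  unfold nrm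
  rw [real_inner_smul_left, hSx, ← div_eq_inv_mul, lt_div_iff₀ hn]
  apply lt_of_pow_lt_pow_left₀ 2 (by positivity)
  rw [mul_pow, hSS]
  have : 0 < (1 + 2 * c) * ((1 - c) * (1 + 3 * c)) := by
    have : 0 < 1 - c := by linarith
    positivity
  nlinarith

lemma ball_sub_hemi {D : ℝ} (hD0 : 0 < D) (hD : D < π / 2) {S x y z u : E 2} (h : Reg (Real.cos D) S x y z) (hu : ‖u‖ = 1)
    (hux : Real.cos D ≤ ⟪u, x⟫) : gball x (π / 2 - D) ⊆ {z ∈ unitSphere 2 | 0 ≤ ⟪u, z⟫ ∧ 0 < ⟪nrm S, z⟫} := by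
  have hc0 : 0 < Real.cos D := Real.cos_pos_of_mem_Ioo ⟨by linarith, hD⟩
  have hs0 : 0 < Real.sin D := Real.sin_pos_of_pos_of_lt_pi hD0 (by linarith [Real.pi_pos])
  have sc := Real.sin_sq_add_cos_sq D
  have hc1 : Real.cos D < 1 := by nlinarith
  obtain ⟨g1, g2⟩ := h.center hc0 hc1
  rintro v ⟨hv, hv2⟩
  have hv1 := mem_us.1 hv
  refine ⟨hv, ?_, ?_⟩
  · have := gdist_tri hu h.xn hv1
    have h2 := (gdist_le_iff hu h.xn hD0.le (by linarith)).2 hux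
    have h3 := (gdist_le_iff hu hv1 (t := π / 2) (by linarith) (by linarith)).1 (by linarith)
    rwa [Real.cos_pi_div_two] at h3
  · have := gdist_tri g2 h.xn hv1
    have h2 : gdist (nrm S) x < D := by
      have h3 := (gdist_le_iff g2 h.xn hD0.le (by linarith)).2 g1.le
      apply lt_of_le_of_ne h3
      intro h4
      unfold gdist at h4
      have : Real.cos (Real.arccos ⟪nrm S, x⟫) = Real.cos D := by rw [h4]
      rw [Real.cos_arccos (neg_one_le_inner' g2 h.xn) (inner_le_one' g2 h.xn)] at this
      linarith
    have h5 : gdist (nrm S) v < π / 2 := by linarith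
    exact Real.arccos_lt_pi_div_two.1 h5

lemma polarReuleaux_sub {D : ℝ} (hD0 : 0 < D) (hD : D < π / 2) {S x y z : E 2} (h : Reg (Real.cos D) S x y z) {w : ℝ} (hw : w = π - D) :
    polarReuleaux x y z w ⊆ WW (Real.cos D) x y z := by
  have e : w - π / 2 = π / 2 - D := by rw [hw]; ring
  have hc0 : 0 < Real.cos D := Real.cos_pos_of_mem_Ioo ⟨by linarith, hD⟩
  have hs0 : 0 < Real.sin D := Real.sin_pos_of_pos_of_lt_pi hD0 (by linarith [Real.pi_pos])
  have sc := Real.sin_sq_add_cos_sq D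
  have hc1 : Real.cos D < 1 := by nlinarith
  intro v hv
  have key : ∀ u : E 2, ‖u‖ = 1 → Real.cos D ≤ ⟪u, x⟫ → Real.cos D ≤ ⟪u, y⟫ → Real.cos D ≤ ⟪u, z⟫ →
      v ∈ {z ∈ unitSphere 2 | 0 ≤ ⟪u, z⟫ ∧ 0 < ⟪nrm S, z⟫} := by
    intro u hu h1 h2 h3
    apply hv
    refine ⟨hemi_sconvex u _ (h.center hc0 hc1).2, ?_⟩
    rw [e]
    exact union_subset (union_subset (ball_sub_hemi hD0 hD h hu h1) (ball_sub_hemi hD0 hD h.rot hu h2))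
      (ball_sub_hemi hD0 hD h.rot.rot hu h3)
  refine ⟨(key x h.xn (by rw [h.xx]; exact hc1.le) h.xy.ge h.xz.ge).1, ?_⟩
  intro u hu h1 h2 h3
  rw [real_inner_comm]
  exact (key u hu h1 h2 h3).2.1

def zoneA (c : ℝ) (S x y z : E 2) : Set (E 2) :=
  {v | 0 < ⟪v, NN c S y⟫ ∧ 0 < ⟪v, NN c S z⟫ ∧ ⟪v, x⟫ ∈ Icc (0 : ℝ) 1} ∩ unitSphere 2

def zoneB (c s : ℝ) (S x y z : E 2) : Set (E 2) :=
  {v | 0 < ⟪v, -NN c S y⟫ ∧ 0 < ⟪v, -NN c S z⟫ ∧ ⟪v, x⟫ ∈ Icc s 1}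

def zoneZ (c : ℝ) (S x : E 2) : Set (E 2) := {v | ⟪v, NN c S x⟫ ∈ Icc (0 : ℝ) 0}

lemma sig_zoneZ {c : ℝ} {S x y z : E 2} (h0 : 0 < c) (h1 : c < 1) (h : Reg c S x y z) : sig.real (zoneZ c S x) = 0 := by
  unfold zoneZ
  rw [sig_zone (h.N_norm h0 h1) le_rfl (by norm_num) (by norm_num)]; ring

lemma sig_zoneB {D : ℝ} (hD0 : 0 < D) (hD : D < π / 2) {S x y z : E 2} (h : Reg (Real.cos D) S x y z) (h0 : 0 < Real.cos D)
    (h1 : Real.cos D < 1) : sig.real (zoneB (Real.cos D) (Real.sin D) S x y z) = 2 * beta0 D * (1 - Real.sin D) := by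
  obtain ⟨b1, b2, b3⟩ := beta0_facts hD0 hD
  have hs0 : 0 < Real.sin D := Real.sin_pos_of_pos_of_lt_pi hD0 (by linarith [Real.pi_pos])
  unfold zoneB
  apply sig_lune_zone
  · rw [norm_neg]; exact h.rot.N_norm h0 h1
  · rw [norm_neg]; exact h.rot.rot.N_norm h0 h1
  · exact h.xn
  · linarith
  · exact b2
  · rw [inner_neg_left, inner_neg_right, neg_neg, h.rot.N_N h0 h1, b3]
  · rw [inner_neg_left, real_inner_comm, h.rot.N_z, neg_zero]
  · rw [inner_neg_left, real_inner_comm, h.rot.rot.N_y, neg_zero]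
  · exact Real.sin_le_one D
  · linarith
  · exact le_rfl

lemma sig_T {D : ℝ} (hD0 : 0 < D) (hD : D < π / 2) {S x y z : E 2} (h : Reg (Real.cos D) S x y z) (h0 : 0 < Real.cos D)
    (h1 : Real.cos D < 1) : sig.real (tri (NN (Real.cos D) S x) (NN (Real.cos D) S y) (NN (Real.cos D) S z)) = 6 * beta0 D - π := by
  obtain ⟨b1, b2, b3⟩ := beta0_facts hD0 hD
  have hI : 2 * beta0 D ∈ Ioo 0 π := ⟨by linarith, b2⟩
  rw [girard (h.N_norm h0 h1) (h.rot.N_norm h0 h1) (h.rot.rot.N_norm h0 h1) hI hI hI (by rw [h.N_N h0 h1, b3])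
    (by rw [real_inner_comm, h.rot.rot.N_N h0 h1, b3]) (by rw [h.rot.N_N h0 h1, b3])]
  ring

lemma sig_zoneA {D : ℝ} (hD0 : 0 < D) (hD : D < π / 2) {S x y z : E 2} (h : Reg (Real.cos D) S x y z) (h0 : 0 < Real.cos D)
    (h1 : Real.cos D < 1) : sig.real (zoneA (Real.cos D) S x y z \ 
      (tri (NN (Real.cos D) S x) (NN (Real.cos D) S y) (NN (Real.cos D) S z) ∩ unitSphere 2)) = π - 4 * beta0 D := by
  obtain ⟨b1, b2, b3⟩ := beta0_facts hD0 hD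
  have e : sig.real (zoneA (Real.cos D) S x y z) = 2 * beta0 D * (1 - 0) := by
    unfold zoneA
    rw [sig_inter_us]
    apply sig_lune_zone
    · exact h.rot.N_norm h0 h1
    · exact h.rot.rot.N_norm h0 h1
    · exact h.xn
    · linarith
    · exact b2
    · rw [h.rot.N_N h0 h1, b3]
    · rw [real_inner_comm, h.rot.N_z]
    · rw [real_inner_comm, h.rot.rot.N_y]
    · exact zero_le_one
    · norm_num
    · exact le_rfl
  rw [measureReal_diff _ ((meas_tri _ _ _).inter measurable_us), e, sig_inter_us, sig_T hD0 hD h h0 h1]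
  · ring
  · rintro v ⟨⟨v1, v2, v3⟩, hv⟩
    have hd := h.decomp h0 h1 v
    refine ⟨⟨v2, v3, ?_, inner_le_one' (mem_us.1 hv) h.xn⟩, hv⟩
    have : 0 < gg (Real.cos D) * ⟪v, x⟫ := by
      rw [← real_inner_smul_left, hd]
      simp only [inner_add_left, real_inner_smul_left, h.xx, h.yx, h.zx]
      positivity
    exact (pos_of_mul_pos_right this (gg_pos h0 h1).le).le

set_option maxHeartbeats 1000000 in
lemma sig_WW {D : ℝ} (hD0 : 0 < D) (hD : D < π / 2) {S x y z : E 2} (h : Reg (Real.cos D) S x y z) :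
    sig.real (WW (Real.cos D) x y z) ≤ 2 * π - 6 * beta0 D * Real.sin D := by
  have hc0 : 0 < Real.cos D := Real.cos_pos_of_mem_Ioo ⟨by linarith, hD⟩
  have hs0 : 0 < Real.sin D := Real.sin_pos_of_pos_of_lt_pi hD0 (by linarith [Real.pi_pos])
  have sc := Real.sin_sq_add_cos_sq D
  have hc1 : Real.cos D < 1 := by nlinarith
  have hg := gg_pos hc0 hc1
  have t1 := sig_T hD0 hD h hc0 hc1
  have a1 := sig_zoneA hD0 hD h hc0 hc1
  have a2 := sig_zoneA hD0 hD h.rot hc0 hc1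
  have a3 := sig_zoneA hD0 hD h.rot.rot hc0 hc1
  have b1 := sig_zoneB hD0 hD h hc0 hc1
  have b2 := sig_zoneB hD0 hD h.rot hc0 hc1
  have b3 := sig_zoneB hD0 hD h.rot.rot hc0 hc1
  have z1 := sig_zoneZ hc0 hc1 h
  have z2 := sig_zoneZ hc0 hc1 h.rot
  have z3 := sig_zoneZ hc0 hc1 h.rot.rot
  revert t1 a1 a2 a3 b1 b2 b3 z1 z2 z3
  set c := Real.cos D with hc
  set s := Real.sin D with hs
  set T := tri (NN c S x) (NN c S y) (NN c S z) with hT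
  set A1 := zoneA c S x y z \ (tri (NN c S x) (NN c S y) (NN c S z) ∩ unitSphere 2) with hA1
  set A2 := zoneA c S y z x \ (tri (NN c S y) (NN c S z) (NN c S x) ∩ unitSphere 2) with hA2
  set A3 := zoneA c S z x y \ (tri (NN c S z) (NN c S x) (NN c S y) ∩ unitSphere 2) with hA3
  set B1 := zoneB c s S x y z with hB1
  set B2 := zoneB c s S y z x with hB2
  set B3 := zoneB c s S z x y with hB3
  set Z1 := zoneZ c S x with hZ1
  set Z2 := zoneZ c S y with hZ2
  set Z3 := zoneZ c S z with hZ3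
  intro t1 a1 a2 a3 b1 b2 b3 z1 z2 z3
  have hsub : WW c x y z ⊆ T ∪ (A1 ∪ (A2 ∪ (A3 ∪ (B1 ∪ (B2 ∪ (B3 ∪ (Z1 ∪ (Z2 ∪ Z3)))))))) := by
    rintro v ⟨hv, hW⟩
    have hv1 := mem_us.1 hv
    have hx0 : 0 ≤ ⟪v, x⟫ := hW x h.xn (by rw [h.xx]; exact hc1.le) h.xy.ge h.xz.ge
    have hy0 : 0 ≤ ⟪v, y⟫ := hW y h.rot.xn h.yx.ge (by rw [h.yy]; exact hc1.le) h.yz.ge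
    have hz0 : 0 ≤ ⟪v, z⟫ := hW z h.rot.rot.xn h.zx.ge h.zy.ge (by rw [h.zz]; exact hc1.le)
    have hx1 : ⟪v, x⟫ ≤ 1 := inner_le_one' hv1 h.xn
    have hy1 : ⟪v, y⟫ ≤ 1 := inner_le_one' hv1 h.rot.xn
    have hz1 : ⟪v, z⟫ ≤ 1 := inner_le_one' hv1 h.rot.rot.xn
    have vx := fun p q => vertical hD0 hD h hv1 hW p q
    have vy := fun p q => vertical hD0 hD h.rot hv1 (fun u q1 q2 q3 q4 => hW u q1 q4 q2 q3) p q
    have vz := fun p q => vertical hD0 hD h.rot.rot hv1 (fun u q1 q2 q3 q4 => hW u q1 q3 q4 q2) p q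
    have hd : gg c * ⟪v, x⟫ = ⟪v, NN c S x⟫ + ⟪v, NN c S y⟫ * c + ⟪v, NN c S z⟫ * c := by
      rw [← real_inner_smul_left, h.decomp hc0 hc1 v]
      simp only [inner_add_left, real_inner_smul_left, h.xx, h.yx, h.zx]; ring
    rcases lt_trichotomy 0 ⟪v, NN c S x⟫ with p1 | p1 | p1
    · rcases lt_trichotomy 0 ⟪v, NN c S y⟫ with p2 | p2 | p2
      · rcases lt_trichotomy 0 ⟪v, NN c S z⟫ with p3 | p3 | p3
        · exact Or.inl ⟨p1, p2, p3⟩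
        · have : v ∈ Z3 := ⟨p3.le, p3.ge⟩
          exact Or.inr (Or.inr (Or.inr (Or.inr (Or.inr (Or.inr (Or.inr (Or.inr (Or.inr this))))))))
        · have : v ∈ A3 := ⟨⟨⟨p1, p2, hz0, hz1⟩, hv⟩, fun hh => absurd hh.1.1 (not_lt.2 p3.le)⟩
          exact Or.inr (Or.inr (Or.inr (Or.inl this)))
      · have : v ∈ Z2 := ⟨p2.le, p2.ge⟩
        exact Or.inr (Or.inr (Or.inr (Or.inr (Or.inr (Or.inr (Or.inr (Or.inr (Or.inl this))))))))
      · rcases lt_trichotomy 0 ⟪v, NN c S z⟫ with p3 | p3 | p3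
        · have : v ∈ A2 := ⟨⟨⟨p3, p1, hy0, hy1⟩, hv⟩, fun hh => absurd hh.1.1 (not_lt.2 p2.le)⟩
          exact Or.inr (Or.inr (Or.inl this))
        · have : v ∈ Z3 := ⟨p3.le, p3.ge⟩
          exact Or.inr (Or.inr (Or.inr (Or.inr (Or.inr (Or.inr (Or.inr (Or.inr (Or.inr this))))))))
        · have : v ∈ B1 := by
            refine ⟨?_, ?_, vx p2 p3, hx1⟩ <;> rw [inner_neg_right] <;> linarith
          exact Or.inr (Or.inr (Or.inr (Or.inr (Or.inl this))))
    · have : v ∈ Z1 := ⟨p1.le, p1.ge⟩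
      exact Or.inr (Or.inr (Or.inr (Or.inr (Or.inr (Or.inr (Or.inr (Or.inl this)))))))
    · rcases lt_trichotomy 0 ⟪v, NN c S y⟫ with p2 | p2 | p2
      · rcases lt_trichotomy 0 ⟪v, NN c S z⟫ with p3 | p3 | p3
        · have : v ∈ A1 := ⟨⟨⟨p2, p3, hx0, hx1⟩, hv⟩, fun hh => absurd hh.1.1 (not_lt.2 p1.le)⟩
          exact Or.inr (Or.inl this)
        · have : v ∈ Z3 := ⟨p3.le, p3.ge⟩
          exact Or.inr (Or.inr (Or.inr (Or.inr (Or.inr (Or.inr (Or.inr (Or.inr (Or.inr this))))))))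
        · have : v ∈ B2 := by
            refine ⟨?_, ?_, vy p3 p1, hy1⟩ <;> rw [inner_neg_right] <;> linarith
          exact Or.inr (Or.inr (Or.inr (Or.inr (Or.inr (Or.inl this)))))
      · have : v ∈ Z2 := ⟨p2.le, p2.ge⟩
        exact Or.inr (Or.inr (Or.inr (Or.inr (Or.inr (Or.inr (Or.inr (Or.inr (Or.inl this))))))))
      · rcases lt_trichotomy 0 ⟪v, NN c S z⟫ with p3 | p3 | p3
        · have : v ∈ B3 := by
            refine ⟨?_, ?_, vz p1 p2, hz1⟩ <;> rw [inner_neg_right] <;> linarith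
          exact Or.inr (Or.inr (Or.inr (Or.inr (Or.inr (Or.inr (Or.inl this))))))
        · have : v ∈ Z3 := ⟨p3.le, p3.ge⟩
          exact Or.inr (Or.inr (Or.inr (Or.inr (Or.inr (Or.inr (Or.inr (Or.inr (Or.inr this))))))))
        · exfalso
          have : 0 ≤ gg c * ⟪v, x⟫ := mul_nonneg hg.le hx0
          nlinarith [mul_neg_of_neg_of_pos p2 hc0, mul_neg_of_neg_of_pos p3 hc0]
  have m := measureReal_mono hsub (μ := sig)
  have m1 := measureReal_union_le (μ := sig) T (A1 ∪ (A2 ∪ (A3 ∪ (B1 ∪ (B2 ∪ (B3 ∪ (Z1 ∪ (Z2 ∪ Z3))))))))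
  have m2 := measureReal_union_le (μ := sig) A1 (A2 ∪ (A3 ∪ (B1 ∪ (B2 ∪ (B3 ∪ (Z1 ∪ (Z2 ∪ Z3)))))))
  have m3 := measureReal_union_le (μ := sig) A2 (A3 ∪ (B1 ∪ (B2 ∪ (B3 ∪ (Z1 ∪ (Z2 ∪ Z3))))))
  have m4 := measureReal_union_le (μ := sig) A3 (B1 ∪ (B2 ∪ (B3 ∪ (Z1 ∪ (Z2 ∪ Z3)))))
  have m5 := measureReal_union_le (μ := sig) B1 (B2 ∪ (B3 ∪ (Z1 ∪ (Z2 ∪ Z3))))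
  have m6 := measureReal_union_le (μ := sig) B2 (B3 ∪ (Z1 ∪ (Z2 ∪ Z3)))
  have m7 := measureReal_union_le (μ := sig) B3 (Z1 ∪ (Z2 ∪ Z3))
  have m8 := measureReal_union_le (μ := sig) Z1 (Z2 ∪ Z3)
  have m9 := measureReal_union_le (μ := sig) Z2 Z3
  clear_value T A1 A2 A3 B1 B2 B3 Z1 Z2 Z3
  linarith

lemma sig_L_ge {D : ℝ} (hD0 : 0 < D) (hD : D < π / 2) {M L : Set (E 2)} (h : Good D M L) :
    2 * π - 6 * beta0 D * Real.sin D ≤ sig.real L := by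
  have hc0 : 0 < Real.cos D := Real.cos_pos_of_mem_Ioo ⟨by linarith, hD⟩
  have hs0 : 0 < Real.sin D := Real.sin_pos_of_pos_of_lt_pi hD0 (by linarith [Real.pi_pos])
  have k1 := Good.ineq hD0 hD h
  have k2 := mul_le_mul_of_nonneg_right (lowM hD0 hD h) hs0.le
  have : (2 * π - 6 * beta0 D * Real.sin D) * (1 + Real.cos D) ≤ sig.real L * (1 + Real.cos D) := by nlinarith
  exact le_of_mul_le_mul_right this (by linarith)

lemma reg_of_centers {x y z : E 2} {D : ℝ} (hD0 : 0 < D) (hD : D < π / 2) (h : IsRegularCenters x y z D) :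
    Reg (Real.cos D) (x + y + z) x y z := by
  obtain ⟨hx, hy, hz, h1, h2, h3⟩ := h
  have hx := mem_us.1 hx
  have hy := mem_us.1 hy
  have hz := mem_us.1 hz
  refine ⟨inner_self_us hx, inner_self_us hy, inner_self_us hz, ?_, ?_, ?_, rfl⟩
  · rw [← h1]; exact (Real.cos_arccos (neg_one_le_inner' hx hy) (inner_le_one' hx hy)).symm
  · rw [← h2]; exact (Real.cos_arccos (neg_one_le_inner' hy hz) (inner_le_one' hy hz)).symm
  · rw [← h3]; exact (Real.cos_arccos (neg_one_le_inner' hx hz) (inner_le_one' hx hz)).symm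

lemma area_min {w : ℝ} (hw1 : π / 2 < w) (hw2 : w < π) {x y z : E 2} (hx : IsRegularCenters x y z (π - w)) {L : Set (E 2)}
    (hL : IsReduced L) (hw : width L = w) : area (polarReuleaux x y z w) ≤ area L := by
  have hD0 : 0 < π - w := by linarith
  have hD : π - w < π / 2 := by linarith
  have hR := reg_of_centers hD0 hD hx
  have hG := reduced_good hw1 hw2 hL hw
  obtain ⟨κ, hκ, hk⟩ := exists_kappa
  have hWS : WW (Real.cos (π - w)) x y z ⊆ unitSphere 2 := fun v hv => hv.1
  refine (area_mono (polarReuleaux_sub hD0 hD hR (by ring)) hWS).trans ?_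
  rw [hk _ (meas_WW _ _ _ _) hWS, hk _ hL.1.2.1.isClosed.measurableSet hL.1.1.1]
  apply mul_le_mul_of_nonneg_left _ hκ.le
  exact (sig_WW hD0 hD hR).trans (sig_L_ge hD0 hD hG)


lemma ball_sub_cone {q e : E 2} {ρ : ℝ} (hq : ‖q‖ = 1) (h0 : 0 < ρ) (h1 : ρ < π / 2) (he : ‖e‖ ≤ Real.sin ρ) :
    q + e ≠ 0 ∧ nrm (q + e) ∈ gball q ρ := by
  have hc0 : 0 < Real.cos ρ := Real.cos_pos_of_mem_Ioo ⟨by linarith, h1⟩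
  have hs0 : 0 < Real.sin ρ := Real.sin_pos_of_pos_of_lt_pi h0 (by linarith [Real.pi_pos])
  have sc := Real.sin_sq_add_cos_sq ρ
  have hs1 : Real.sin ρ < 1 := by nlinarith
  have hne : q + e ≠ 0 := by
    intro h
    have : e = -q := by rw [eq_neg_iff_add_eq_zero, add_comm]; exact h
    rw [this, norm_neg, hq] at he
    linarith
  refine ⟨hne, ?_⟩
  have hn := norm_nrm hne
  rw [gball_eq hq h0.le (by linarith [Real.pi_pos])]
  refine ⟨mem_us.2 hn, ?_⟩
  have hp : 0 < ‖q + e‖ := norm_pos_iff.2 hne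
  unfold nrm
  rw [real_inner_smul_right, inner_add_right, inner_self_us hq, ← div_eq_inv_mul, le_div_iff₀ hp]
  have hab : |⟪q, e⟫| ≤ ‖e‖ := by have := abs_real_inner_le_norm q e; rwa [hq, one_mul] at this
  have hab2 := neg_le_of_abs_le hab
  apply le_of_sq_le_sq _ (by linarith)
  have e1 : ‖q + e‖ ^ 2 = 1 + 2 * ⟪q, e⟫ + ‖e‖ ^ 2 := by rw [norm_add_sq_real, hq]; ring
  have e2 : ‖e‖ ^ 2 ≤ Real.sin ρ ^ 2 := pow_le_pow_left₀ (norm_nonneg _) he 2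
  rw [mul_pow, e1]
  have e3 : Real.cos ρ ^ 2 = 1 - Real.sin ρ ^ 2 := by linarith
  have e4 := mul_le_mul_of_nonneg_left e2 (sq_nonneg (Real.cos ρ))
  rw [e3] at e4 ⊢
  nlinarith [sq_nonneg (⟪q, e⟫ + Real.sin ρ ^ 2)]

lemma sdist_le {x y : E 2} {A : Set (E 2)} (hy : y ∈ A) : sdist x A ≤ gdist x y := by
  apply csInf_le
  · refine ⟨0, ?_⟩
    rintro _ ⟨z, _, rfl⟩
    exact Real.arccos_nonneg _
  · exact ⟨y, hy, rfl⟩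

set_option maxHeartbeats 1000000 in
lemma point_bound {K L : Set (E 2)} {q : E 2} {ρ : ℝ} (h0 : 0 < ρ) (h1 : ρ < π / 2) (hK : IsConvexBody K) (hL : IsConvexBody L)
    (hLK : L ⊆ K) (hq : ‖q‖ = 1) (hqL : gball q ρ ⊆ L) {x : E 2} (hx : x ∈ K) :
    ∃ t : ℝ, 0 ≤ t ∧ t ≤ π ∧ sdist x L ≤ 4 * π / Real.sin ρ * t ∧ 2 * π * (1 - Real.cos t) ≤ sig.real (K \ L) := by
  have hpi := Real.pi_pos
  have hs0 : 0 < Real.sin ρ := Real.sin_pos_of_pos_of_lt_pi h0 (by linarith)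
  have hs1 : Real.sin ρ ≤ 1 := Real.sin_le_one ρ
  have hxn := mem_us.1 (hK.1.1 hx)
  have hCL := coneOver_ccone hL.1 hL.2.1 hL.nonempty
  have hCK := coneOver_ccone hK.1 hK.2.1 hK.nonempty
  obtain ⟨f, hf, n, hfn, hort, hn⟩ := hCL.moreau x
  by_cases hn0 : n = 0
  · rw [hn0, add_zero] at hfn
    rw [← hfn] at hf
    have hxL := coneOver_inter hL.1.1 hxn hf
    refine ⟨0, le_rfl, hpi.le, ?_, ?_⟩
    · have := sdist_le (x := x) hxL
      unfold gdist at this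
      rw [inner_self_us hxn, Real.arccos_one] at this
      simpa using this
    · simp
  have hs : 0 < ‖n‖ := norm_pos_iff.2 hn0
  have hfs : ‖f‖ ^ 2 + ‖n‖ ^ 2 = 1 := by
    have : ‖x‖ ^ 2 = ‖f‖ ^ 2 + ‖n‖ ^ 2 := by rw [hfn, norm_add_sq_real, hort]; ring
    rw [← this, hxn]; norm_num
  have hsle : ‖n‖ ≤ 1 := by nlinarith [norm_nonneg f]
  set s := ‖n‖ with hsdef
  have hmn := norm_nrm hn0
  set m := nrm n with hm
  have hnm : n = s • m := (norm_smul_nrm n).symm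
  have hxm : ⟪x, m⟫ = s := by
    have : ⟪x, n⟫ = s ^ 2 := by rw [hfn, inner_add_left, hort, real_inner_self_eq_norm_sq, zero_add]
    rw [hm]; unfold nrm; rw [real_inner_smul_right, this, ← hsdef]; field_simp
  have hLm : ∀ y ∈ L, ⟪y, m⟫ ≤ 0 := by
    intro y hy
    rw [hm]; unfold nrm; rw [real_inner_smul_right]
    exact mul_nonpos_of_nonneg_of_nonpos (by positivity) (hn y ⟨1, zero_le_one, y, hy, by simp⟩)
  have hqm : -1 ≤ ⟪q, m⟫ := neg_one_le_inner' hq hmn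
  have hsd : sdist x L ≤ π * s := by
    by_cases hf0 : f = 0
    · have : s = 1 := by
        rw [hf0] at hfs; simp at hfs
        rcases hfs with h | h
        · exact h
        · linarith
      obtain ⟨y, hy⟩ := hL.nonempty
      rw [this, mul_one]
      exact (sdist_le hy).trans (Real.arccos_le_pi _)
    · have hfp : 0 < ‖f‖ := norm_pos_iff.2 hf0
      have hfL : nrm f ∈ L := coneOver_inter hL.1.1 (norm_nrm hf0) (hCL.smul _ (by positivity) _ hf)
      refine (sdist_le hfL).trans ?_
      have hi : ⟪x, nrm f⟫ = ‖f‖ := by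
        unfold nrm
        rw [real_inner_smul_right, hfn, inner_add_left, real_inner_self_eq_norm_sq, real_inner_comm, hort]
        field_simp; ring
      unfold gdist
      rw [hi]
      have k := Real.mul_le_sin (Real.arccos_nonneg ‖f‖) (Real.arccos_le_pi_div_two.2 (norm_nonneg f))
      rw [Real.sin_arccos, show 1 - ‖f‖ ^ 2 = s ^ 2 by linarith, Real.sqrt_sq hs.le, div_mul_eq_mul_div, div_le_iff₀ hpi] at k
      nlinarith [Real.arccos_nonneg ‖f‖]
  -- the small ball
  obtain ⟨l, hl⟩ : ∃ l, l = s / 4 := ⟨_, rfl⟩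
  have hl0 : 0 < l := by linarith
  obtain ⟨p, hp⟩ : ∃ p, p = (1 - l) • x + l • q := ⟨_, rfl⟩
  have hpm : s / 2 ≤ ⟪p, m⟫ := by
    rw [hp, inner_add_left, real_inner_smul_left, real_inner_smul_left, hxm]
    nlinarith
  have hp0 : p ≠ 0 := by
    intro h; rw [h, inner_zero_left] at hpm; linarith
  have hpp : 0 < ‖p‖ := norm_pos_iff.2 hp0
  have hp1 : ‖p‖ ≤ 1 := by
    rw [hp]
    refine (norm_add_le _ _).trans ?_
    rw [norm_smul, norm_smul, hxn, hq, Real.norm_of_nonneg (by linarith), Real.norm_of_nonneg hl0.le]; linarith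
  have hpn := norm_nrm hp0
  have hpm' : s / 2 ≤ ⟪nrm p, m⟫ := by
    refine hpm.trans ?_
    unfold nrm
    rw [real_inner_smul_left]
    exact le_mul_of_one_le_left (by linarith) ((one_le_inv₀ hpp).2 hp1)
  obtain ⟨t, ht⟩ : ∃ t, t = l * Real.sin ρ := ⟨_, rfl⟩
  have ht0 : 0 < t := by rw [ht]; positivity
  have htl : t ≤ l := by rw [ht]; exact mul_le_of_le_one_right hl0.le hs1
  have htpi : t ≤ π := by linarith [Real.pi_gt_three]
  refine ⟨t, ht0.le, htpi, ?_, ?_⟩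
  · have : 4 * π / Real.sin ρ * t = π * s := by rw [ht, hl]; field_simp
    rw [this]; exact hsd
  rw [← sig_gball hpn ht0.le htpi]
  refine measureReal_mono ?_
  rw [gball_eq hpn ht0.le htpi]
  rintro z ⟨hz, hz2⟩
  have hzn := mem_us.1 hz
  have hdz : ‖z - nrm p‖ ≤ t := by
    apply le_of_sq_le_sq _ ht0.le
    rw [norm_sub_sq_real, hzn, hpn, real_inner_comm]
    have := Real.one_sub_sq_div_two_le_cos (x := t)
    linarith
  constructor
  · -- membership in K
    obtain ⟨e, he⟩ : ∃ e, e = (‖p‖ / l) • (z - nrm p) := ⟨_, rfl⟩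
    have hen : ‖e‖ ≤ Real.sin ρ := by
      rw [he, norm_smul, Real.norm_of_nonneg (by positivity)]
      calc ‖p‖ / l * ‖z - nrm p‖ ≤ 1 / l * t := by gcongr
        _ = Real.sin ρ := by rw [ht]; field_simp
    obtain ⟨b1, b2⟩ := ball_sub_cone hq h0 h1 hen
    have hy : q + e ∈ coneOver K := ⟨‖q + e‖, norm_nonneg _, nrm (q + e), hLK (hqL b2), (norm_smul_nrm _).symm⟩
    have hxc : x ∈ coneOver K := ⟨1, zero_le_one, x, hx, by simp⟩
    have hsum := hCK.add _ (hCK.smul (1 - l) (by linarith) _ hxc) _ (hCK.smul l hl0.le _ hy)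
    have hzz : z = ‖p‖⁻¹ • ((1 - l) • x + l • (q + e)) := by
      have : (1 - l) • x + l • (q + e) = ‖p‖ • z := by
        rw [smul_add, ← add_assoc, ← hp, he, smul_smul, mul_div_cancel₀ _ hl0.ne', smul_sub, norm_smul_nrm]; abel
      rw [this, smul_smul, inv_mul_cancel₀ hpp.ne', one_smul]
    apply coneOver_inter hK.1.1 hzn
    rw [hzz]
    exact hCK.smul _ (by positivity) _ hsum
  · intro hzL
    have h2 := hLm z hzL
    have h3 : ⟪z, m⟫ = ⟪nrm p, m⟫ + ⟪z - nrm p, m⟫ := by rw [inner_sub_left]; ring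
    have h4 := neg_le_of_abs_le (abs_real_inner_le_norm (z - nrm p) m)
    rw [hmn, mul_one] at h4
    linarith

theorem final (w : ℝ) (hw1 : π / 2 < w) (hw2 : w < π)
    (x₁ x₂ x₃ : E 2) (hx : IsRegularCenters x₁ x₂ x₃ (π - w)) :
    ∃ c > 0, ∀ ε > 0, ∀ K L : Set (E 2),
      IsConvexBody K → width K = w →
      area K ≤ area (polarReuleaux x₁ x₂ x₃ w) + ε →
      IsReduced L → L ⊆ K → width L = width K →
      hausdorffG K L ≤ c * Real.sqrt ε := by
  have hpi := Real.pi_pos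
  have hD0 : 0 < π - w := by linarith
  have hD : π - w < π / 2 := by linarith
  obtain ⟨κ, hκ, hk⟩ := exists_kappa
  obtain ⟨ρ, hρ⟩ : ∃ ρ, ρ = π / 2 - (π - w) := ⟨_, rfl⟩
  have hρ0 : 0 < ρ := by linarith
  have hρ1 : ρ < π / 2 := by linarith
  have hs0 : 0 < Real.sin ρ := Real.sin_pos_of_pos_of_lt_pi hρ0 (by linarith)
  refine ⟨4 * π / Real.sin ρ * √(π / (4 * κ)), by positivity, ?_⟩
  intro ε hε K L hK hwK hA hL hLK hwL
  have hw : width L = w := hwL.trans hwK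
  have hG := reduced_good hw1 hw2 hL hw
  have hmin := area_min hw1 hw2 hx hL hw
  have hLm := hL.1.2.1.isClosed.measurableSet
  have hsig : sig.real (K \ L) ≤ ε / κ := by
    rw [measureReal_diff hLK hLm, le_div_iff₀ hκ]
    rw [hk _ hK.2.1.isClosed.measurableSet hK.1.1] at hA
    rw [hk _ hLm hL.1.1.1] at hmin
    linarith
  obtain ⟨p, hp⟩ := hG.ne
  have hball := hG.ball_sub hD0 hD hp
  rw [← hρ] at hball
  have hqn : ‖-p‖ = 1 := by rw [norm_neg]; exact mem_us.1 (hG.MS hp)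
  have hR : 0 ≤ 4 * π / Real.sin ρ * √(π / (4 * κ)) * √ε := by positivity
  unfold hausdorffG
  apply max_le
  · apply Real.sSup_le _ hR
    rintro _ ⟨x, hxK, rfl⟩
    obtain ⟨t, ht0, ht1, ht2, ht3⟩ := point_bound hρ0 hρ1 hK hL.1 hLK hqn hball hxK
    refine ht2.trans ?_
    rw [mul_assoc (4 * π / Real.sin ρ), ← Real.sqrt_mul (by positivity)]
    apply mul_le_mul_of_nonneg_left _ (by positivity)
    apply Real.le_sqrt_of_sq_le
    have k := Real.cos_le_one_sub_mul_cos_sq (x := t) (by rw [abs_of_nonneg ht0]; exact ht1)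
    have k2 : 2 * π * (2 / π ^ 2 * t ^ 2) ≤ ε / κ := by
      refine le_trans ?_ (ht3.trans hsig)
      apply mul_le_mul_of_nonneg_left _ (by positivity)
      linarith
    have e1 : 2 * π * (2 / π ^ 2 * t ^ 2) = 4 / π * t ^ 2 := by field_simp; ring
    have e2 : π / (4 * κ) * ε = π / 4 * (ε / κ) := by field_simp
    rw [e2]
    rw [e1] at k2
    calc t ^ 2 = π / 4 * (4 / π * t ^ 2) := by field_simp
      _ ≤ _ := by gcongr
  · apply Real.sSup_le _ hR
    rintro _ ⟨y, hy, rfl⟩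
    refine (sdist_le (hLK hy)).trans ?_
    unfold gdist
    rw [inner_self_us (mem_us.1 (hL.1.1.1 hy)), Real.arccos_one]
    exact hR


end SphericalPal

/-- a convex body of width `w > π/2` whose area exceeds the minimum by at
most `ε` is at Hausdorff distance at most `c_w·√ε` from any of its reductions. -/
theorem reduction_distance (w : ℝ) (hw1 : π / 2 < w) (hw2 : w < π)
    (x₁ x₂ x₃ : E 2) (hx : IsRegularCenters x₁ x₂ x₃ (π - w)) :
    ∃ c > 0, ∀ ε > 0, ∀ K L : Set (E 2),
      IsConvexBody K → width K = w →
      area K ≤ area (polarReuleaux x₁ x₂ x₃ w) + ε →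
      IsReduced L → L ⊆ K → width L = width K →
      hausdorffG K L ≤ c * Real.sqrt ε := by
  exact SphericalPal.final w hw1 hw2 x₁ x₂ x₃ hx
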